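/- arXiv:1905.04179 — 2 statements merged into one kernel-verified Lean document; each statement's English description precedes it below -/
import Mathlib

section
/- For every ε > 0 there exist constants C_ε > 0 and c > 0 such that the following holds. Let p be a prime and A ⊆ F_p a finite set with |A−A|·|A|·|A²−A²| ≤ c·p². Then E₄(A²) ≤ C_ε·p^{ε}·|A−A|³·|A| (equivalently, E₄(A²) ≲ |A|⁴·M³ with M := |A−A|/|A|). -/
open Finset Pointwise

namespace FpSumProd

/-- `A² = {a² : a ∈ A}`. -/
def sqSet {p : ℕ} (A : Finset (ZMod p)) : Finset (ZMod p) := A.image fun a => a ^ 2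

/-- `A² - A² = {a² - b² : a, b ∈ A}` (here `A - B` denotes the pointwise difference set). -/
def sqDiff {p : ℕ} (A : Finset (ZMod p)) : Finset (ZMod p) := sqSet A - sqSet A

/-- `r_{A²-A²}(x)`: the number of pairs `(y, z) ∈ A² × A²` with `y - z = x`. -/
def rep {p : ℕ} (A : Finset (ZMod p)) (x : ZMod p) : ℕ :=
  ((sqSet A ×ˢ sqSet A).filter fun q => q.1 - q.2 = x).card

/-- `P = {x ∈ A²-A² : r_{A²-A²}(x) ≥ |A|²/(2·|A²-A²|)}`, i.e. `r_{A²-A²}(x) ≥ |A|/(2K)`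
with `K = |A²-A²|/|A|`. -/
noncomputable def popular {p : ℕ} (A : Finset (ZMod p)) : Finset (ZMod p) :=
  (sqDiff A).filter fun x =>
    (A.card : ℝ) ^ 2 / (2 * ((sqDiff A).card : ℝ)) ≤ (rep A x : ℝ)

/-- `P_w = (A²-A²) ∩ (P - w)` where `P - w = {x - w : x ∈ P}`. -/
noncomputable def Pw {p : ℕ} (A : Finset (ZMod p)) (w : ZMod p) : Finset (ZMod p) :=
  sqDiff A ∩ ((popular A).image fun x => x - w)

/-- `T_w = #{(u, v) ∈ P_w × P_w : u - v ∈ P}`. -/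
noncomputable def Tw {p : ℕ} (A : Finset (ZMod p)) (w : ZMod p) : ℕ :=
  ((Pw A w ×ˢ Pw A w).filter fun q => q.1 - q.2 ∈ popular A).card

/-- `X = Σ_{w ∈ A²-A²} #{(u, v) ∈ P_w × P_w : u - v ∈ P}`. -/
noncomputable def Xsum {p : ℕ} (A : Finset (ZMod p)) : ℕ :=
  ∑ w ∈ sqDiff A, Tw A w

/-- `E₄(A²)`: the number of `8`-tuples `(x₁,x₂,x₃,x₄,y₁,y₂,y₃,y₄) ∈ (A²)⁸` with
`x₁ - y₁ = x₂ - y₂ = x₃ - y₃ = x₄ - y₄`. -/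
noncomputable def E4 {p : ℕ} (A : Finset (ZMod p)) : ℕ :=
  Set.ncard {v : Fin 4 → ZMod p × ZMod p |
    (∀ i, (v i).1 ∈ sqSet A ∧ (v i).2 ∈ sqSet A) ∧
    ∀ i, (v i).1 - (v i).2 = (v 0).1 - (v 0).2}

open Polynomial in
theorem resultant_ne_zero_of_irreducible {S : Type*} [CommRing S] [IsDomain S] [IsGCDMonoid S]
    {f g : S[X]} (hf : Irreducible f) (hf0 : f.natDegree ≠ 0) (hfg : ¬ f ∣ g) :
    f.resultant g ≠ 0 := by
  have hprim := hf.isPrimitive hf0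
  let L := FractionRing S
  have hinj : Function.Injective (algebraMap S L) := IsFractionRing.injective S L
  have hirr : Irreducible (f.map (algebraMap S L)) :=
    hprim.irreducible_iff_irreducible_map_fraction_map.1 hf
  have hcop : IsCoprime (f.map (algebraMap S L)) (g.map (algebraMap S L)) :=
    (hirr.coprime_iff_not_dvd).2 fun h =>
      hfg (hprim.dvd_of_fraction_map_dvd_fraction_map h)
  have h1 := resultant_ne_zero _ _ hcop
  intro h
  apply h1
  rw [natDegree_map_eq_of_injective hinj, natDegree_map_eq_of_injective hinj,
    resultant_map_map, h, map_zero]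

open Polynomial in
theorem natDegree_resultant_le {K : Type*} [CommRing K] (f g : K[X][X]) (m n d e : ℕ)
    (hf : ∀ i, (f.coeff i).natDegree ≤ d) (hg : ∀ i, (g.coeff i).natDegree ≤ e) :
    (f.resultant g m n).natDegree ≤ m * e + n * d := by
  rw [resultant, Matrix.det_apply]
  refine natDegree_sum_le_of_forall_le _ _ fun σ _ => ?_
  refine (natDegree_smul_le _ _).trans ((natDegree_prod_le _ _).trans ?_)
  rw [Fin.sum_univ_add]
  refine add_le_add ?_ ?_
  · calc _ ≤ ∑ i : Fin m, e := by
          refine sum_le_sum fun i _ => ?_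
          simp only [sylvester, Matrix.of_apply, Fin.addCases_left]
          split_ifs
          · exact hg _
          · simp
      _ = _ := by simp
  · calc _ ≤ ∑ i : Fin n, d := by
          refine sum_le_sum fun i _ => ?_
          simp only [sylvester, Matrix.of_apply, Fin.addCases_right]
          split_ifs
          · exact hf _
          · simp
      _ = _ := by simp

open MvPolynomial in
/-- Trivariate polynomials as iterated univariate ones; the variable `0` is the outermost one. -/
noncomputable def toIterated (K : Type*) [Field K] :
    MvPolynomial (Fin 3) K →ₐ[K] Polynomial (Polynomial (Polynomial K)) :=
  aeval (![Polynomial.X, Polynomial.C Polynomial.X, Polynomial.C (Polynomial.C Polynomial.X)] :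
    Fin 3 → Polynomial (Polynomial (Polynomial K)))

/-- A polynomial in the variables `2` (inner) and `1` (outer), as a trivariate polynomial. -/
noncomputable def ofBivariate (K : Type*) [Field K] :
    Polynomial (Polynomial K) →+* MvPolynomial (Fin 3) K :=
  Polynomial.eval₂RingHom (Polynomial.aeval (MvPolynomial.X 2)).toRingHom (MvPolynomial.X 1)

noncomputable def ofIterated (K : Type*) [Field K] :
    Polynomial (Polynomial (Polynomial K)) →+* MvPolynomial (Fin 3) K :=
  Polynomial.eval₂RingHom (ofBivariate K) (MvPolynomial.X 0)

theorem ofIterated_toIterated {K : Type*} [Field K] (F : MvPolynomial (Fin 3) K) :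
    ofIterated K (toIterated K F) = F := by
  induction F using MvPolynomial.induction_on with
  | C a => simp [toIterated, ofIterated, ofBivariate, Polynomial.algebraMap_apply]
  | add p q hp hq => simp [hp, hq]
  | mul_X p i hp =>
    have hX : ofIterated K (toIterated K (MvPolynomial.X i)) = MvPolynomial.X i := by
      obtain rfl | rfl | rfl : i = 0 ∨ i = 1 ∨ i = 2 := by omega
      all_goals simp [toIterated, ofIterated, ofBivariate]
    rw [map_mul, map_mul, hp, hX]

theorem toIterated_ofIterated {K : Type*} [Field K]
    (f : Polynomial (Polynomial (Polynomial K))) : toIterated K (ofIterated K f) = f := by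
  have h : ((toIterated K).toRingHom.comp (ofIterated K)) = RingHom.id _ := by
    ext <;> simp [toIterated, ofIterated, ofBivariate, Polynomial.algebraMap_apply]
  exact congrArg (fun φ => φ f) h

noncomputable def iteratedEquiv (K : Type*) [Field K] :
    MvPolynomial (Fin 3) K ≃+* Polynomial (Polynomial (Polynomial K)) :=
  RingEquiv.ofRingHom (toIterated K).toRingHom (ofIterated K)
    (RingHom.ext toIterated_ofIterated) (RingHom.ext ofIterated_toIterated)

theorem toIterated_monomial {K : Type*} [Field K] (s : Fin 3 →₀ ℕ) (a : K) :
    toIterated K (MvPolynomial.monomial s a) =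
      Polynomial.monomial (s 0) (Polynomial.monomial (s 1) (Polynomial.monomial (s 2) a)) := by
  simp only [toIterated, MvPolynomial.aeval_monomial]
  rw [Finsupp.prod_fintype _ _ (by simp)]
  simp [Fin.prod_univ_three, ← Polynomial.C_mul_X_pow_eq_monomial, Polynomial.algebraMap_apply]
  ring

theorem le_totalDegree_of_mem_support {K : Type*} [Field K] {F : MvPolynomial (Fin 3) K}
    {s : Fin 3 →₀ ℕ} (hs : s ∈ F.support) : s 0 ≤ F.totalDegree ∧ s 1 ≤ F.totalDegree := by
  have h := MvPolynomial.le_totalDegree hs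
  rw [Finsupp.sum_fintype _ _ (by simp), Fin.sum_univ_three] at h
  omega

theorem natDegree_toIterated_le {K : Type*} [Field K] (F : MvPolynomial (Fin 3) K) :
    (toIterated K F).natDegree ≤ F.totalDegree := by
  conv_lhs => rw [F.as_sum, map_sum]
  refine Polynomial.natDegree_sum_le_of_forall_le _ _ fun s hs => ?_
  rw [toIterated_monomial]
  exact (Polynomial.natDegree_monomial_le _).trans (le_totalDegree_of_mem_support hs).1

theorem natDegree_coeff_toIterated_le {K : Type*} [Field K] (F : MvPolynomial (Fin 3) K) (i : ℕ) :
    ((toIterated K F).coeff i).natDegree ≤ F.totalDegree := by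
  conv_lhs => rw [F.as_sum, map_sum, Polynomial.finsetSum_coeff]
  refine Polynomial.natDegree_sum_le_of_forall_le _ _ fun s hs => ?_
  rw [toIterated_monomial, Polynomial.coeff_monomial]
  split_ifs
  · exact (Polynomial.natDegree_monomial_le _).trans (le_totalDegree_of_mem_support hs).2
  · simp

/-- Elimination of the variable `0` from two coprime trivariate polynomials. -/
theorem exists_eliminant {K : Type*} [Field K] {F G : MvPolynomial (Fin 3) K}
    (hF : Irreducible F) (hFG : ¬ F ∣ G) :
    ∃ r : Polynomial (Polynomial K), r ≠ 0 ∧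
      r.natDegree ≤ F.totalDegree * (2 * G.totalDegree + 1) ∧
      ∃ u v, ofBivariate K r = F * u + G * v := by
  have hirr : Irreducible (toIterated K F) := (MulEquiv.irreducible_iff (iteratedEquiv K)).2 hF
  have hndvd : ¬ toIterated K F ∣ toIterated K G := fun h =>
    hFG ((map_dvd_iff (iteratedEquiv K)).1 h)
  have hC : ∀ r, ofIterated K (Polynomial.C r) = ofBivariate K r := fun r => by simp [ofIterated]
  by_cases h0 : (toIterated K F).natDegree = 0
  · have hconst := Polynomial.eq_C_of_natDegree_eq_zero h0
    refine ⟨(toIterated K F).coeff 0, fun h => ?_, ?_, 1, 0, ?_⟩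
    · rw [h, map_zero] at hconst
      exact hirr.ne_zero hconst
    · refine (natDegree_coeff_toIterated_le F 0).trans ?_
      exact Nat.le_mul_of_pos_right _ (by omega)
    · rw [← hC, ← hconst, ofIterated_toIterated]
      ring
  · refine ⟨_, resultant_ne_zero_of_irreducible hirr h0 hndvd, ?_, ?_⟩
    · refine (natDegree_resultant_le _ _ _ _ F.totalDegree G.totalDegree
        (natDegree_coeff_toIterated_le F) (natDegree_coeff_toIterated_le G)).trans ?_
      have h1 := natDegree_toIterated_le F
      have h2 := natDegree_toIterated_le G
      nlinarith [Nat.mul_le_mul_right G.totalDegree h1, Nat.mul_le_mul_right F.totalDegree h2]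
    · obtain ⟨u, v, -, -, h⟩ := Polynomial.exists_mul_add_mul_eq_C_resultant
        (toIterated K F) (toIterated K G) le_rfl le_rfl (Or.inl h0)
      refine ⟨ofIterated K u, ofIterated K v, ?_⟩
      rw [← hC, ← h, map_add, map_mul, map_mul, ofIterated_toIterated, ofIterated_toIterated]

/-- The point `(x, y, z)` and the plane with parameters `(b, a, c)` are incident. -/
def Incident {K : Type*} [Field K] (q π : K × K × K) : Prop :=
  q.2.1 * π.1 + q.2.2 = π.2.1 * q.1 + π.2.2

/-- Restriction of a polynomial in `(Z, Y, X)` to the line `X = x`, `Z = y * Y + z`. -/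
noncomputable def restrictPoint {K : Type*} [Field K] (q : K × K × K) :
    MvPolynomial (Fin 3) K →ₐ[K] Polynomial K :=
  MvPolynomial.aeval (![Polynomial.C q.2.1 * Polynomial.X + Polynomial.C q.2.2, Polynomial.X,
    Polynomial.C q.1] : Fin 3 → Polynomial K)

/-- Restriction of a polynomial in `(Z, Y, X)` to the line `Y = b`, `Z = a * X + c`. -/
noncomputable def restrictPlane {K : Type*} [Field K] (π : K × K × K) :
    MvPolynomial (Fin 3) K →ₐ[K] Polynomial K :=
  MvPolynomial.aeval (![Polynomial.C π.2.1 * Polynomial.X + Polynomial.C π.2.2,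
    Polynomial.C π.1, Polynomial.X] : Fin 3 → Polynomial K)

section Restrict

variable {K : Type*} [Field K]

theorem natDegree_restrictPoint_le (q : K × K × K) (F : MvPolynomial (Fin 3) K) :
    (restrictPoint q F).natDegree ≤ F.totalDegree := by
  have h := MvPolynomial.aeval_natDegree_le (n := 1) F le_rfl
    (![Polynomial.C q.2.1 * Polynomial.X + Polynomial.C q.2.2, Polynomial.X,
    Polynomial.C q.1] : Fin 3 → Polynomial K) (by
      intro i
      obtain rfl | rfl | rfl : i = 0 ∨ i = 1 ∨ i = 2 := by omega
      · exact Polynomial.natDegree_linear_le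
      · simp
      · simp)
  simpa [restrictPoint] using h

theorem natDegree_restrictPlane_le (π : K × K × K) (F : MvPolynomial (Fin 3) K) :
    (restrictPlane π F).natDegree ≤ F.totalDegree := by
  have h := MvPolynomial.aeval_natDegree_le (n := 1) F le_rfl
    (![Polynomial.C π.2.1 * Polynomial.X + Polynomial.C π.2.2, Polynomial.C π.1,
    Polynomial.X] : Fin 3 → Polynomial K) (by
      intro i
      obtain rfl | rfl | rfl : i = 0 ∨ i = 1 ∨ i = 2 := by omega
      · exact Polynomial.natDegree_linear_le
      · simp
      · simp)
  simpa [restrictPlane] using h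

theorem eval_restrictPlane_eq {q π : K × K × K} (h : Incident q π)
    (F : MvPolynomial (Fin 3) K) :
    (restrictPlane π F).eval q.1 = (restrictPoint q F).eval π.1 := by
  unfold Incident at h
  induction F using MvPolynomial.induction_on with
  | C a => simp [restrictPlane, restrictPoint]
  | add f g hf hg => simp [hf, hg]
  | mul_X f i hf =>
    have hX : (restrictPlane π (MvPolynomial.X i)).eval q.1 =
        (restrictPoint q (MvPolynomial.X i)).eval π.1 := by
      obtain rfl | rfl | rfl : i = 0 ∨ i = 1 ∨ i = 2 := by omega
      all_goals simp [restrictPlane, restrictPoint, h]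
    rw [map_mul, map_mul, Polynomial.eval_mul, Polynomial.eval_mul, hf, hX]

theorem card_filter_eval_fst_le {S : Finset (K × K × K)}
    (hS : Set.InjOn Prod.fst (S : Set (K × K × K))) {P : Polynomial K} (hP : P ≠ 0)
    (hroot : ∀ q ∈ S, P.eval q.1 = 0) :
    S.card ≤ P.natDegree := by
  classical
  rw [← card_image_of_injOn hS]
  refine Polynomial.card_le_degree_of_subset_roots fun x hx => ?_
  obtain ⟨q, hq, rfl⟩ := mem_image.1 (Finset.mem_def.2 hx)
  exact (Polynomial.mem_roots hP).2 (hroot q hq)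

theorem restrictPlane_ofBivariate (π : K × K × K) (r : Polynomial (Polynomial K)) :
    restrictPlane π (ofBivariate K r) = r.eval (Polynomial.C π.1) := by
  have h : (restrictPlane π).toRingHom.comp (ofBivariate K) =
      Polynomial.evalRingHom (Polynomial.C π.1) := by
    ext <;> simp [restrictPlane, ofBivariate]
  exact congrArg (fun φ => φ r) h

/-- A weak Bézout bound for lines contained in two surfaces. -/
theorem card_common_planes_le {F G : MvPolynomial (Fin 3) K} (hF : Irreducible F)
    (hFG : ¬ F ∣ G) {T : Finset (K × K × K)} (hT : Set.InjOn Prod.fst (T : Set (K × K × K)))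
    (h : ∀ π ∈ T, restrictPlane π F = 0 ∧ restrictPlane π G = 0) :
    T.card ≤ F.totalDegree * (2 * G.totalDegree + 1) := by
  classical
  obtain ⟨r, hr, hdeg, u, v, huv⟩ := exists_eliminant hF hFG
  refine le_trans ?_ hdeg
  have hinj : Set.InjOn (fun π : K × K × K => Polynomial.C π.1) (T : Set (K × K × K)) :=
    fun π hπ π' hπ' heq => hT hπ hπ' (Polynomial.C_injective heq)
  rw [← card_image_of_injOn hinj]
  refine Polynomial.card_le_degree_of_subset_roots fun x hx => ?_
  obtain ⟨π, hπ, rfl⟩ := mem_image.1 (Finset.mem_def.2 hx)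
  refine (Polynomial.mem_roots hr).2 ?_
  rw [Polynomial.IsRoot, ← restrictPlane_ofBivariate, huv, map_add, map_mul, map_mul,
    (h π hπ).1, (h π hπ).2]
  simp

theorem derivative_restrictPoint (q : K × K × K) (F : MvPolynomial (Fin 3) K) :
    Polynomial.derivative (restrictPoint q F) = restrictPoint q (MvPolynomial.pderiv 1 F) +
      Polynomial.C q.2.1 * restrictPoint q (MvPolynomial.pderiv 0 F) := by
  induction F using MvPolynomial.induction_on with
  | C a => simp [restrictPoint]
  | add f g hf hg => simp only [map_add, hf, hg]; ring
  | mul_X f i hf =>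
    have hX : Polynomial.derivative (restrictPoint q (MvPolynomial.X i)) =
        restrictPoint q (MvPolynomial.pderiv 1 (MvPolynomial.X i)) +
        Polynomial.C q.2.1 * restrictPoint q (MvPolynomial.pderiv 0 (MvPolynomial.X i)) := by
      obtain rfl | rfl | rfl : i = 0 ∨ i = 1 ∨ i = 2 := by omega
      all_goals simp [restrictPoint, MvPolynomial.pderiv_X]
    rw [map_mul, Polynomial.derivative_mul, hf, hX, MvPolynomial.pderiv_mul,
      MvPolynomial.pderiv_mul]
    simp only [map_add, map_mul]
    ring

end Restrict

section Hessian

variable {K : Type*} [Field K]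

/-- The derivation tangent to the sections `X = const` of the surface `F = 0`. -/
noncomputable def tangent (F : MvPolynomial (Fin 3) K) :
    Derivation K (MvPolynomial (Fin 3) K) (MvPolynomial (Fin 3) K) :=
  MvPolynomial.pderiv 0 F • MvPolynomial.pderiv 1 - MvPolynomial.pderiv 1 F • MvPolynomial.pderiv 0

theorem tangent_apply (F f : MvPolynomial (Fin 3) K) :
    tangent F f = MvPolynomial.pderiv 0 F * MvPolynomial.pderiv 1 f -
      MvPolynomial.pderiv 1 F * MvPolynomial.pderiv 0 f := by
  simp [tangent]

theorem tangent_self (F : MvPolynomial (Fin 3) K) : tangent F F = 0 := by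
  rw [tangent_apply]; ring

/-- The Hessian of the sections `X = const` of `F = 0`; it vanishes at inflection points. -/
noncomputable def flex (F : MvPolynomial (Fin 3) K) : MvPolynomial (Fin 3) K :=
  MvPolynomial.pderiv 0 F * tangent F (MvPolynomial.pderiv 1 F) -
    MvPolynomial.pderiv 1 F * tangent F (MvPolynomial.pderiv 0 F)

theorem totalDegree_pderiv_le (i : Fin 3) (F : MvPolynomial (Fin 3) K) :
    (MvPolynomial.pderiv i F).totalDegree ≤ F.totalDegree := by
  conv_lhs => rw [F.as_sum, map_sum]
  refine MvPolynomial.totalDegree_finsetSum_le fun s hs => ?_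
  rw [MvPolynomial.pderiv_monomial]
  refine (MvPolynomial.totalDegree_monomial_le _ _).trans
    (le_trans ?_ (MvPolynomial.le_totalDegree hs))
  rw [Finsupp.sum_fintype _ _ (by simp), Finsupp.sum_fintype _ _ (by simp)]
  exact sum_le_sum fun j _ => by simp

theorem totalDegree_flex_le (F : MvPolynomial (Fin 3) K) :
    (flex F).totalDegree ≤ 3 * F.totalDegree := by
  have h (i : Fin 3) : (MvPolynomial.pderiv i F).totalDegree ≤ F.totalDegree :=
    totalDegree_pderiv_le i F
  have h2 (i j : Fin 3) : (MvPolynomial.pderiv i (MvPolynomial.pderiv j F)).totalDegree ≤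
      F.totalDegree := (totalDegree_pderiv_le i _).trans (h j)
  have hm {f g : MvPolynomial (Fin 3) K} {m n : ℕ} (hf : f.totalDegree ≤ m)
      (hg : g.totalDegree ≤ n) : (f * g).totalDegree ≤ m + n :=
    (MvPolynomial.totalDegree_mul f g).trans (add_le_add hf hg)
  have hs {f g : MvPolynomial (Fin 3) K} {m : ℕ} (hf : f.totalDegree ≤ m)
      (hg : g.totalDegree ≤ m) : (f - g).totalDegree ≤ m :=
    (MvPolynomial.totalDegree_sub f g).trans (max_le hf hg)
  have ht (j : Fin 3) : (tangent F (MvPolynomial.pderiv j F)).totalDegree ≤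
      F.totalDegree + F.totalDegree := by
    rw [tangent_apply]
    exact hs (hm (h _) (h2 _ _)) (hm (h _) (h2 _ _))
  refine (hs (hm (h _) (ht _)) (hm (h _) (ht _))).trans ?_
  omega

theorem restrictPoint_flex {q : K × K × K} {F : MvPolynomial (Fin 3) K}
    (hF : restrictPoint q F = 0) : restrictPoint q (flex F) = 0 := by
  have h1 := derivative_restrictPoint q F
  rw [hF, Polynomial.derivative_zero] at h1
  have hY := derivative_restrictPoint q (MvPolynomial.pderiv 1 F)
  have hZ := derivative_restrictPoint q (MvPolynomial.pderiv 0 F)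
  have hb : restrictPoint q (MvPolynomial.pderiv 1 F) =
      -(Polynomial.C q.2.1 * restrictPoint q (MvPolynomial.pderiv 0 F)) :=
    eq_neg_of_add_eq_zero_left h1.symm
  rw [hb, Polynomial.derivative_neg, Polynomial.derivative_C_mul] at hY
  simp only [flex, tangent_apply, map_sub, map_mul, hb]
  linear_combination (-(restrictPoint q (MvPolynomial.pderiv 0 F)) ^ 2) * hY -
    (restrictPoint q (MvPolynomial.pderiv 0 F)) ^ 2 * Polynomial.C q.2.1 * hZ

/-- Moving the point `(Z, Y, X)` along the tangent direction of the section of `F`. -/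
noncomputable def flow (F : MvPolynomial (Fin 3) K) :
    MvPolynomial (Fin 3) K →ₐ[K] Polynomial (MvPolynomial (Fin 3) K) :=
  MvPolynomial.aeval
    (![Polynomial.C (MvPolynomial.X 0) - Polynomial.X * Polynomial.C (MvPolynomial.pderiv 1 F),
      Polynomial.C (MvPolynomial.X 1) + Polynomial.X * Polynomial.C (MvPolynomial.pderiv 0 F),
      Polynomial.C (MvPolynomial.X 2)] : Fin 3 → Polynomial (MvPolynomial (Fin 3) K))

theorem derivative_flow (F f : MvPolynomial (Fin 3) K) :
    Polynomial.derivative (flow F f) =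
      Polynomial.C (MvPolynomial.pderiv 0 F) * flow F (MvPolynomial.pderiv 1 f) -
      Polynomial.C (MvPolynomial.pderiv 1 F) * flow F (MvPolynomial.pderiv 0 f) := by
  induction f using MvPolynomial.induction_on with
  | C a => simp [flow, Polynomial.algebraMap_apply]
  | add f g hf hg => simp only [map_add, hf, hg]; ring
  | mul_X f i hf =>
    have hX : Polynomial.derivative (flow F (MvPolynomial.X i)) =
        Polynomial.C (MvPolynomial.pderiv 0 F) *
          flow F (MvPolynomial.pderiv 1 (MvPolynomial.X i)) -
        Polynomial.C (MvPolynomial.pderiv 1 F) *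
          flow F (MvPolynomial.pderiv 0 (MvPolynomial.X i)) := by
      obtain rfl | rfl | rfl : i = 0 ∨ i = 1 ∨ i = 2 := by omega
      all_goals simp [flow, MvPolynomial.pderiv_X]
    rw [map_mul, Polynomial.derivative_mul, hf, hX, MvPolynomial.pderiv_mul,
      MvPolynomial.pderiv_mul]
    simp only [map_add, map_mul]
    ring

/-- The tangent derivation applied to every coefficient. -/
noncomputable def tangentCoeffs (F : MvPolynomial (Fin 3) K) :
    Derivation K (Polynomial (MvPolynomial (Fin 3) K)) (Polynomial (MvPolynomial (Fin 3) K)) :=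
  (PolynomialModule.equivPolynomialSelf (R := MvPolynomial (Fin 3) K)).toLinearMap.compDer
    (tangent F).mapCoeffs

theorem coeff_tangentCoeffs (F : MvPolynomial (Fin 3) K) (P : Polynomial (MvPolynomial (Fin 3) K))
    (k : ℕ) : (tangentCoeffs F P).coeff k = tangent F (P.coeff k) := rfl

theorem tangentCoeffs_C (F f : MvPolynomial (Fin 3) K) :
    tangentCoeffs F (Polynomial.C f) = Polynomial.C (tangent F f) := by
  ext1 k
  rw [coeff_tangentCoeffs, Polynomial.coeff_C, Polynomial.coeff_C]
  split_ifs <;> simp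

theorem tangentCoeffs_X (F : MvPolynomial (Fin 3) K) :
    tangentCoeffs F Polynomial.X = 0 := by
  ext1 k
  rw [coeff_tangentCoeffs, Polynomial.coeff_X]
  split_ifs <;> simp

theorem tangentCoeffs_flow (F f : MvPolynomial (Fin 3) K) :
    tangentCoeffs F (flow F f) =
      (Polynomial.C (MvPolynomial.pderiv 0 F) +
        Polynomial.X * Polynomial.C (tangent F (MvPolynomial.pderiv 0 F))) *
          flow F (MvPolynomial.pderiv 1 f) -
      (Polynomial.C (MvPolynomial.pderiv 1 F) +
        Polynomial.X * Polynomial.C (tangent F (MvPolynomial.pderiv 1 F))) *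
          flow F (MvPolynomial.pderiv 0 f) := by
  induction f using MvPolynomial.induction_on with
  | C a =>
    have h : flow F (MvPolynomial.C a) = Polynomial.C (MvPolynomial.C a) := by
      simp [flow, Polynomial.algebraMap_apply]
    rw [h, tangentCoeffs_C]
    simp [tangent_apply]
  | add f g hf hg => simp only [map_add, hf, hg]; ring
  | mul_X f i hf =>
    have hX : tangentCoeffs F (flow F (MvPolynomial.X i)) =
        (Polynomial.C (MvPolynomial.pderiv 0 F) +
          Polynomial.X * Polynomial.C (tangent F (MvPolynomial.pderiv 0 F))) *
            flow F (MvPolynomial.pderiv 1 (MvPolynomial.X i)) -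
        (Polynomial.C (MvPolynomial.pderiv 1 F) +
          Polynomial.X * Polynomial.C (tangent F (MvPolynomial.pderiv 1 F))) *
            flow F (MvPolynomial.pderiv 0 (MvPolynomial.X i)) := by
      obtain rfl | rfl | rfl : i = 0 ∨ i = 1 ∨ i = 2 := by omega
      all_goals
        simp [flow, tangentCoeffs_C, tangentCoeffs_X, Derivation.leibniz, tangent_apply,
          MvPolynomial.pderiv_X]
      try ring
    rw [map_mul, Derivation.leibniz, hf, hX, MvPolynomial.pderiv_mul,
      MvPolynomial.pderiv_mul]
    simp only [map_add, map_mul, smul_eq_mul]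
    ring

theorem coeff_zero_flow (F f : MvPolynomial (Fin 3) K) : (flow F f).coeff 0 = f := by
  induction f using MvPolynomial.induction_on with
  | C a => simp [flow, Polynomial.algebraMap_apply]
  | add f g hf hg => simp [hf, hg]
  | mul_X f i hf =>
    have hX : (flow F (MvPolynomial.X i)).coeff 0 = MvPolynomial.X i := by
      obtain rfl | rfl | rfl : i = 0 ∨ i = 1 ∨ i = 2 := by omega
      all_goals simp [flow]
    rw [map_mul, Polynomial.mul_coeff_zero, hf, hX]

theorem natDegree_flow_le (F f : MvPolynomial (Fin 3) K) :
    (flow F f).natDegree ≤ f.totalDegree := by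
  have hdeg : (MvPolynomial.map (algebraMap K (MvPolynomial (Fin 3) K)) f).totalDegree ≤
      f.totalDegree := Finset.sup_mono (MvPolynomial.support_map_subset _ _)
  rw [flow, ← MvPolynomial.aeval_map_algebraMap (MvPolynomial (Fin 3) K)]
  refine (MvPolynomial.aeval_natDegree_le (n := 1) _ hdeg _ ?_).trans (by simp)
  intro i
  obtain rfl | rfl | rfl : i = 0 ∨ i = 1 ∨ i = 2 := by omega
  · simp only [Matrix.cons_val_zero]
    compute_degree
  · simp only [Matrix.cons_val_one, Matrix.cons_val_zero]
    compute_degree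
  · simp

/-- If every point of every section `X = const` is an inflection point then these sections contain
their tangent lines. -/
theorem dvd_coeff_flow {F : MvPolynomial (Fin 3) K} (hF : Irreducible F) (hflex : F ∣ flex F)
    (hZ : ¬ F ∣ MvPolynomial.pderiv 0 F)
    (hchar : ∀ k : ℕ, 0 < k → k ≤ F.totalDegree → (k : K) ≠ 0) (k : ℕ) :
    F ∣ (flow F F).coeff k := by
  induction k with
  | zero => rw [coeff_zero_flow]
  | succ k ih =>
    by_cases hk : F.totalDegree < k + 1
    · rw [Polynomial.coeff_eq_zero_of_natDegree_lt ((natDegree_flow_le F F).trans_lt hk)]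
      exact dvd_zero F
    have hkey : Polynomial.C (MvPolynomial.pderiv 0 F) * tangentCoeffs F (flow F F) -
        (Polynomial.C (MvPolynomial.pderiv 0 F) * Polynomial.derivative (flow F F) +
        Polynomial.C (tangent F (MvPolynomial.pderiv 0 F)) *
          (Polynomial.X * Polynomial.derivative (flow F F))) =
        Polynomial.C (flex F) * -(Polynomial.X * flow F (MvPolynomial.pderiv 0 F)) := by
      rw [tangentCoeffs_flow, derivative_flow, flex]
      simp only [map_sub, map_mul]
      ring
    have hX : (Polynomial.X * Polynomial.derivative (flow F F)).coeff k =
        (flow F F).coeff k * k := by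
      cases k with
      | zero => simp
      | succ k => simp [Polynomial.coeff_X_mul, Polynomial.coeff_derivative]
    have hcoeff := congrArg (fun P => Polynomial.coeff P k) hkey
    simp only [Polynomial.coeff_sub, Polynomial.coeff_add, Polynomial.coeff_C_mul, hX,
      Polynomial.coeff_derivative, coeff_tangentCoeffs] at hcoeff
    obtain ⟨u, hu⟩ := ih
    obtain ⟨w, hw⟩ := hflex
    have htan : F ∣ tangent F ((flow F F).coeff k) := by
      rw [hu, Derivation.leibniz, tangent_self, smul_zero, add_zero, smul_eq_mul]
      exact dvd_mul_right F _
    obtain ⟨t, ht⟩ := htan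
    have hprod : F ∣ MvPolynomial.pderiv 0 F *
        ((flow F F).coeff (k + 1) * MvPolynomial.C ((k + 1 : ℕ) : K)) := by
      rw [ht, hu, hw] at hcoeff
      refine ⟨MvPolynomial.pderiv 0 F * t - tangent F (MvPolynomial.pderiv 0 F) * (u * k) -
        w * (-(Polynomial.X * flow F (MvPolynomial.pderiv 0 F))).coeff k, ?_⟩
      push_cast [map_add, map_natCast, map_one]
      linear_combination -hcoeff
    have hprime := hF.prime
    rcases hprime.dvd_or_dvd hprod with h | h
    · exact absurd h hZ
    rcases hprime.dvd_or_dvd h with h | h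
    · exact h
    · exfalso
      refine hF.not_isUnit (isUnit_of_dvd_unit h ?_)
      exact (IsUnit.mk0 _ (hchar (k + 1) k.succ_pos (by omega))).map MvPolynomial.C

end Hessian

section Ruled

variable {K : Type*} [Field K]

/-- A surface all of whose points are inflection points of its sections `X = const`, and which
contains the line given by `π`, is the union of its lines through the points of that line. -/
theorem dvd_ruling {F : MvPolynomial (Fin 3) K} (hF : Irreducible F) (hflex : F ∣ flex F)
    (hZ : ¬ F ∣ MvPolynomial.pderiv 0 F)
    (hchar : ∀ k : ℕ, 0 < k → k ≤ F.totalDegree → (k : K) ≠ 0) {π : K × K × K}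
    (hπ : restrictPlane π F = 0) (hg : restrictPlane π (MvPolynomial.pderiv 0 F) ≠ 0) :
    F ∣ Polynomial.aeval (MvPolynomial.X 2) (restrictPlane π (MvPolynomial.pderiv 0 F)) *
        (MvPolynomial.X 0 - MvPolynomial.C π.2.1 * MvPolynomial.X 2 - MvPolynomial.C π.2.2) +
      (MvPolynomial.X 1 - MvPolynomial.C π.1) *
        Polynomial.aeval (MvPolynomial.X 2) (restrictPlane π (MvPolynomial.pderiv 1 F)) := by
  set g := restrictPlane π (MvPolynomial.pderiv 0 F) with hgdef
  set h := restrictPlane π (MvPolynomial.pderiv 1 F) with hhdef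
  by_contra hG
  obtain ⟨r, hr, -, u, v, huv⟩ := exists_eliminant hF hG
  let Ψ : MvPolynomial (Fin 3) K →ₐ[K] Polynomial (Polynomial K) :=
    (Polynomial.mapAlgHom (restrictPlane π)).comp (flow F)
  have hΨF : Ψ F = 0 := by
    have hd : Polynomial.C F ∣ flow F F :=
      (Polynomial.C_dvd_iff_dvd_coeff _ _).2 (dvd_coeff_flow hF hflex hZ hchar)
    have := map_dvd (Polynomial.mapAlgHom (restrictPlane π)) hd
    simp only [Polynomial.coe_mapAlgHom, Polynomial.map_C, RingHom.coe_coe, hπ, map_zero,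
      zero_dvd_iff] at this
    simpa [Ψ] using this
  have hX0 : Ψ (MvPolynomial.X 0) =
      Polynomial.C (Polynomial.C π.2.1 * Polynomial.X + Polynomial.C π.2.2) -
        Polynomial.X * Polynomial.C h := by
    simp [Ψ, flow, hhdef, restrictPlane, Polynomial.X_mul]
  have hX1 : Ψ (MvPolynomial.X 1) =
      Polynomial.C (Polynomial.C π.1) + Polynomial.X * Polynomial.C g := by
    simp [Ψ, flow, hgdef, restrictPlane, Polynomial.X_mul]
  have hX2 : Ψ (MvPolynomial.X 2) = Polynomial.C Polynomial.X := by
    simp [Ψ, flow, restrictPlane]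
  have hC (a : K) : Ψ (MvPolynomial.C a) = Polynomial.C (Polynomial.C a) :=
    Ψ.commutes a
  have hs (P : Polynomial K) :
      Ψ (Polynomial.aeval (MvPolynomial.X 2) P) = Polynomial.C P := by
    rw [← Polynomial.aeval_algHom_apply, hX2]
    have := Polynomial.aeval_algHom_apply
      (IsScalarTower.toAlgHom K (Polynomial K) (Polynomial (Polynomial K))) Polynomial.X P
    simpa [Polynomial.algebraMap_eq] using this
  have hΨr : Ψ (ofBivariate K r) =
      r.comp (Polynomial.C (Polynomial.C π.1) + Polynomial.X * Polynomial.C g) := by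
    have hcomp : Ψ.toRingHom.comp (ofBivariate K) =
        Polynomial.compRingHom
          (Polynomial.C (Polynomial.C π.1) + Polynomial.X * Polynomial.C g) := by
      ext a
      · simp [ofBivariate, Polynomial.compRingHom, hC]
      · simp [ofBivariate, Polynomial.compRingHom, hX2]
      · simp [ofBivariate, Polynomial.compRingHom, hX1]
    exact congrArg (fun φ => φ r) hcomp
  have hzero : r.comp (Polynomial.C (Polynomial.C π.1) + Polynomial.X * Polynomial.C g) = 0 := by
    rw [← hΨr, huv]
    simp only [map_add, map_mul, map_sub, hΨF, hs, hX0, hX1, hX2, hC]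
    ring
  rcases Polynomial.comp_eq_zero_iff.1 hzero with h0 | ⟨-, h1⟩
  · exact hr h0
  · have := congrArg (fun P => Polynomial.coeff P 1) h1
    simp [Polynomial.coeff_C] at this
    exact hg this

/-- The lines of a ruled surface meet a fixed transversal line, with few exceptions. -/
theorem incident_of_ruling {F : MvPolynomial (Fin 3) K} (hF : Irreducible F)
    (hflex : F ∣ flex F) (hZ : ¬ F ∣ MvPolynomial.pderiv 0 F)
    (hchar : ∀ k : ℕ, 0 < k → k ≤ F.totalDegree → (k : K) ≠ 0) {q π : K × K × K}
    (hπ : restrictPlane π F = 0)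
    (hq : restrictPoint q F = 0)
    (hgq : (restrictPlane π (MvPolynomial.pderiv 0 F)).eval q.1 ≠ 0) : Incident q π := by
  have hg : restrictPlane π (MvPolynomial.pderiv 0 F) ≠ 0 := by
    rintro h; simp [h] at hgq
  have hd := map_dvd (restrictPoint q) (dvd_ruling hF hflex hZ hchar hπ hg)
  rw [hq, zero_dvd_iff] at hd
  have hs (P : Polynomial K) :
      restrictPoint q (Polynomial.aeval (MvPolynomial.X 2) P) = Polynomial.C (P.eval q.1) := by
    rw [← Polynomial.aeval_algHom_apply]
    have : restrictPoint q (MvPolynomial.X 2) = algebraMap K (Polynomial K) q.1 := by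
      simp [restrictPoint]
    rw [this, Polynomial.aeval_algebraMap_apply_eq_algebraMap_eval]
    rfl
  have he := congrArg (Polynomial.eval π.1) hd
  simp only [map_add, map_mul, map_sub, hs] at he
  simp [restrictPoint] at he
  rcases he with he | he
  · exact absurd he hgq
  · unfold Incident
    linear_combination he

end Ruled

section Cell

variable {K : Type*} [Field K]

open Classical in
/-- The points of `L` incident to `π`. -/
noncomputable def pointsOn (L : Finset (K × K × K)) (π : K × K × K) : Finset (K × K × K) :=
  L.filter fun q => Incident q π

open Classical in
/-- The number of incidences between the points of `L` and the planes of `G`. -/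
noncomputable def incidences (L G : Finset (K × K × K)) : ℕ :=
  ∑ π ∈ G, (pointsOn L π).card

theorem mem_pointsOn {L : Finset (K × K × K)} {π q : K × K × K} :
    q ∈ pointsOn L π ↔ q ∈ L ∧ Incident q π := by
  simp [pointsOn]

theorem pointsOn_subset (L : Finset (K × K × K)) (π : K × K × K) : pointsOn L π ⊆ L :=
  fun _ h => (mem_pointsOn.1 h).1

theorem card_pointsOn_le {L : Finset (K × K × K)}
    (hL : Set.InjOn Prod.fst (L : Set (K × K × K))) {P : MvPolynomial (Fin 3) K}
    (hP : ∀ q ∈ L, restrictPoint q P = 0) {π : K × K × K} (hπ : restrictPlane π P ≠ 0) :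
    (pointsOn L π).card ≤ P.totalDegree := by
  refine (card_filter_eval_fst_le (hL.mono ?_) hπ fun q hq => ?_).trans
    (natDegree_restrictPlane_le π P)
  · exact_mod_cast pointsOn_subset L π
  · obtain ⟨hqL, hinc⟩ := mem_pointsOn.1 hq
    rw [eval_restrictPlane_eq hinc, hP q hqL, Polynomial.eval_zero]

theorem totalDegree_pderiv_le_sub_one (i : Fin 3) (F : MvPolynomial (Fin 3) K) :
    (MvPolynomial.pderiv i F).totalDegree ≤ F.totalDegree - 1 := by
  conv_lhs => rw [F.as_sum, map_sum]
  refine MvPolynomial.totalDegree_finsetSum_le fun s hs => ?_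
  rw [MvPolynomial.pderiv_monomial]
  by_cases h0 : s i = 0
  · simp [h0]
  refine (MvPolynomial.totalDegree_monomial_le _ _).trans ?_
  have h1 : (s - Finsupp.single i 1) + Finsupp.single i 1 = s := by
    ext j
    by_cases hj : i = j
    · subst hj; simp; omega
    · simp [Finsupp.single_eq_of_ne' hj]
  have h2 := MvPolynomial.le_totalDegree hs
  rw [← h1, Finsupp.sum_add_index' (by simp) (by simp)] at h2
  simp only [Finsupp.sum_single_index] at h2
  simp only [Finsupp.sum] at h2 ⊢
  simpa using Nat.le_sub_one_of_lt h2

theorem totalDegree_pos_of_irreducible {F : MvPolynomial (Fin 3) K} (hF : Irreducible F) :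
    0 < F.totalDegree := by
  rw [Nat.pos_iff_ne_zero]
  intro h
  rw [MvPolynomial.totalDegree_eq_zero_iff_eq_C] at h
  rw [h] at hF
  by_cases h0 : MvPolynomial.coeff 0 F = 0
  · rw [h0, map_zero] at hF; exact hF.ne_zero rfl
  · exact hF.not_isUnit ((IsUnit.mk0 _ h0).map MvPolynomial.C)

theorem exists_ofBivariate_of_dvd_pderiv {F : MvPolynomial (Fin 3) K} (hF : Irreducible F)
    (hZ : F ∣ MvPolynomial.pderiv 0 F)
    (hchar : ∀ k : ℕ, 0 < k → k ≤ F.totalDegree → (k : K) ≠ 0) :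
    ∃ r : Polynomial (Polynomial K), r ≠ 0 ∧ r.natDegree ≤ F.totalDegree ∧
      ofBivariate K r = F := by
  have hzero : MvPolynomial.pderiv 0 F = 0 := by
    by_contra h
    have h1 := MvPolynomial.totalDegree_le_of_dvd_of_isDomain hZ h
    have h2 := totalDegree_pderiv_le_sub_one 0 F
    have := totalDegree_pos_of_irreducible hF
    omega
  have hvars : ∀ s ∈ F.support, s 0 = 0 := by
    intro s hs
    by_contra h0
    have hc := congrArg (MvPolynomial.coeff (s - Finsupp.single 0 1)) hzero
    have h1 : (s - Finsupp.single 0 1) + Finsupp.single 0 1 = s := by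
      ext j
      by_cases hj : (0 : Fin 3) = j
      · subst hj; simp; omega
      · simp [Finsupp.single_eq_of_ne' hj]
    rw [MvPolynomial.coeff_pderiv, h1, MvPolynomial.coeff_zero, mul_eq_zero] at hc
    rcases hc with hc | hc
    · exact MvPolynomial.mem_support_iff.1 hs hc
    · refine hchar (s 0) (by omega) ?_ ?_
      · refine le_trans ?_ (MvPolynomial.le_totalDegree hs)
        rw [Finsupp.sum]
        exact Finset.single_le_sum (f := fun i => s i) (fun _ _ => Nat.zero_le _)
          (Finsupp.mem_support_iff.2 h0)
      · have : s 0 - 1 + 1 = s 0 := by omega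
        simp only [Finsupp.coe_tsub, Pi.sub_apply, Finsupp.single_eq_same] at hc
        rw [← this]; push_cast; exact_mod_cast hc
  let r : Polynomial (Polynomial K) := MvPolynomial.aeval
    (![0, Polynomial.X, Polynomial.C Polynomial.X] : Fin 3 → Polynomial (Polynomial K)) F
  have hr : ofBivariate K r = F := by
    have h1 : ofBivariate K r = MvPolynomial.eval₂ MvPolynomial.C
        (![0, MvPolynomial.X 1, MvPolynomial.X 2] : Fin 3 → MvPolynomial (Fin 3) K) F := by
      have : (ofBivariate K).comp (MvPolynomial.aeval (R := K)
          (![0, Polynomial.X, Polynomial.C Polynomial.X] :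
            Fin 3 → Polynomial (Polynomial K))).toRingHom = MvPolynomial.eval₂Hom MvPolynomial.C
        (![0, MvPolynomial.X 1, MvPolynomial.X 2] : Fin 3 → MvPolynomial (Fin 3) K) := by
        apply MvPolynomial.ringHom_ext
        · intro a; simp [ofBivariate, Polynomial.algebraMap_apply]
        · intro (i : Fin 3)
          obtain rfl | rfl | rfl : i = 0 ∨ i = 1 ∨ i = 2 := by omega
          all_goals simp [ofBivariate]
      exact congrArg (fun φ => φ F) this
    rw [h1]
    conv_rhs => rw [← MvPolynomial.eval₂_eta F]
    have hcongr : ∀ {i : Fin 3} {c : Fin 3 →₀ ℕ}, i ∈ c.support → MvPolynomial.coeff c F ≠ 0 →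
        (![0, MvPolynomial.X 1, MvPolynomial.X 2] : Fin 3 → MvPolynomial (Fin 3) K) i =
          MvPolynomial.X i := by
      intro i c hi hc
      obtain rfl | rfl | rfl : i = 0 ∨ i = 1 ∨ i = 2 := by omega
      · exact absurd (hvars c (MvPolynomial.mem_support_iff.2 hc)) (Finsupp.mem_support_iff.1 hi)
      all_goals simp
    apply MvPolynomial.eval₂_congr
    exact hcongr
  refine ⟨r, ?_, ?_, hr⟩
  · rintro h; rw [h, map_zero] at hr; exact hF.ne_zero hr.symm
  · have hdeg : (MvPolynomial.map (algebraMap K (Polynomial K)) F).totalDegree ≤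
        F.totalDegree := Finset.sup_mono (MvPolynomial.support_map_subset _ _)
    have := MvPolynomial.aeval_natDegree_le (n := 1) _ hdeg
      (![0, Polynomial.X, Polynomial.C Polynomial.X] : Fin 3 → Polynomial (Polynomial K)) (by
        intro i
        obtain rfl | rfl | rfl : i = 0 ∨ i = 1 ∨ i = 2 := by omega
        all_goals simp)
    rw [MvPolynomial.aeval_map_algebraMap, mul_one] at this
    exact this

end Cell

section Factor

variable {K : Type*} [Field K]

theorem incidences_le_of_forall {L G : Finset (K × K × K)} {n : ℕ}
    (h : ∀ π ∈ G, (pointsOn L π).card ≤ n) : incidences L G ≤ G.card * n := by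
  simpa [incidences] using Finset.sum_le_card_nsmul G _ n h

open Classical in
/-- Incidences between lines of an irreducible surface. -/
theorem exists_small_exceptional {F : MvPolynomial (Fin 3) K} (hF : Irreducible F)
    (hchar : ∀ k : ℕ, 0 < k → k ≤ F.totalDegree → (k : K) ≠ 0) {L L₂ : Finset (K × K × K)}
    (hL : Set.InjOn Prod.fst (L : Set (K × K × K)))
    (hL₂ : Set.InjOn Prod.fst (L₂ : Set (K × K × K))) {k : ℕ}
    (hk : ∀ π ∈ L₂, ∀ π' ∈ L₂, π ≠ π' →
      {q ∈ (L : Set (K × K × K)) | Incident q π ∧ Incident q π'}.ncard ≤ k)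
    (hLF : ∀ q ∈ L, restrictPoint q F = 0) :
    ∃ B ⊆ L₂, B.card ≤ 7 * F.totalDegree ^ 2 ∧ ∀ G ⊆ L₂, Disjoint G B →
      incidences L G ≤ L.card + (G.filter fun π => restrictPlane π F = 0).card * k +
        G.card * (5 * F.totalDegree) := by
  classical
  have hdpos := totalDegree_pos_of_irreducible hF
  set d := F.totalDegree with hd
  have hplane : ∀ π, restrictPlane π F ≠ 0 → (pointsOn L π).card ≤ d :=
    fun π hπ => card_pointsOn_le hL hLF hπ
  by_cases hflex : F ∣ flex F
  swap
  · refine ⟨L₂.filter fun π => restrictPlane π F = 0 ∧ restrictPlane π (flex F) = 0,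
      filter_subset _ _, ?_, fun G hG hdis => ?_⟩
    · refine (card_common_planes_le hF hflex (hL₂.mono (by
      exact_mod_cast filter_subset _ _)) (by simp)).trans ?_
      have := totalDegree_flex_le F
      calc F.totalDegree * (2 * (flex F).totalDegree + 1) ≤ d * (2 * (3 * d) + d) := by
            gcongr; omega
        _ = 7 * d ^ 2 := by ring
    · refine (incidences_le_of_forall (n := 5 * d) fun π hπ => ?_).trans (by omega)
      by_cases h0 : restrictPlane π F = 0
      · have h1 : restrictPlane π (flex F) ≠ 0 := fun h =>
          Finset.disjoint_left.1 hdis hπ (mem_filter.2 ⟨hG hπ, h0, h⟩)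
        have := card_pointsOn_le hL (fun q hq => restrictPoint_flex (hLF q hq)) h1
        have := totalDegree_flex_le F
        omega
      · have := hplane π h0
        omega
  by_cases hZ : F ∣ MvPolynomial.pderiv 0 F
  · obtain ⟨r, hr, hrd, hrF⟩ := exists_ofBivariate_of_dvd_pderiv hF hZ hchar
    refine ⟨L₂.filter fun π => restrictPlane π F = 0,
      filter_subset _ _, ?_, fun G hG hdis => ?_⟩
    · have h1 : ((L₂.filter fun π => restrictPlane π F = 0).image
          fun π => Polynomial.C π.1).card ≤ r.natDegree := by
        refine Polynomial.card_le_degree_of_subset_roots fun x hx => ?_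
        obtain ⟨π, hπ, rfl⟩ := mem_image.1 (Finset.mem_def.2 hx)
        rw [Polynomial.mem_roots hr, Polynomial.IsRoot.def, ← restrictPlane_ofBivariate, hrF]
        exact (mem_filter.1 hπ).2
      rw [card_image_of_injOn] at h1
      · nlinarith
      · intro π hπ π' hπ' h
        exact hL₂ (mem_filter.1 hπ).1 (mem_filter.1 hπ').1 (Polynomial.C_injective h)
    · refine (incidences_le_of_forall (n := 5 * d) fun π hπ => ?_).trans (by omega)
      have h0 : restrictPlane π F ≠ 0 := fun h =>
          Finset.disjoint_left.1 hdis hπ (mem_filter.2 ⟨hG hπ, h⟩)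
      have := hplane π h0
      omega
  · refine ⟨L₂.filter fun π => restrictPlane π F = 0 ∧
      restrictPlane π (MvPolynomial.pderiv 0 F) = 0,
      filter_subset _ _, ?_, fun G hG hdis => ?_⟩
    · refine (card_common_planes_le hF hZ (hL₂.mono (by
      exact_mod_cast filter_subset _ _)) (by simp)).trans ?_
      have := totalDegree_pderiv_le 0 F
      calc F.totalDegree * (2 * (MvPolynomial.pderiv 0 F).totalDegree + 1)
          ≤ d * (2 * (3 * d) + d) := by gcongr <;> omega
        _ = 7 * d ^ 2 := by ring
    have hmiss : ∀ π ∈ G, restrictPlane π F = 0 → (L \ pointsOn L π).card ≤ d := by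
      intro π hπ h0
      have h1 : restrictPlane π (MvPolynomial.pderiv 0 F) ≠ 0 := fun h =>
          Finset.disjoint_left.1 hdis hπ (mem_filter.2 ⟨hG hπ, h0, h⟩)
      refine (card_filter_eval_fst_le (hL.mono (by simp)) h1 fun q hq => ?_).trans
        ((natDegree_restrictPlane_le π _).trans (totalDegree_pderiv_le 0 F))
      obtain ⟨hqL, hq⟩ := mem_sdiff.1 hq
      by_contra hne
      exact hq (mem_pointsOn.2 ⟨hqL, incident_of_ruling hF hflex hZ hchar h0 (hLF q hqL) hne⟩)
    set G₀ := G.filter fun π => restrictPlane π F = 0 with hG₀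
    have hG₀G : G₀.card ≤ G.card := card_le_card (filter_subset _ _)
    have hrich : incidences L G₀ ≤ L.card + G₀.card * (k + 2 * d) := by
      rcases Nat.lt_or_ge 1 G₀.card with h1 | h1
      · obtain ⟨π, hπ, π', hπ', hne⟩ := one_lt_card.1 h1
        obtain ⟨hπG, hπ0⟩ := mem_filter.1 hπ
        obtain ⟨hπG', hπ0'⟩ := mem_filter.1 hπ'
        have hsub : L ⊆ (L.filter fun q => Incident q π ∧ Incident q π') ∪
            ((L \ pointsOn L π) ∪ (L \ pointsOn L π')) := by
          intro q hq
          simp only [mem_union, mem_filter, mem_sdiff, mem_pointsOn]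
          tauto
        have hc := (card_le_card hsub).trans (card_union_le _ _)
        have hc' := card_union_le (L \ pointsOn L π) (L \ pointsOn L π')
        have hk' := hk π (hG hπG) π' (hG hπG') hne
        have hm := hmiss π hπG hπ0
        have hm' := hmiss π' hπG' hπ0'
        have he : {q ∈ (L : Set (K × K × K)) | Incident q π ∧ Incident q π'}.ncard =
            (L.filter fun q => Incident q π ∧ Incident q π').card := by
          rw [← Set.ncard_coe_finset]; congr 1; ext q; simp
        rw [he] at hk'
        refine (incidences_le_of_forall (n := k + 2 * d) fun π hπ => ?_).trans (by omega)
        exact (card_le_card (pointsOn_subset L π)).trans (by omega)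
      · refine (incidences_le_of_forall (n := L.card) fun π hπ =>
          card_le_card (pointsOn_subset L π)).trans ?_
        nlinarith
    have hpoor : incidences L (G.filter fun π => ¬ restrictPlane π F = 0) ≤ G.card * d :=
      (incidences_le_of_forall (n := d) fun π hπ => hplane π (mem_filter.1 hπ).2).trans
        (by gcongr; exact filter_subset _ _)
    have hsplit : incidences L G =
        incidences L G₀ + incidences L (G.filter fun π => ¬ restrictPlane π F = 0) :=
      (sum_filter_add_sum_filter_not _ _ _).symm
    calc incidences L G ≤ L.card + G₀.card * (k + 2 * d) + G.card * d := by omega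
      _ = L.card + (G₀.card * k + G₀.card * (2 * d)) + G.card * d := by ring
      _ ≤ L.card + (G₀.card * k + G.card * (2 * d)) + G.card * d := by gcongr
      _ ≤ L.card + G₀.card * k + G.card * (5 * d) := by nlinarith

/-- The distinct irreducible factors of a polynomial. -/
theorem exists_factors {F : MvPolynomial (Fin 3) K} (hF : F ≠ 0) :
    ∃ S : Finset (MvPolynomial (Fin 3) K), (∀ f ∈ S, Irreducible f) ∧
      (∀ f ∈ S, ∀ g ∈ S, f ≠ g → ¬ f ∣ g) ∧
      ∑ f ∈ S, f.totalDegree ≤ F.totalDegree ∧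
      ∀ q : K × K × K, restrictPoint q F = 0 → ∃ f ∈ S, restrictPoint q f = 0 := by
  classical
  induction F using UniqueFactorizationMonoid.induction_on_prime with
  | h₁ => exact absurd rfl hF
  | h₂ x hx =>
    refine ⟨∅, by simp, by simp, by simp, fun q hq => ?_⟩
    exact absurd hq (hx.map (restrictPoint q)).ne_zero
  | h₃ a p ha hp ih =>
    obtain ⟨S, hirr, hdvd, hdeg, hroot⟩ := ih ha
    have hdm := MvPolynomial.totalDegree_mul_of_isDomain hp.ne_zero ha
    by_cases hex : ∃ f ∈ S, p ∣ f
    · obtain ⟨f, hf, hpf⟩ := hex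
      refine ⟨S, hirr, hdvd, by omega, fun q hq => ?_⟩
      rw [map_mul, mul_eq_zero] at hq
      rcases hq with hq | hq
      · refine ⟨f, hf, ?_⟩
        have := map_dvd (restrictPoint q) hpf
        rwa [hq, zero_dvd_iff] at this
      · exact hroot q hq
    · push Not at hex
      have hpS : p ∉ S := fun h => hex p h dvd_rfl
      refine ⟨insert p S, ?_, ?_, ?_, fun q hq => ?_⟩
      · intro f hf
        rcases mem_insert.1 hf with rfl | hf
        · exact hp.irreducible
        · exact hirr f hf
      · intro f hf g hg hfg
        rcases mem_insert.1 hf with rfl | hfS <;> rcases mem_insert.1 hg with rfl | hgS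
        · exact absurd rfl hfg
        · exact hex g hgS
        · intro h
          exact hex f hfS ((hirr f hfS).associated_of_dvd hp.irreducible h).symm.dvd
        · exact hdvd f hfS g hgS hfg
      · rw [sum_insert hpS]; omega
      · rw [map_mul, mul_eq_zero] at hq
        rcases hq with hq | hq
        · exact ⟨p, mem_insert_self _ _, hq⟩
        · obtain ⟨f, hf, h⟩ := hroot q hq
          exact ⟨f, mem_insert_of_mem hf, h⟩

/-- Parameter counting. -/
theorem exists_interpolant (L : Finset (K × K × K)) {m : ℕ} (hm : 3 * L.card ≤ (m + 1) ^ 2) :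
    ∃ F : MvPolynomial (Fin 3) K, F ≠ 0 ∧ F.totalDegree ≤ 3 * m ∧
      ∀ q ∈ L, restrictPoint q F = 0 := by
  classical
  let e : (Fin 3 → Fin (m + 1)) → (Fin 3 →₀ ℕ) := fun i =>
    Finsupp.equivFunOnFinite.symm fun j => (i j : ℕ)
  have he : Function.Injective e := by
    intro i i' h
    funext j
    exact Fin.ext (DFunLike.congr_fun h j)
  let Φ : ((Fin 3 → Fin (m + 1)) → K) →ₗ[K] MvPolynomial (Fin 3) K :=
    ∑ i, (MvPolynomial.monomial (e i)).comp (LinearMap.proj i)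
  have hΦ (c) : Φ c = ∑ i, MvPolynomial.monomial (e i) (c i) := by
    simp [Φ]
  have hΦdeg (c) : (Φ c).totalDegree ≤ 3 * m := by
    rw [hΦ]
    refine MvPolynomial.totalDegree_finsetSum_le fun i _ => ?_
    refine (MvPolynomial.totalDegree_monomial_le _ _).trans ?_
    rw [Finsupp.sum_fintype _ _ (by simp), Fin.sum_univ_three]
    have := fun j => (i j).is_lt
    have h0 := this 0
    have h1 := this 1
    have h2 := this 2
    simp only [e, Finsupp.equivFunOnFinite_symm_apply_apply, id_eq]
    omega
  let Λ : ((Fin 3 → Fin (m + 1)) → K) →ₗ[K] (L × Fin (3 * m + 1) → K) :=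
    LinearMap.pi fun s => (Polynomial.lcoeff K s.2).comp
      ((restrictPoint s.1.1).toLinearMap.comp Φ)
  have hlt : Module.finrank K (L × Fin (3 * m + 1) → K) <
      Module.finrank K ((Fin 3 → Fin (m + 1)) → K) := by
    simp only [Module.finrank_fintype_fun_eq_card, Fintype.card_prod, Fintype.card_coe,
      Fintype.card_fin, Fintype.card_pi, Finset.prod_const, Finset.card_univ]
    nlinarith [sq_nonneg (m + 1), L.card.zero_le]
  obtain ⟨c, hc, hc0⟩ := (Submodule.ne_bot_iff _).1
    (LinearMap.ker_ne_bot_of_finrank_lt hlt (f := Λ))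
  refine ⟨Φ c, fun h => hc0 ?_, hΦdeg c, fun q hq => ?_⟩
  · funext i
    have := congrArg (MvPolynomial.coeff (e i)) h
    rw [hΦ, MvPolynomial.coeff_sum, Finset.sum_eq_single i] at this
    · simpa using this
    · intro j _ hj
      rw [MvPolynomial.coeff_monomial, if_neg fun h => hj (he h)]
    · simp
  · ext n
    rcases Nat.lt_or_ge n (3 * m + 1) with hn | hn
    · have := congrFun (LinearMap.mem_ker.1 hc) (⟨q, hq⟩, ⟨n, hn⟩)
      simpa [Λ] using this
    · rw [Polynomial.coeff_zero, Polynomial.coeff_eq_zero_of_natDegree_lt]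
      have := natDegree_restrictPoint_le q (Φ c)
      have := hΦdeg c
      omega

end Factor

section Step

variable {K : Type*} [Field K]

theorem ncard_common_mono {L L' : Finset (K × K × K)} (h : L ⊆ L') (π π' : K × K × K) :
    {q ∈ (L : Set (K × K × K)) | Incident q π ∧ Incident q π'}.ncard ≤
      {q ∈ (L' : Set (K × K × K)) | Incident q π ∧ Incident q π'}.ncard :=
  Set.ncard_le_ncard (fun _ hq => ⟨h hq.1, hq.2⟩) (L'.finite_toSet.subset fun _ hq => hq.1)

/-- After removing few exceptional planes, the number of incidences is small. -/
theorem exists_sparse_planes {L₁ L₂ : Finset (K × K × K)}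
    (hL₁ : Set.InjOn Prod.fst (L₁ : Set (K × K × K)))
    (hL₂ : Set.InjOn Prod.fst (L₂ : Set (K × K × K))) {k m : ℕ}
    (hk : ∀ π ∈ L₂, ∀ π' ∈ L₂, π ≠ π' →
      {q ∈ (L₁ : Set (K × K × K)) | Incident q π ∧ Incident q π'}.ncard ≤ k)
    (hm : 3 * L₁.card ≤ (m + 1) ^ 2)
    (hchar : ∀ j : ℕ, 0 < j → j ≤ 3 * m → (j : K) ≠ 0) :
    ∃ B ⊆ L₂, B.card ≤ 90 * m ^ 2 ∧ ∀ G ⊆ L₂, Disjoint G B →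
      incidences L₁ G ≤ L₁.card + L₂.card * (k + 15 * m) := by
  classical
  obtain ⟨F, hF, hFdeg, hFroot⟩ := exists_interpolant L₁ hm
  obtain ⟨S, hirr, hdvd, hdeg, hroot⟩ := exists_factors hF
  choose! j hjS hj using fun q (hq : q ∈ L₁) => hroot q (hFroot q hq)
  have hD : ∑ f ∈ S, f.totalDegree ≤ 3 * m := hdeg.trans hFdeg
  have hdle : ∀ f ∈ S, f.totalDegree ≤ 3 * m := fun f hf =>
    (single_le_sum (f := fun f => f.totalDegree) (fun _ _ => Nat.zero_le _) hf).trans hD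
  have hex : ∀ f ∈ S, ∃ B ⊆ L₂, B.card ≤ 7 * f.totalDegree ^ 2 ∧ ∀ G ⊆ L₂, Disjoint G B →
      incidences (L₁.filter fun q => j q = f) G ≤ (L₁.filter fun q => j q = f).card +
        (G.filter fun π => restrictPlane π f = 0).card * k + G.card * (5 * f.totalDegree) := by
    intro f hf
    obtain ⟨B, hB, hBc, hBG⟩ := exists_small_exceptional (hirr f hf)
      (fun k h0 hk => hchar k h0 (hk.trans (hdle f hf)))
      (L := L₁.filter fun q => j q = f) (L₂ := L₂)
      (hL₁.mono (by exact_mod_cast filter_subset _ _)) hL₂ (k := k)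
      (fun π hπ π' hπ' hne =>
        (ncard_common_mono (filter_subset _ _) π π').trans (hk π hπ π' hπ' hne))
      (fun q hq => by
        obtain ⟨hqL, rfl⟩ := mem_filter.1 hq
        exact hj q hqL)
    exact ⟨B, hB, hBc, fun G hG hd => by convert hBG G hG hd⟩
  choose! B hBL hBc hBG using hex
  let E : MvPolynomial (Fin 3) K → MvPolynomial (Fin 3) K → Finset (K × K × K) := fun f g =>
    if f = g then ∅ else L₂.filter fun π => restrictPlane π f = 0 ∧ restrictPlane π g = 0
  have hE : ∀ f ∈ S, ∀ g ∈ S, (E f g).card ≤ 3 * (f.totalDegree * g.totalDegree) := by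
    intro f hf g hg
    by_cases hfg : f = g
    · simp [E, hfg]
    · have h1 := totalDegree_pos_of_irreducible (hirr g hg)
      simp only [E, if_neg hfg]
      refine (card_common_planes_le (hirr f hf) (hdvd f hf g hg hfg)
        (hL₂.mono (by exact_mod_cast filter_subset _ _)) (by simp)).trans ?_
      nlinarith [Nat.mul_le_mul_left f.totalDegree h1]
  refine ⟨S.biUnion B ∪ S.biUnion fun f => S.biUnion fun g => E f g, ?_, ?_, ?_⟩
  · refine union_subset (biUnion_subset.2 hBL) (biUnion_subset.2 fun f _ =>
      biUnion_subset.2 fun g _ => ?_)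
    simp only [E]
    split_ifs
    · exact empty_subset _
    · exact filter_subset _ _
  · have h1 : (S.biUnion B).card ≤ 7 * (3 * m) ^ 2 := by
      refine card_biUnion_le.trans ((sum_le_sum hBc).trans ?_)
      rw [← mul_sum]
      gcongr
      refine le_trans ?_ (Nat.pow_le_pow_left hD 2)
      rw [sq, sum_mul]
      refine sum_le_sum fun f hf => ?_
      rw [sq]
      gcongr
      exact single_le_sum (f := fun f => f.totalDegree) (fun _ _ => Nat.zero_le _) hf
    have h2 : (S.biUnion fun f => S.biUnion fun g => E f g).card ≤ 3 * (3 * m) ^ 2 := by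
      refine card_biUnion_le.trans ((sum_le_sum fun f hf => card_biUnion_le.trans
        (sum_le_sum (hE f hf))).trans ?_)
      simp only [← mul_sum]
      rw [← sum_mul, sq]
      gcongr
    refine (card_union_le _ _).trans ?_
    nlinarith
  · intro G hG hdis
    rw [disjoint_union_right] at hdis
    obtain ⟨hd1, hd2⟩ := hdis
    rw [disjoint_biUnion_right] at hd1
    have hsum : incidences L₁ G = ∑ f ∈ S, incidences (L₁.filter fun q => j q = f) G := by
      simp only [incidences]
      rw [sum_comm]
      refine sum_congr rfl fun π _ => ?_
      rw [card_eq_sum_card_fiberwise (f := j) (t := S)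
        (fun q hq => hjS q (pointsOn_subset _ _ hq))]
      refine sum_congr rfl fun f _ => ?_
      congr 1
      ext q
      simp only [mem_filter, mem_pointsOn]
      tauto
    have hL : ∑ f ∈ S, (L₁.filter fun q => j q = f).card = L₁.card :=
      (card_eq_sum_card_fiberwise (f := j) (t := S) hjS).symm
    have hR : ∑ f ∈ S, (G.filter fun π => restrictPlane π f = 0).card ≤ G.card := by
      rw [← card_biUnion]
      · exact card_le_card (biUnion_subset.2 fun f _ => filter_subset _ _)
      · intro f hf g hg hfg
        rw [Function.onFun, disjoint_left]
        intro π hπf hπg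
        refine disjoint_left.1 hd2 (mem_filter.1 hπf).1 ?_
        refine mem_biUnion.2 ⟨f, hf, mem_biUnion.2 ⟨g, hg, ?_⟩⟩
        simp only [E, if_neg hfg]
        exact mem_filter.2 ⟨hG (mem_filter.1 hπf).1, (mem_filter.1 hπf).2, (mem_filter.1 hπg).2⟩
    have hGc : G.card ≤ L₂.card := card_le_card hG
    calc incidences L₁ G ≤ ∑ f ∈ S, ((L₁.filter fun q => j q = f).card +
        (G.filter fun π => restrictPlane π f = 0).card * k + G.card * (5 * f.totalDegree)) := by
          rw [hsum]
          exact sum_le_sum fun f hf => hBG f hf G hG (hd1 f hf)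
      _ = L₁.card + (∑ f ∈ S, (G.filter fun π => restrictPlane π f = 0).card) * k +
          G.card * (5 * ∑ f ∈ S, f.totalDegree) := by
          rw [sum_add_distrib, sum_add_distrib, hL, sum_mul, ← mul_sum, ← mul_sum]
      _ ≤ L₁.card + L₂.card * k + L₂.card * (5 * (3 * m)) := by
          gcongr
          exact hR.trans hGc
      _ = L₁.card + L₂.card * (k + 15 * m) := by ring

end Step

section Recursion

variable {K : Type*} [Field K]

theorem incidences_le_mul (L G : Finset (K × K × K)) : incidences L G ≤ G.card * L.card := by
  simpa [incidences] using Finset.sum_le_card_nsmul G _ L.card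
    fun π _ => card_le_card (pointsOn_subset L π)

theorem incidences_sdiff_left [DecidableEq K] {L L' : Finset (K × K × K)} (h : L' ⊆ L)
    (G : Finset (K × K × K)) : incidences L G = incidences (L \ L') G + incidences L' G := by
  classical
  simp only [incidences, ← sum_add_distrib]
  refine sum_congr rfl fun π _ => ?_
  rw [← card_union_of_disjoint]
  · congr 1
    ext q
    simp only [mem_union, mem_pointsOn, mem_sdiff]
    have := @h q
    tauto
  · rw [disjoint_left]
    intro q hq hq'
    exact (mem_sdiff.1 (mem_pointsOn.1 hq).1).2 (mem_pointsOn.1 hq').1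

theorem incidences_le_of_pieces {G : Finset (K × K × K)} {a : ℕ} {X : ℝ} (M : ℕ) :
    ∀ L : Finset (K × K × K), L.card ≤ M * a →
      (∀ L' ⊆ L, L'.card ≤ a → (incidences L' G : ℝ) ≤ X) → (incidences L G : ℝ) ≤ M * X := by
  classical
  induction M with
  | zero =>
    intro L hL _
    rw [zero_mul, Nat.le_zero, card_eq_zero] at hL
    subst hL
    simp [incidences, pointsOn]
  | succ M ih =>
    intro L hL h
    obtain ⟨L', hL', hc⟩ := exists_subset_card_eq (min_le_right a L.card)
    have h1 := ih (L \ L') (by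
      rw [card_sdiff_of_subset hL', hc]
      rw [add_mul, one_mul] at hL
      omega) fun L'' hL'' => h L'' (hL''.trans sdiff_subset)
    have h2 := h L' hL' (by omega)
    rw [incidences_sdiff_left hL']
    push_cast
    linarith

/-- Incidences between `N` points and `N` planes in which two planes share few points. -/
theorem exists_incidences_bound (δ : ℝ) (hδ : 0 < δ) :
    ∃ C : ℝ, 0 < C ∧ ∀ (K : Type) [Field K] (N k : ℕ) (L₁ L₂ : Finset (K × K × K)),
      Set.InjOn Prod.fst (L₁ : Set (K × K × K)) → Set.InjOn Prod.fst (L₂ : Set (K × K × K)) →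
      L₁.card ≤ N → L₂.card ≤ N →
      (∀ π ∈ L₂, ∀ π' ∈ L₂, π ≠ π' →
        {q ∈ (L₁ : Set (K × K × K)) | Incident q π ∧ Incident q π'}.ncard ≤ k) →
      (∀ j : ℕ, 0 < j → j ^ 2 ≤ 27 * N → (j : K) ≠ 0) →
      (incidences L₁ L₂ : ℝ) ≤ C * (√N + k) * (N : ℝ) ^ (1 + δ) := by
  classical
  obtain ⟨M, hM⟩ := exists_nat_ge (max 1081 ((2 * (540 : ℝ) ^ (1 + δ)) ^ (1 / δ)))
  have hM1 : 1081 ≤ M := by exact_mod_cast (le_max_left _ _).trans hM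
  have hM0 : (0 : ℝ) < M := by positivity
  have hMδ : 2 * (540 : ℝ) ^ (1 + δ) ≤ (M : ℝ) ^ δ := by
    have h1 := (le_max_right _ _).trans hM
    have h2 := Real.rpow_le_rpow (by positivity) h1 hδ.le
    rwa [← Real.rpow_mul (by positivity), one_div_mul_cancel hδ.ne', Real.rpow_one] at h2
  refine ⟨60 * M, by positivity, fun K _ N => ?_⟩
  induction N using Nat.strong_induction_on with
  | _ N ih =>
  intro k L₁ L₂ hL₁ hL₂ hc₁ hc₂ hk hchar
  rcases Nat.eq_zero_or_pos N with rfl | hN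
  · have : incidences L₁ L₂ = 0 := by
      rw [Nat.le_zero, card_eq_zero] at hc₂
      simp [incidences, hc₂]
    rw [this]; push_cast; positivity
  have hN1 : (1 : ℝ) ≤ N := by exact_mod_cast hN
  have hNδ : (N : ℝ) ≤ (N : ℝ) ^ (1 + δ) := by
    conv_lhs => rw [← Real.rpow_one (N : ℝ)]
    exact Real.rpow_le_rpow_of_exponent_le hN1 (by linarith)
  have hsq : 1 ≤ √(N : ℝ) := by rwa [Real.one_le_sqrt]
  rcases Nat.lt_or_ge N M with hNM | hNM
  · have h1 : (incidences L₁ L₂ : ℝ) ≤ M * N := by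
      have := incidences_le_mul L₁ L₂
      have h2 : L₂.card * L₁.card ≤ M * N := Nat.mul_le_mul (by omega) hc₁
      exact_mod_cast this.trans h2
    calc (incidences L₁ L₂ : ℝ) ≤ M * N := h1
      _ ≤ M * (N : ℝ) ^ (1 + δ) := by gcongr
      _ = M * 1 * (N : ℝ) ^ (1 + δ) := by ring
      _ ≤ 60 * M * (√N + k) * (N : ℝ) ^ (1 + δ) := by
        gcongr ?_ * ?_ * _
        · linarith
        · have : (0 : ℝ) ≤ k := by positivity
          linarith
  set b := N / M with hb
  have hb1 : 1 ≤ b := (Nat.one_le_div_iff (by omega)).2 hNM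
  have hbN : b * M ≤ N := Nat.div_mul_le_self N M
  have hlt : 540 * b < N := by nlinarith
  have hpiece : ∀ L' ⊆ L₁, L'.card ≤ b + 1 → (incidences L' L₂ : ℝ) ≤
      N * (30 * (√N + k)) + 60 * M * (√N + k) * ((540 * b : ℕ) : ℝ) ^ (1 + δ) := by
    intro L' hL' hc'
    have hsqrt := Nat.sqrt_le' (3 * L'.card)
    have hinj : Set.InjOn Prod.fst (L' : Set (K × K × K)) := hL₁.mono (by exact_mod_cast hL')
    have hk' : ∀ π ∈ L₂, ∀ π' ∈ L₂, π ≠ π' →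
        {q ∈ (L' : Set (K × K × K)) | Incident q π ∧ Incident q π'}.ncard ≤ k :=
      fun π hπ π' hπ' hne => (ncard_common_mono hL' π π').trans (hk π hπ π' hπ' hne)
    obtain ⟨B, hB, hBc, hBG⟩ := exists_sparse_planes hinj hL₂ hk'
      (Nat.lt_succ_sqrt' (3 * L'.card)).le fun j hj0 hj => hchar j hj0 (by nlinarith)
    set m := Nat.sqrt (3 * L'.card) with hm
    have hrec := ih (540 * b) hlt k L' B hinj (hL₂.mono (by exact_mod_cast hB)) (by omega)
      (by omega) (fun π hπ π' hπ' hne => hk' π (hB hπ) π' (hB hπ') hne)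
      fun j hj0 hj => hchar j hj0 (by omega)
    have hrest := hBG (L₂ \ B) sdiff_subset sdiff_disjoint
    have hsum : incidences L' L₂ = incidences L' (L₂ \ B) + incidences L' B :=
      (sum_sdiff hB).symm
    have hmN : (m : ℝ) ≤ 9 / 5 * √N := by
      have h1 : (m : ℝ) ^ 2 ≤ 3 * N := by
        have h2 : m ^ 2 ≤ 3 * N := by omega
        exact_mod_cast h2
      refine le_of_sq_le_sq ?_ (by positivity)
      rw [mul_pow, Real.sq_sqrt (by positivity)]
      nlinarith
    have hrest' : (incidences L' (L₂ \ B) : ℝ) ≤ N * (30 * (√N + k)) := by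
      have h1 : incidences L' (L₂ \ B) ≤ N + N * (k + 15 * m) := by
        refine hrest.trans (by gcongr; omega)
      have h2 : (incidences L' (L₂ \ B) : ℝ) ≤ N + N * (k + 15 * m) := by exact_mod_cast h1
      have h3 : (0 : ℝ) ≤ k := by positivity
      calc (incidences L' (L₂ \ B) : ℝ) ≤ N + N * (k + 15 * m) := h2
        _ = N * (1 + (k + 15 * m)) := by ring
        _ ≤ N * (30 * (√N + k)) := by gcongr; linarith
    have hmono : √((540 * b : ℕ) : ℝ) ≤ √N := by
      apply Real.sqrt_le_sqrt; exact_mod_cast hlt.le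
    rw [hsum, Nat.cast_add]
    refine add_le_add hrest' (hrec.trans ?_)
    gcongr
  have htotal := incidences_le_of_pieces M L₁ (a := b + 1)
    (by have := Nat.lt_mul_div_succ N (show 0 < M by omega); rw [← hb] at this; omega) hpiece
  have hsmall : (M : ℝ) * ((540 * b : ℕ) : ℝ) ^ (1 + δ) ≤ (N : ℝ) ^ (1 + δ) / 2 := by
    have h1 : ((540 * b : ℕ) : ℝ) ≤ 540 * (N / M) := by
      push_cast
      gcongr
      rw [le_div_iff₀ hM0]
      exact_mod_cast hbN
    calc (M : ℝ) * ((540 * b : ℕ) : ℝ) ^ (1 + δ) ≤ M * (540 * (N / M)) ^ (1 + δ) := by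
          gcongr
      _ = M * (540 ^ (1 + δ) * (N ^ (1 + δ) / (M * M ^ δ))) := by
          rw [Real.mul_rpow (by positivity) (by positivity),
            Real.div_rpow (by positivity) (by positivity), Real.rpow_add hM0, Real.rpow_one]
      _ = (540 ^ (1 + δ) / M ^ δ) * N ^ (1 + δ) := by field_simp
      _ ≤ 1 / 2 * N ^ (1 + δ) := by
          refine mul_le_mul_of_nonneg_right ?_ (by positivity)
          rw [div_le_iff₀ (by positivity)]
          linarith
      _ = (N : ℝ) ^ (1 + δ) / 2 := by ring
  calc (incidences L₁ L₂ : ℝ) ≤ M * (N * (30 * (√N + k)) +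
        60 * M * (√N + k) * ((540 * b : ℕ) : ℝ) ^ (1 + δ)) := htotal
    _ = 30 * M * (√N + k) * N +
        60 * M * (√N + k) * (M * ((540 * b : ℕ) : ℝ) ^ (1 + δ)) := by ring
    _ ≤ 30 * M * (√N + k) * N ^ (1 + δ) + 60 * M * (√N + k) * (N ^ (1 + δ) / 2) := by
        gcongr
    _ = 60 * M * (√N + k) * (N : ℝ) ^ (1 + δ) := by ring

end Recursion

section Shear

variable {K : Type*} [Field K]

theorem exists_forall_eval_ne_zero [Infinite K] (T : Finset (Polynomial K)) (hT : ∀ P ∈ T, P ≠ 0) :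
    ∃ t : K, ∀ P ∈ T, P.eval t ≠ 0 := by
  have h0 : ∏ P ∈ T, P ≠ 0 := prod_ne_zero_iff.2 hT
  by_contra! h
  refine h0 (Polynomial.funext fun t => ?_)
  obtain ⟨P, hP, hPt⟩ := h t
  rw [Polynomial.eval_prod, Polynomial.eval_zero]
  exact prod_eq_zero hP hPt

/-- A projective transformation of points preserving incidence together with `shearPlane`. -/
noncomputable def shearPoint (t : K) (q : K × K × K) : K × K × K :=
  ((q.1 + t * q.2.1 + t ^ 2 * q.2.2) / (1 - t ^ 3 * q.2.1), q.2.1 / (1 - t ^ 3 * q.2.1),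
    q.2.2 / (1 - t ^ 3 * q.2.1))

/-- The transformation of planes corresponding to `shearPoint`. -/
noncomputable def shearPlane (t : K) (π : K × K × K) : K × K × K :=
  ((π.1 + t * π.2.1 - t ^ 3 * π.2.2) / (1 + t ^ 2 * π.2.1), π.2.1 / (1 + t ^ 2 * π.2.1),
    π.2.2 / (1 + t ^ 2 * π.2.1))

theorem incident_shear {t : K} {q π : K × K × K} (hq : 1 - t ^ 3 * q.2.1 ≠ 0)
    (hπ : 1 + t ^ 2 * π.2.1 ≠ 0) :
    Incident (shearPoint t q) (shearPlane t π) ↔ Incident q π := by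
  simp only [Incident, shearPoint, shearPlane]
  rw [← sub_eq_zero, ← sub_eq_zero (a := q.2.1 * π.1 + q.2.2)]
  have : q.2.1 / (1 - t ^ 3 * q.2.1) * ((π.1 + t * π.2.1 - t ^ 3 * π.2.2) / (1 + t ^ 2 * π.2.1)) +
      q.2.2 / (1 - t ^ 3 * q.2.1) - (π.2.1 / (1 + t ^ 2 * π.2.1) *
        ((q.1 + t * q.2.1 + t ^ 2 * q.2.2) / (1 - t ^ 3 * q.2.1)) +
          π.2.2 / (1 + t ^ 2 * π.2.1)) =
      (q.2.1 * π.1 + q.2.2 - (π.2.1 * q.1 + π.2.2)) /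
        ((1 - t ^ 3 * q.2.1) * (1 + t ^ 2 * π.2.1)) := by
    obtain ⟨d, hd⟩ : ∃ d, d = 1 - t ^ 3 * q.2.1 := ⟨_, rfl⟩
    obtain ⟨e, he⟩ : ∃ e, e = 1 + t ^ 2 * π.2.1 := ⟨_, rfl⟩
    rw [← hd] at hq ⊢
    rw [← he] at hπ ⊢
    field_simp
    rw [hd, he]
    ring
  rw [this, div_eq_zero_iff, or_iff_left (mul_ne_zero hq hπ)]

open Polynomial in
theorem exists_generic_shear [Infinite K] (L₁ L₂ : Finset (K × K × K)) :
    ∃ t : K, Set.InjOn (fun q => (shearPoint t q).1) (L₁ : Set (K × K × K)) ∧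
      Set.InjOn (fun π => (shearPlane t π).1) (L₂ : Set (K × K × K)) ∧
      ∀ q ∈ L₁, ∀ π ∈ L₂, Incident (shearPoint t q) (shearPlane t π) ↔ Incident q π := by
  classical
  let p₁ : K × K × K → K[X] := fun q => 1 - X ^ 3 * C q.2.1
  let p₂ : K × K × K → K[X] := fun π => 1 + X ^ 2 * C π.2.1
  let p₃ : (K × K × K) × (K × K × K) → K[X] := fun s =>
    (C s.1.1 + X * C s.1.2.1 + X ^ 2 * C s.1.2.2) * p₁ s.2 -
      (C s.2.1 + X * C s.2.2.1 + X ^ 2 * C s.2.2.2) * p₁ s.1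
  let p₄ : (K × K × K) × (K × K × K) → K[X] := fun s =>
    (C s.1.1 + X * C s.1.2.1 - X ^ 3 * C s.1.2.2) * p₂ s.2 -
      (C s.2.1 + X * C s.2.2.1 - X ^ 3 * C s.2.2.2) * p₂ s.1
  have hp₁ (q) : p₁ q ≠ 0 := by
    intro h
    have := congrArg (Polynomial.eval 0) h
    simp [p₁] at this
  have hp₂ (π) : p₂ π ≠ 0 := by
    intro h
    have := congrArg (Polynomial.eval 0) h
    simp [p₂] at this
  have hp₃ (s : (K × K × K) × (K × K × K)) (hs : s.1 ≠ s.2) : p₃ s ≠ 0 := by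
    intro h
    apply hs
    have he : p₃ s = C (s.1.1 - s.2.1) + C (s.1.2.1 - s.2.2.1) * X +
        C (s.1.2.2 - s.2.2.2) * X ^ 2 + C (s.2.1 * s.1.2.1 - s.1.1 * s.2.2.1) * X ^ 3 +
        C (s.2.2.2 * s.1.2.1 - s.1.2.2 * s.2.2.1) * X ^ 5 := by
      simp only [p₃, p₁, C_sub, C_mul]; ring
    rw [he] at h
    have h0 := congrArg (Polynomial.coeff · 0) h
    have h1 := congrArg (Polynomial.coeff · 1) h
    have h2 := congrArg (Polynomial.coeff · 2) h
    simp [coeff_X, coeff_X_pow, coeff_C, -map_sub, sub_eq_zero] at h0 h1 h2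
    exact Prod.ext h0 (Prod.ext h1 h2)
  have hp₄ (s : (K × K × K) × (K × K × K)) (hs : s.1 ≠ s.2) : p₄ s ≠ 0 := by
    intro h
    apply hs
    have he : p₄ s = C (s.1.1 - s.2.1) + C (s.1.2.1 - s.2.2.1) * X +
        C (s.1.1 * s.2.2.1 - s.2.1 * s.1.2.1) * X ^ 2 + C (s.2.2.2 - s.1.2.2) * X ^ 3 +
        C (s.2.2.2 * s.1.2.1 - s.1.2.2 * s.2.2.1) * X ^ 5 := by
      simp only [p₄, p₂, C_sub, C_mul]; ring
    rw [he] at h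
    have h0 := congrArg (Polynomial.coeff · 0) h
    have h1 := congrArg (Polynomial.coeff · 1) h
    have h3 := congrArg (Polynomial.coeff · 3) h
    simp [coeff_X, coeff_X_pow, coeff_C, -map_sub, sub_eq_zero] at h0 h1 h3
    exact Prod.ext h0 (Prod.ext h1 h3.symm)
  obtain ⟨t, ht⟩ := exists_forall_eval_ne_zero
    (L₁.image p₁ ∪ L₂.image p₂ ∪ L₁.offDiag.image p₃ ∪ L₂.offDiag.image p₄) (by
      intro P hP
      simp only [mem_union, mem_image, mem_offDiag] at hP
      rcases hP with ((⟨q, -, rfl⟩ | ⟨q, -, rfl⟩) | ⟨s, hs, rfl⟩) | ⟨s, hs, rfl⟩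
      · exact hp₁ q
      · exact hp₂ q
      · exact hp₃ s hs.2.2
      · exact hp₄ s hs.2.2)
  have h₁ : ∀ q ∈ L₁, 1 - t ^ 3 * q.2.1 ≠ 0 := fun q hq => by
    simpa only [p₁, eval_sub, eval_mul, eval_C, eval_X, eval_pow, eval_one] using
      ht (p₁ q) (mem_union_left _ (mem_union_left _
      (mem_union_left _ (mem_image_of_mem _ hq))))
  have h₂ : ∀ q ∈ L₂, 1 + t ^ 2 * q.2.1 ≠ 0 := fun q hq => by
    simpa only [p₂, eval_add, eval_mul, eval_C, eval_X, eval_pow, eval_one] using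
      ht (p₂ q) (mem_union_left _ (mem_union_left _
      (mem_union_right _ (mem_image_of_mem _ hq))))
  refine ⟨t, fun q hq q' hq' h => ?_, fun q hq q' hq' h => ?_, fun q hq π hπ =>
    incident_shear (h₁ q hq) (h₂ π hπ)⟩
  · by_contra hne
    refine ht (p₃ (q, q')) (mem_union_left _ (mem_union_right _
      (mem_image_of_mem _ (mem_offDiag.2 ⟨hq, hq', hne⟩)))) ?_
    simp only [shearPoint] at h
    rw [div_eq_div_iff (h₁ q hq) (h₁ q' hq')] at h
    simp only [p₃, p₁, eval_sub, eval_mul, eval_add, eval_C, eval_X, eval_pow, eval_one]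
    rw [h, sub_self]
  · by_contra hne
    refine ht (p₄ (q, q')) (mem_union_right _
      (mem_image_of_mem _ (mem_offDiag.2 ⟨hq, hq', hne⟩))) ?_
    simp only [shearPlane] at h
    rw [div_eq_div_iff (h₂ q hq) (h₂ q' hq')] at h
    simp only [p₄, p₂, eval_sub, eval_mul, eval_add, eval_C, eval_X, eval_pow, eval_one]
    rw [h, sub_self]

end Shear

theorem incident_map {K K' : Type*} [Field K] [Field K'] (i : K →+* K') (q π : K × K × K) :
    Incident (i q.1, i q.2.1, i q.2.2) (i π.1, i π.2.1, i π.2.2) ↔ Incident q π := by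
  simp only [Incident, ← map_mul, ← map_add, i.injective.eq_iff]

theorem incidences_image {K K' : Type*} [Field K] [Field K'] [DecidableEq K']
    {φ ψ : K × K × K → K' × K' × K'}
    {L G : Finset (K × K × K)} (hφ : Set.InjOn φ (L : Set (K × K × K)))
    (hψ : Set.InjOn ψ (G : Set (K × K × K)))
    (h : ∀ q ∈ L, ∀ π ∈ G, Incident (φ q) (ψ π) ↔ Incident q π) :
    incidences (L.image φ) (G.image ψ) = incidences L G := by
  classical
  rw [incidences, sum_image hψ]
  refine sum_congr rfl fun π hπ => ?_
  have : pointsOn (L.image φ) (ψ π) = (pointsOn L π).image φ := by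
    ext q
    simp only [mem_pointsOn, mem_image]
    constructor
    · rintro ⟨⟨q, hq, rfl⟩, hinc⟩
      exact ⟨q, ⟨hq, (h q hq π hπ).1 hinc⟩, rfl⟩
    · rintro ⟨q, ⟨hq, hinc⟩, rfl⟩
      exact ⟨⟨q, hq, rfl⟩, (h q hq π hπ).2 hinc⟩
  rw [this, card_image_of_injOn]
  exact hφ.mono (by exact_mod_cast pointsOn_subset L π)

theorem exists_incidences_bound_zmod (δ : ℝ) (hδ : 0 < δ) :
    ∃ C : ℝ, 0 < C ∧ ∀ (p : ℕ) [Fact p.Prime] (N k : ℕ)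
      (L₁ L₂ : Finset (ZMod p × ZMod p × ZMod p)), L₁.card ≤ N → L₂.card ≤ N →
      (∀ π ∈ L₂, ∀ π' ∈ L₂, π ≠ π' → ∀ S ⊆ L₁,
        (∀ q ∈ S, Incident q π ∧ Incident q π') → S.card ≤ k) →
      27 * N < p ^ 2 →
      (incidences L₁ L₂ : ℝ) ≤ C * (√N + k) * (N : ℝ) ^ (1 + δ) := by
  classical
  obtain ⟨C, hC, hbound⟩ := exists_incidences_bound δ hδ
  refine ⟨C, hC, fun p hp N k L₁ L₂ h₁ h₂ hk hN => ?_⟩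
  let K := AlgebraicClosure (ZMod p)
  let i : ZMod p →+* K := algebraMap _ _
  let ι : ZMod p × ZMod p × ZMod p → K × K × K := fun q => (i q.1, i q.2.1, i q.2.2)
  have hι : Function.Injective ι := by
    rintro ⟨x, y, z⟩ ⟨x', y', z'⟩ h
    simpa [ι, i.injective.eq_iff] using h
  obtain ⟨t, ht₁, ht₂, hinc⟩ := exists_generic_shear (L₁.image ι) (L₂.image ι)
  let φ : ZMod p × ZMod p × ZMod p → K × K × K := fun q => shearPoint t (ι q)
  let ψ : ZMod p × ZMod p × ZMod p → K × K × K := fun q => shearPlane t (ι q)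
  have hφ : Set.InjOn (fun q => (φ q).1) (L₁ : Set (ZMod p × ZMod p × ZMod p)) :=
    fun q hq q' hq' h => hι (ht₁ (mem_image_of_mem ι hq) (mem_image_of_mem ι hq') h)
  have hψ : Set.InjOn (fun q => (ψ q).1) (L₂ : Set (ZMod p × ZMod p × ZMod p)) :=
    fun q hq q' hq' h => hι (ht₂ (mem_image_of_mem ι hq) (mem_image_of_mem ι hq') h)
  have hφ' : Set.InjOn φ (L₁ : Set (ZMod p × ZMod p × ZMod p)) :=
    fun q hq q' hq' h => hφ hq hq' (congrArg Prod.fst h)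
  have hψ' : Set.InjOn ψ (L₂ : Set (ZMod p × ZMod p × ZMod p)) :=
    fun q hq q' hq' h => hψ hq hq' (congrArg Prod.fst h)
  have hiff : ∀ q ∈ L₁, ∀ π ∈ L₂, Incident (φ q) (ψ π) ↔ Incident q π := fun q hq π hπ =>
    (hinc _ (mem_image_of_mem _ hq) _ (mem_image_of_mem _ hπ)).trans (incident_map i q π)
  rw [← incidences_image hφ' hψ' hiff]
  refine hbound K N k _ _ ?_ ?_ (card_image_le.trans h₁) (card_image_le.trans h₂) ?_ ?_
  · rintro _ hs _ hs' h
    obtain ⟨q, hq, rfl⟩ := mem_image.1 (mem_coe.1 hs)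
    obtain ⟨q', hq', rfl⟩ := mem_image.1 (mem_coe.1 hs')
    rw [hφ hq hq' h]
  · rintro _ hs _ hs' h
    obtain ⟨q, hq, rfl⟩ := mem_image.1 (mem_coe.1 hs)
    obtain ⟨q', hq', rfl⟩ := mem_image.1 (mem_coe.1 hs')
    rw [hψ hq hq' h]
  · intro _ hs _ hs' hne
    obtain ⟨π, hπ, rfl⟩ := mem_image.1 hs
    obtain ⟨π', hπ', rfl⟩ := mem_image.1 hs'
    refine le_trans (le_of_eq ?_) ((card_image_le (f := φ)).trans
      (hk π hπ π' hπ' (fun h => hne (by rw [h])) (L₁.filter fun q => Incident q π ∧ Incident q π')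
        (filter_subset _ _) fun q hq => (mem_filter.1 hq).2))
    rw [← Set.ncard_coe_finset]
    congr 1
    ext q
    simp only [Set.mem_ofPred_eq, mem_coe, mem_image, mem_filter]
    constructor
    · rintro ⟨⟨q, hq, rfl⟩, hi, hi'⟩
      exact ⟨q, ⟨hq, (hiff q hq π hπ).1 hi, (hiff q hq π' hπ').1 hi'⟩, rfl⟩
    · rintro ⟨q, ⟨hq, hi, hi'⟩, rfl⟩
      exact ⟨⟨q, hq, rfl⟩, (hiff q hq π hπ).2 hi, (hiff q hq π' hπ').2 hi'⟩
  · intro j hj0 hj h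
    have hdvd := (CharP.cast_eq_zero_iff K p j).1 h
    have := Nat.le_of_dvd hj0 hdvd
    nlinarith

section Configuration

variable {p : ℕ} [Fact p.Prime]

/-- The point, or plane, attached to `(c, e, x)`. -/
def config (s : ZMod p × ZMod p × ZMod p) : ZMod p × ZMod p × ZMod p :=
  (s.1, 2 * s.2.1, s.2.1 ^ 2 + s.2.2 - s.1 ^ 2)

theorem config_injective (h2 : (2 : ZMod p) ≠ 0) :
    Function.Injective (config : ZMod p × ZMod p × ZMod p → _) := by
  rintro ⟨c, e, x⟩ ⟨c', e', x'⟩ h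
  simp only [config, Prod.mk.injEq, mul_right_inj' h2] at h
  obtain ⟨rfl, rfl, h⟩ := h
  simpa using h

theorem incident_config {s t : ZMod p × ZMod p × ZMod p}
    (h : (s.1 + s.2.1) ^ 2 + s.2.2 = (t.1 + t.2.1) ^ 2 + t.2.2) :
    Incident (config (s.1, t.2)) (config (t.1, s.2)) := by
  simp only [Incident, config]
  linear_combination -h

/-- The triples `(c, e, x)` with `c ∈ A`, `e ∈ A - A` and `x ∈ P`. -/
def triples (A P : Finset (ZMod p)) : Finset (ZMod p × ZMod p × ZMod p) := A ×ˢ ((A - A) ×ˢ P)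

theorem card_triples (A P : Finset (ZMod p)) :
    (triples A P).card = (A - A).card * A.card * P.card := by
  simp only [triples, card_product]; ring

theorem mem_triples {A P : Finset (ZMod p)} {s : ZMod p × ZMod p × ZMod p} :
    s ∈ triples A P ↔ s.1 ∈ A ∧ s.2.1 ∈ A - A ∧ s.2.2 ∈ P := by
  simp only [triples, mem_product]

theorem card_common_config_le {A P : Finset (ZMod p)}
    {π π' : ZMod p × ZMod p × ZMod p} (hne : π ≠ π')
    {S : Finset (ZMod p × ZMod p × ZMod p)} (hS : S ⊆ (triples A P).image config)
    (hinc : ∀ q ∈ S, Incident q π ∧ Incident q π') : S.card ≤ (A - A).card := by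
  have hx : ∀ q ∈ S, q.1 ∈ A := by
    intro q hq
    obtain ⟨s, hs, rfl⟩ := mem_image.1 (hS hq)
    exact (mem_triples.1 hs).1
  have hy : ∀ q ∈ S, q.2.1 ∈ (A - A).image fun e => 2 * e := by
    intro q hq
    obtain ⟨s, hs, rfl⟩ := mem_image.1 (hS hq)
    exact mem_image_of_mem _ (mem_triples.1 hs).2.1
  unfold Incident at hinc
  by_cases hb : π.1 = π'.1
  · by_cases ha : π.2.1 = π'.2.1
    · rcases S.eq_empty_or_nonempty with rfl | ⟨q, hq⟩
      · simp
      · exfalso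
        obtain ⟨h, h'⟩ := hinc q hq
        refine hne (Prod.ext hb (Prod.ext ha ?_))
        rw [← hb, ← ha] at h'
        linear_combination h' - h
    · refine (card_le_card_of_injOn (fun q : ZMod p × ZMod p × ZMod p => q.2.1)
        (t := (A - A).image fun e => 2 * e) (fun q hq => hy q hq) ?_).trans card_image_le
      intro q hq q' hq' h
      obtain ⟨h₁, h₁'⟩ := hinc q hq
      obtain ⟨h₂, h₂'⟩ := hinc q' hq'
      rw [← hb] at h₁' h₂'
      replace h : q.2.1 = q'.2.1 := h
      have hx : q.1 = q'.1 := by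
        have h0 : (π.2.1 - π'.2.1) * (q.1 - q'.1) = 0 := by
          linear_combination h₁' - h₁ - h₂' + h₂
        rcases mul_eq_zero.1 h0 with h0 | h0
        · exact absurd (sub_eq_zero.1 h0) ha
        · exact sub_eq_zero.1 h0
      rw [hx, h] at h₁
      exact Prod.ext hx (Prod.ext h (by linear_combination h₁ - h₂))
  · refine (card_le_card_of_injOn (fun q : ZMod p × ZMod p × ZMod p => q.1) (t := A)
      (fun q hq => hx q hq) ?_).trans card_le_card_sub_self
    intro q hq q' hq' h
    obtain ⟨h₁, h₁'⟩ := hinc q hq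
    obtain ⟨h₂, h₂'⟩ := hinc q' hq'
    replace h : q.1 = q'.1 := h
    rw [h] at h₁ h₁'
    have hy : q.2.1 = q'.2.1 := by
      have h0 : (π.1 - π'.1) * (q.2.1 - q'.2.1) = 0 := by
        linear_combination h₁ - h₁' - h₂ + h₂'
      rcases mul_eq_zero.1 h0 with h0 | h0
      · exact absurd (sub_eq_zero.1 h0) hb
      · exact sub_eq_zero.1 h0
    rw [hy] at h₁
    exact Prod.ext h (Prod.ext hy (by linear_combination h₁ - h₂))

/-- The triples at which `(c + e) ^ 2 + x` equals `u`. -/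
def triplesAt (A P : Finset (ZMod p)) (u : ZMod p) : Finset (ZMod p × ZMod p × ZMod p) :=
  (triples A P).filter fun s => (s.1 + s.2.1) ^ 2 + s.2.2 = u

theorem incidences_eq_card {K : Type*} [Field K] (L G : Finset (K × K × K))
    [DecidablePred fun s : (K × K × K) × K × K × K => Incident s.1 s.2] :
    incidences L G = ((L ×ˢ G).filter fun s => Incident s.1 s.2).card := by
  classical
  rw [incidences, card_eq_sum_card_fiberwise (f := Prod.snd) (t := G)
    (fun s hs => (mem_product.1 (mem_filter.1 hs).1).2)]
  refine sum_congr rfl fun π hπ => ?_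
  refine card_bij (fun q _ => (q, π)) (fun q hq => ?_) (fun q _ q' _ h => congrArg Prod.fst h) ?_
  · rw [mem_pointsOn] at hq
    simp [hq.1, hq.2, hπ]
  · rintro ⟨q, π'⟩ hs
    simp only [mem_filter, mem_product] at hs
    obtain ⟨⟨⟨hq, -⟩, hinc⟩, rfl⟩ := hs
    exact ⟨q, mem_pointsOn.2 ⟨hq, hinc⟩, rfl⟩

theorem sum_sq_card_triplesAt_le (h2 : (2 : ZMod p) ≠ 0) (A P U : Finset (ZMod p)) :
    ∑ u ∈ U, (triplesAt A P u).card ^ 2 ≤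
      incidences ((triples A P).image config) ((triples A P).image config) := by
  classical
  rw [incidences_eq_card]
  have hsum : ∑ u ∈ U, (triplesAt A P u).card ^ 2 =
      (U.sigma fun u => triplesAt A P u ×ˢ triplesAt A P u).card := by
    rw [card_sigma]
    exact sum_congr rfl fun u _ => by rw [card_product, sq]
  rw [hsum]
  refine card_le_card_of_injOn
    (fun s => (config (s.2.1.1, s.2.2.2), config (s.2.2.1, s.2.1.2))) ?_ ?_
  · rintro ⟨u, s, t⟩ h
    simp only [coe_sigma, Set.mem_sigma_iff, mem_coe, mem_product, triplesAt, mem_filter,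
      mem_triples] at h
    obtain ⟨-, ⟨⟨hs1, hs2, hs3⟩, hs⟩, ⟨ht1, ht2, ht3⟩, ht⟩ := h
    rw [mem_coe, mem_filter, mem_product]
    exact ⟨⟨mem_image_of_mem _ (mem_triples.2 ⟨hs1, ht2, ht3⟩),
      mem_image_of_mem _ (mem_triples.2 ⟨ht1, hs2, hs3⟩)⟩, incident_config (hs.trans ht.symm)⟩
  · rintro ⟨u, s, t⟩ h ⟨u', s', t'⟩ h' heq
    simp only [coe_sigma, Set.mem_sigma_iff, mem_coe, mem_product, triplesAt, mem_filter] at h h'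
    simp only [Prod.mk.injEq, (config_injective h2).eq_iff] at heq
    obtain ⟨⟨h1, h2⟩, h3, h4⟩ := heq
    obtain rfl : s = s' := Prod.ext h1 h4
    obtain rfl : t = t' := Prod.ext h3 h2
    obtain rfl : u = u' := h.2.1.2.symm.trans h'.2.1.2
    rfl

theorem le_sum_card_triplesAt {A P : Finset (ZMod p)} {τ : ℕ} (hP : ∀ x ∈ P, τ ≤ rep A x) :
    A.card * P.card * τ ≤ ∑ u ∈ sqSet A, (triplesAt A P u).card := by
  classical
  have hroot : ∀ v ∈ sqSet A, ∃ b ∈ A, b ^ 2 = v := fun v hv => mem_image.1 hv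
  choose! r hrA hr using hroot
  have h1 : ∑ u ∈ sqSet A, (triplesAt A P u).card =
      ((triples A P).filter fun s => (s.1 + s.2.1) ^ 2 + s.2.2 ∈ sqSet A).card := by
    have hmaps : Set.MapsTo (fun s : ZMod p × ZMod p × ZMod p => (s.1 + s.2.1) ^ 2 + s.2.2)
        ((triples A P).filter fun s => (s.1 + s.2.1) ^ 2 + s.2.2 ∈ sqSet A) (sqSet A) :=
      fun s hs => (mem_filter.1 (mem_coe.1 hs)).2
    rw [card_eq_sum_card_fiberwise hmaps]
    refine sum_congr rfl fun u hu => ?_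
    rw [triplesAt, filter_filter]
    congr 1
    refine filter_congr fun s _ => ?_
    constructor
    · rintro rfl; exact ⟨hu, rfl⟩
    · exact fun h => h.2
  rw [h1, card_eq_sum_card_fiberwise
    (f := fun s : ZMod p × ZMod p × ZMod p => (s.1, s.2.2)) (t := A ×ˢ P)
    (fun s hs => by
      have := mem_triples.1 (mem_filter.1 (mem_coe.1 hs)).1
      exact mem_product.2 ⟨this.1, this.2.2⟩), ← card_product, ← smul_eq_mul]
  refine card_nsmul_le_sum _ _ _ fun cx hcx => ?_
  obtain ⟨c, x⟩ := cx
  obtain ⟨hc, hx⟩ := mem_product.1 hcx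
  refine (hP x hx).trans (card_le_card_of_injOn (fun uv => (c, r uv.2 - c, x)) ?_ ?_)
  · rintro ⟨u, v⟩ huv
    simp only [coe_filter, mem_product, Set.mem_ofPred_eq] at huv
    obtain ⟨⟨hu, hv⟩, rfl⟩ := huv
    simp only [coe_filter, Set.mem_ofPred_eq, mem_filter, mem_triples]
    refine ⟨⟨⟨hc, sub_mem_sub (hrA v hv) hc, hx⟩, ?_⟩, trivial⟩
    rw [add_sub_cancel, hr v hv, add_sub_cancel]
    exact hu
  · rintro ⟨u, v⟩ huv ⟨u', v'⟩ huv' h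
    simp only [coe_filter, mem_product, Set.mem_ofPred_eq] at huv huv'
    simp only [Prod.mk.injEq, sub_left_inj, true_and, and_true] at h
    have hv : v = v' := by rw [← hr v huv.1.2, ← hr v' huv'.1.2, h]
    subst hv
    have hu : u = u' := sub_left_injective (huv.2.trans huv'.2.symm)
    rw [hu]

theorem card_sq_mul_le_incidences (h2 : (2 : ZMod p) ≠ 0) {A P : Finset (ZMod p)} {τ : ℕ}
    (hP : ∀ x ∈ P, τ ≤ rep A x) :
    (A.card * P.card * τ) ^ 2 ≤ A.card *
      incidences ((triples A P).image config) ((triples A P).image config) := by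
  calc (A.card * P.card * τ) ^ 2 ≤ (∑ u ∈ sqSet A, (triplesAt A P u).card) ^ 2 :=
        Nat.pow_le_pow_left (le_sum_card_triplesAt hP) 2
    _ ≤ (sqSet A).card * ∑ u ∈ sqSet A, (triplesAt A P u).card ^ 2 := by
        exact_mod_cast sq_sum_le_card_mul_sum_sq (α := ℕ)
    _ ≤ _ := Nat.mul_le_mul card_image_le (sum_sq_card_triplesAt_le h2 A P _)

theorem rep_le_card (A : Finset (ZMod p)) (x : ZMod p) : rep A x ≤ A.card := by
  refine (card_le_card_of_injOn Prod.snd (t := sqSet A) ?_ ?_).trans card_image_le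
  · rintro ⟨u, v⟩ h
    simp only [coe_filter, mem_product, Set.mem_ofPred_eq] at h
    exact h.1.2
  · rintro ⟨u, v⟩ h ⟨u', v'⟩ h' heq
    simp only [coe_filter, mem_product, Set.mem_ofPred_eq] at h h'
    replace heq : v = v' := heq
    subst heq
    rw [sub_left_injective (h.2.trans h'.2.symm)]

end Configuration

theorem pow_four_mul_le_of_sq_le {C d n m τ E N : ℝ} (hC : 0 < C) (hn : 0 < n) (hm : 0 < m)
    (hnd : n ≤ d) (hτ0 : 0 ≤ τ) (hτ : τ ≤ n) (hE : 1 ≤ E) (hN : N = d * n * m)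
    (h : (n * m * τ) ^ 2 ≤ n * (C * (√N + d) * (N * E))) :
    τ ^ 4 * m ≤ (4 * C ^ 2 + 2 * C) * E ^ 2 * d ^ 3 * n := by
  have hd : 0 < d := hn.trans_le hnd
  have hkey : τ ^ 2 * m ≤ C * d * (√N + d) * E := by
    have h2 : n ^ 2 * m * (τ ^ 2 * m) ≤ n ^ 2 * m * (C * d * (√N + d) * E) := by
      calc _ = (n * m * τ) ^ 2 := by ring
        _ ≤ n * (C * (√N + d) * (N * E)) := h
        _ = n * (C * (√N + d) * (d * n * m * E)) := by rw [← hN]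
        _ = _ := by ring
    exact le_of_mul_le_mul_left h2 (by positivity)
  rcases le_total d √N with hle | hle
  · have h1 : τ ^ 2 * m ≤ 2 * C * d * √N * E := by
      refine hkey.trans ?_
      have : C * d * (√N + d) * E ≤ C * d * (√N + √N) * E := by gcongr
      linarith
    have h2 : (τ ^ 2 * m) ^ 2 ≤ (2 * C * d * √N * E) ^ 2 :=
      pow_le_pow_left₀ (by positivity) h1 2
    have h3 : (2 * C * d * √N * E) ^ 2 = 4 * C ^ 2 * E ^ 2 * d ^ 3 * n * m := by
      rw [mul_pow, mul_pow (2 * C * d), Real.sq_sqrt (by rw [hN]; positivity), hN]; ring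
    have h4 : τ ^ 4 * m ≤ 4 * C ^ 2 * E ^ 2 * d ^ 3 * n := by
      refine le_of_mul_le_mul_right ?_ hm
      linarith
    have h5 : 0 ≤ 2 * C * E ^ 2 * d ^ 3 * n := by positivity
    linarith
  · have h1 : τ ^ 2 * m ≤ 2 * C * d ^ 2 * E := by
      refine hkey.trans ?_
      have : C * d * (√N + d) * E ≤ C * d * (d + d) * E := by gcongr
      linarith
    have h2 : τ ^ 2 ≤ n * d := by
      rw [sq]; exact mul_le_mul hτ (hτ.trans hnd) hτ0 hn.le
    have hEE : E ≤ E ^ 2 := by nlinarith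
    have h5 : 0 ≤ 4 * C ^ 2 * E ^ 2 * d ^ 3 * n := by positivity
    calc τ ^ 4 * m = τ ^ 2 * (τ ^ 2 * m) := by ring
      _ ≤ (n * d) * (2 * C * d ^ 2 * E) := mul_le_mul h2 h1 (by positivity) (by positivity)
      _ ≤ (n * d) * (2 * C * d ^ 2 * E ^ 2) := by gcongr
      _ ≤ _ := by linarith

theorem pow_four_mul_card_le (ε : ℝ) (hε : 0 < ε) :
    ∃ C : ℝ, 0 < C ∧ ∀ (p : ℕ) [Fact p.Prime] (A P : Finset (ZMod p)) (τ : ℕ),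
      30 * ((A - A).card * A.card * (sqDiff A).card) ≤ p ^ 2 → P ⊆ sqDiff A →
      (∀ x ∈ P, τ ≤ rep A x) →
      (τ : ℝ) ^ 4 * P.card ≤ C * (p : ℝ) ^ ε * ((A - A).card : ℝ) ^ 3 * A.card := by
  obtain ⟨C, hC, h⟩ := exists_incidences_bound_zmod (ε / 4) (by positivity)
  refine ⟨4 * C ^ 2 + 2 * C, by positivity, fun p _ A P τ hA hPA hP => ?_⟩
  have hp : p.Prime := Fact.out
  rcases P.eq_empty_or_nonempty with rfl | hPne
  · simp only [card_empty, Nat.cast_zero, mul_zero]; positivity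
  have hPpos : 0 < P.card := hPne.card_pos
  obtain ⟨x, hx⟩ := hPne
  have hτn : τ ≤ A.card := (hP x hx).trans (rep_le_card A x)
  rcases A.eq_empty_or_nonempty with rfl | hAne
  · obtain rfl : τ = 0 := by simpa using hτn
    simp
  have hnpos : 0 < A.card := hAne.card_pos
  have hnd : A.card ≤ (A - A).card := card_le_card_sub_self
  set d := (A - A).card with hd
  set n := A.card with hn
  set m := P.card with hm
  have hNle : d * n * m ≤ d * n * (sqDiff A).card := Nat.mul_le_mul_left _ (card_le_card hPA)
  have hNpos : 0 < d * n * m := by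
    have : 0 < d := hnpos.trans_le hnd
    positivity
  have h27 : 27 * (d * n * m) < p ^ 2 := by omega
  have h2 : (2 : ZMod p) ≠ 0 := by
    intro h0
    have : ((2 : ℕ) : ZMod p) = 0 := by exact_mod_cast h0
    have h3 := Nat.le_of_dvd (by norm_num) ((ZMod.natCast_eq_zero_iff 2 p).1 this)
    nlinarith
  have hcard : ((triples A P).image config).card ≤ d * n * m :=
    card_image_le.trans (card_triples A P).le
  have hinc := h p (d * n * m) d _ _ hcard hcard
    (fun π _ π' _ hne S hS hq => card_common_config_le hne hS hq) h27
  have hCS : ((n * m * τ : ℕ) : ℝ) ^ 2 ≤ n * (incidences ((triples A P).image config)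
      ((triples A P).image config) : ℝ) := by
    exact_mod_cast card_sq_mul_le_incidences h2 hP
  set N := d * n * m with hN
  have hNR : (0 : ℝ) < N := by exact_mod_cast hNpos
  have hNR1 : (1 : ℝ) ≤ N := by exact_mod_cast hNpos
  have hNeq : (N : ℝ) = d * n * m := by rw [hN]; push_cast; ring
  have hnR : (0 : ℝ) < n := by exact_mod_cast hnpos
  have hmR : (0 : ℝ) < m := by exact_mod_cast hPpos
  have hndR : (n : ℝ) ≤ d := by exact_mod_cast hnd
  set E := (N : ℝ) ^ (ε / 4) with hE
  have hE1 : 1 ≤ E := Real.one_le_rpow hNR1 (by positivity)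
  have hEp : E ^ 2 ≤ (p : ℝ) ^ ε := by
    have hNp : (N : ℝ) ≤ (p : ℝ) ^ (2 : ℝ) := by
      rw [Real.rpow_two]
      exact_mod_cast (show N ≤ p ^ 2 by omega)
    have hp0 : (0 : ℝ) ≤ p := Nat.cast_nonneg _
    calc E ^ 2 ≤ (((p : ℝ) ^ (2 : ℝ)) ^ (ε / 4)) ^ 2 :=
          pow_le_pow_left₀ (by positivity)
            (Real.rpow_le_rpow hNR.le hNp (by positivity)) 2
      _ = (p : ℝ) ^ ε := by
          rw [← Real.rpow_mul hp0, ← Real.rpow_natCast, ← Real.rpow_mul hp0]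
          congr 1; push_cast; ring
  rw [Real.rpow_add hNR, Real.rpow_one] at hinc
  refine (pow_four_mul_le_of_sq_le hC hnR hmR hndR (Nat.cast_nonneg _) (by exact_mod_cast hτn)
    hE1 hNeq ?_).trans (by gcongr)
  refine le_trans ?_ (mul_le_mul_of_nonneg_left hinc hnR.le)
  exact_mod_cast hCS

theorem E4_le_sum_rep {p : ℕ} [Fact p.Prime] (A : Finset (ZMod p)) :
    E4 A ≤ ∑ x ∈ sqDiff A, rep A x ^ 4 := by
  classical
  have hsub : {v : Fin 4 → ZMod p × ZMod p | (∀ i, (v i).1 ∈ sqSet A ∧ (v i).2 ∈ sqSet A) ∧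
      ∀ i, (v i).1 - (v i).2 = (v 0).1 - (v 0).2} ⊆
      (((sqDiff A).biUnion fun x => Fintype.piFinset fun _ : Fin 4 =>
        (sqSet A ×ˢ sqSet A).filter fun q => q.1 - q.2 = x : Finset _) :
          Set (Fin 4 → ZMod p × ZMod p)) := by
    rintro v ⟨hv, hv'⟩
    rw [mem_coe, mem_biUnion]
    refine ⟨(v 0).1 - (v 0).2, sub_mem_sub (hv 0).1 (hv 0).2, ?_⟩
    rw [Fintype.mem_piFinset]
    exact fun i => mem_filter.2 ⟨mem_product.2 (hv i), hv' i⟩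
  refine (Set.ncard_le_ncard hsub (finite_toSet _)).trans ?_
  rw [Set.ncard_coe_finset]
  refine card_biUnion_le.trans (sum_le_sum fun x _ => ?_)
  rw [Fintype.card_piFinset_const]
  rfl

theorem sum_pow_four_le_sum_dyadic {α : Type*} (S : Finset α) (f : α → ℕ) (b : ℕ)
    (hb : ∀ x ∈ S, f x ≤ b) :
    ∑ x ∈ S, f x ^ 4 ≤ 16 * ∑ i ∈ range (Nat.log 2 b + 1),
      (2 ^ i) ^ 4 * (S.filter fun x => 2 ^ i ≤ f x).card := by
  have hpt : ∀ x ∈ S, f x ^ 4 ≤ 16 * ∑ i ∈ range (Nat.log 2 b + 1),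
      if 2 ^ i ≤ f x then (2 ^ i) ^ 4 else 0 := by
    intro x hx
    rcases Nat.eq_zero_or_pos (f x) with h0 | hpos
    · simp [h0]
    have hle : 2 ^ Nat.log 2 (f x) ≤ f x := Nat.pow_log_le_self 2 hpos.ne'
    have hlt : f x < 2 ^ (Nat.log 2 (f x) + 1) := Nat.lt_pow_succ_log_self one_lt_two _
    have hmem : Nat.log 2 (f x) ∈ range (Nat.log 2 b + 1) :=
      mem_range.2 (Nat.lt_succ_of_le (Nat.log_mono_right (hb x hx)))
    have h1 := single_le_sum (f := fun i => if 2 ^ i ≤ f x then (2 ^ i) ^ 4 else 0)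
      (fun i _ => Nat.zero_le _) hmem
    simp only [hle, if_true] at h1
    calc f x ^ 4 ≤ (2 ^ (Nat.log 2 (f x) + 1)) ^ 4 := Nat.pow_le_pow_left hlt.le 4
      _ = 16 * (2 ^ Nat.log 2 (f x)) ^ 4 := by ring
      _ ≤ _ := Nat.mul_le_mul_left 16 h1
  refine (sum_le_sum hpt).trans ?_
  rw [← mul_sum, sum_comm]
  refine Nat.mul_le_mul_left 16 (sum_le_sum fun i _ => ?_)
  rw [← sum_filter, sum_const, smul_eq_mul, mul_comm]

theorem natLog_add_one_le_rpow {δ : ℝ} (hδ : 0 < δ) {n : ℕ} (hn : 1 ≤ n) :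
    ((Nat.log 2 n : ℝ) + 1) ≤ (1 + 2 / δ) * (n : ℝ) ^ δ := by
  have hn1 : (1 : ℝ) ≤ n := by exact_mod_cast hn
  have h1 : (Nat.log 2 n : ℝ) ≤ Real.logb 2 n := by exact_mod_cast Real.natLog_le_logb n 2
  have h2 : Real.log n ≤ (n : ℝ) ^ δ / δ := Real.log_le_rpow_div (Nat.cast_nonneg n) hδ
  have h3 : Real.logb 2 n ≤ 2 * Real.log n := by
    have := Real.log_two_gt_d9
    rw [Real.logb, div_le_iff₀ (by linarith)]
    nlinarith [Real.log_nonneg hn1]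
  have h4 : 1 ≤ (n : ℝ) ^ δ := Real.one_le_rpow hn1 hδ.le
  calc ((Nat.log 2 n : ℝ) + 1) ≤ 2 * ((n : ℝ) ^ δ / δ) + (n : ℝ) ^ δ := by linarith
    _ = _ := by ring

/-- For every `ε > 0` there exist `C_ε > 0` and `c > 0` such that for every prime `p` and
`A ⊆ 𝔽_p` with `|A-A|·|A|·|A²-A²| ≤ c·p²`, one has `E₄(A²) ≤ C_ε·p^ε·|A-A|³·|A|`. -/
theorem E4_upper (ε : ℝ) (hε : 0 < ε) :
    ∃ Cε c : ℝ, 0 < Cε ∧ 0 < c ∧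
      ∀ (p : ℕ), p.Prime →
        ∀ A : Finset (ZMod p),
          (((A - A).card : ℝ) * (A.card : ℝ) * ((sqDiff A).card : ℝ) ≤ c * (p : ℝ) ^ 2) →
          (E4 A : ℝ) ≤ Cε * (p : ℝ) ^ ε * ((A - A).card : ℝ) ^ 3 * (A.card : ℝ) := by
  obtain ⟨C, hC, h⟩ := pow_four_mul_card_le (ε / 2) (by positivity)
  refine ⟨16 * (1 + 2 / (ε / 2)) * C, 1 / 30, by positivity, by norm_num, fun p hp A hA => ?_⟩
  have : Fact p.Prime := ⟨hp⟩
  have hA' : 30 * ((A - A).card * A.card * (sqDiff A).card) ≤ p ^ 2 := by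
    have : (30 : ℝ) * ((A - A).card * A.card * (sqDiff A).card) ≤ (p : ℝ) ^ 2 := by linarith
    exact_mod_cast this
  have hrep : ∀ x ∈ sqDiff A, rep A x ≤ p := fun x _ =>
    (rep_le_card A x).trans ((card_le_univ A).trans (ZMod.card p).le)
  have hE : (E4 A : ℝ) ≤ 16 * ∑ i ∈ range (Nat.log 2 p + 1),
      ((2 ^ i : ℕ) : ℝ) ^ 4 * ((sqDiff A).filter fun x => 2 ^ i ≤ rep A x).card := by
    exact_mod_cast (E4_le_sum_rep A).trans (sum_pow_four_le_sum_dyadic _ _ p hrep)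
  have hsum := sum_le_card_nsmul (range (Nat.log 2 p + 1)) (fun i =>
      ((2 ^ i : ℕ) : ℝ) ^ 4 * ((sqDiff A).filter fun x => 2 ^ i ≤ rep A x).card) _
    fun i _ => h p A _ (2 ^ i) hA' (filter_subset _ _) fun x hx => (mem_filter.1 hx).2
  rw [card_range, nsmul_eq_mul] at hsum
  have hlog := natLog_add_one_le_rpow (half_pos hε) hp.one_le
  have hpow : (p : ℝ) ^ ε = (p : ℝ) ^ (ε / 2) * (p : ℝ) ^ (ε / 2) := by
    rw [← Real.rpow_add (by exact_mod_cast hp.pos), add_halves]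
  push_cast at hsum hE
  calc (E4 A : ℝ) ≤ _ := hE
    _ ≤ 16 * (((Nat.log 2 p : ℝ) + 1) *
        (C * (p : ℝ) ^ (ε / 2) * ((A - A).card : ℝ) ^ 3 * A.card)) := by gcongr
    _ ≤ 16 * ((1 + 2 / (ε / 2)) * (p : ℝ) ^ (ε / 2) *
        (C * (p : ℝ) ^ (ε / 2) * ((A - A).card : ℝ) ^ 3 * A.card)) := by gcongr
    _ = _ := by rw [hpow]; ring

end FpSumProd
end

section
/- There exist absolute constants C, c > 0 such that the following holds. Let p be a prime and A ⊆ F_p a nonempty finite set with |A−A|·|A|·|A²−A²| ≤ c·p². Then for every w ∈ A²−A², T_w := #{(u,v) ∈ P_w × P_w : u−v ∈ P} satisfies T_w ≤ C·( M^{3/2}·K·|P_w|^{3/2} + M²·K·|P_w| ), where M := |A−A|/|A| and K := |A²−A²|/|A|. -/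
open Finset Pointwise

namespace FpSumProd

section Incidence
open MvPolynomial

theorem totalDegree_det_le {σ R n : Type*} [CommRing R] [Fintype n] [DecidableEq n]
    (M : Matrix n n (MvPolynomial σ R)) {b : ℕ} (h : ∀ i j, (M i j).totalDegree ≤ b) :
    M.det.totalDegree ≤ Fintype.card n * b := by
  rw [Matrix.det_apply]
  refine totalDegree_finsetSum_le fun τ _ => (totalDegree_smul_le _ _).trans ?_
  refine (totalDegree_finsetProd _ _).trans ?_
  simpa using Finset.sum_le_card_nsmul univ _ b fun i _ => h (τ i) i

theorem totalDegree_pderiv_le_sub_one_s12 {σ R : Type*} [CommSemiring R] (i : σ) (F : MvPolynomial σ R) :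
    (pderiv i F).totalDegree ≤ F.totalDegree - 1 := by
  refine Finset.sup_le fun m hm => Nat.le_sub_one_of_lt ?_
  have h : m + Finsupp.single i 1 ∈ F.support := by
    rw [mem_support_iff, coeff_pderiv] at *
    exact left_ne_zero_of_mul hm
  refine lt_of_lt_of_le ?_ (le_totalDegree h)
  rw [Finsupp.sum_add_index' (fun _ => rfl) (fun _ _ _ => rfl), Finsupp.sum_single_index rfl]
  exact Nat.lt_succ_self _

theorem totalDegree_pderiv_le_s12 {σ R : Type*} [CommSemiring R] (i : σ) (F : MvPolynomial σ R) :
    (pderiv i F).totalDegree ≤ F.totalDegree :=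
  (totalDegree_pderiv_le_sub_one_s12 i F).trans (Nat.sub_le _ _)

theorem pderiv_ne_zero {σ K : Type*} [Field K] {p : ℕ} [CharP K p] {i : σ} {F : MvPolynomial σ K}
    (hi : F.degreeOf i ≠ 0) (hp : F.totalDegree < p) : pderiv i F ≠ 0 := by
  classical
  have hF : F ≠ 0 := by rintro rfl; simp at hi
  obtain ⟨m, hm, hmi⟩ := Finset.exists_mem_eq_sup F.support (support_nonempty.2 hF) fun m => m i
  rw [← degreeOf_eq_sup] at hmi
  have h1 : m - Finsupp.single i 1 + Finsupp.single i 1 = m :=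
    tsub_add_cancel_of_le (by simpa [Nat.one_le_iff_ne_zero] using hmi ▸ hi)
  intro h0
  have h2 := coeff_pderiv (i := i) F (m - Finsupp.single i 1 : σ →₀ ℕ)
  rw [h0, h1, coeff_zero, eq_comm, mul_eq_zero] at h2
  refine h2.elim (mem_support_iff.1 hm) fun h => ?_
  rw [← Nat.cast_add_one] at h
  have h3 : (m - Finsupp.single i 1 : σ →₀ ℕ) i + 1 = m i := by
    simpa using congr($h1 i)
  rw [h3, CharP.cast_eq_zero_iff K p] at h
  have := Nat.le_of_dvd (by omega) h
  have := degreeOf_le_totalDegree F i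
  omega

theorem finSuccEquiv_rename_succ {K : Type*} [Field K] (n : ℕ) (R : MvPolynomial (Fin n) K) :
    finSuccEquiv K n (rename Fin.succ R) = Polynomial.C R := by
  have h : (Polynomial.CAlgHom : MvPolynomial (Fin n) K →ₐ[MvPolynomial (Fin n) K] _).restrictScalars K
      = (finSuccEquiv K n : _ →ₐ[K] _).comp (rename Fin.succ) := by
    ext1 i
    simp [finSuccEquiv_X_succ]
  exact congr($h R).symm

theorem exists_eliminant_s12 {K : Type*} [Field K] {F Q : MvPolynomial (Fin 3) K}
    (hF : Irreducible F) (hZ : 0 < F.degreeOf 0) (hQ : ¬ F ∣ Q) {a b : ℕ}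
    (ha : F.totalDegree ≤ a) (hb : Q.totalDegree ≤ b) (hab : a ≤ b) :
    ∃ (A B : MvPolynomial (Fin 3) K) (R : MvPolynomial (Fin 2) K), R ≠ 0 ∧
      R.totalDegree ≤ (a + b) * b ∧ F * A + Q * B = rename Fin.succ R := by
  set e := finSuccEquiv K 2
  have hdeg (G : MvPolynomial (Fin 3) K) (i : ℕ) : ((e G).coeff i).totalDegree ≤ G.totalDegree := by
    by_cases h : (e G).coeff i = 0
    · simp [h]
    · have := totalDegree_coeff_finSuccEquiv_add_le G i h
      exact (Nat.le_add_right _ _).trans this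
  have hFd : (e F).natDegree ≠ 0 := by
    rw [natDegree_finSuccEquiv]; omega
  have hFd' : (e F).natDegree ≤ a := by
    rw [natDegree_finSuccEquiv]; exact (degreeOf_le_totalDegree F 0).trans ha
  have hQd' : (e Q).natDegree ≤ b := by
    rw [natDegree_finSuccEquiv]; exact (degreeOf_le_totalDegree Q 0).trans hb
  have hirr : Irreducible (e F) := (MulEquiv.irreducible_iff e).2 hF
  have hprim : (e F).IsPrimitive := hirr.isPrimitive hFd
  obtain ⟨A, B, -, -, hAB⟩ := Polynomial.exists_mul_add_mul_eq_C_resultant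
    (e F) (e Q) le_rfl le_rfl (.inl hFd)
  refine ⟨e.symm A, e.symm B, (e F).resultant (e Q), ?_, ?_, ?_⟩
  · let k := FractionRing (MvPolynomial (Fin 2) K)
    have hinj := IsFractionRing.injective (MvPolynomial (Fin 2) K) k
    intro h0
    have h1 : ((e F).map (algebraMap _ k)).resultant ((e Q).map (algebraMap _ k)) = 0 := by
      rw [Polynomial.natDegree_map_eq_of_injective hinj, Polynomial.natDegree_map_eq_of_injective hinj,
        Polynomial.resultant_map_map, h0, map_zero]
    rw [Polynomial.resultant_eq_zero_iff] at h1
    have hirr' := (hprim.irreducible_iff_irreducible_map_fraction_map (K := k)).1 hirr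
    refine h1.2 ((EuclideanDomain.dvd_or_coprime _ _ hirr').resolve_left fun hd => hQ ?_)
    have := hprim.dvd_of_fraction_map_dvd_fraction_map hd
    exact (map_dvd_iff e).1 this
  · refine (totalDegree_det_le (b := b) _ fun i j => ?_).trans ?_
    · simp only [Polynomial.sylvester, Matrix.of_apply]
      refine Fin.addCases (fun j => ?_) (fun j => ?_) j
      · simp only [Fin.addCases_left]
        split_ifs
        · exact (hdeg _ _).trans hb
        · simp
      · simp only [Fin.addCases_right]
        split_ifs
        · exact (hdeg _ _).trans (ha.trans hab)
        · simp
    · simp only [Fintype.card_fin]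
      gcongr
  · apply e.injective
    rw [map_add, map_mul, map_mul, e.apply_symm_apply, e.apply_symm_apply, hAB]
    exact (finSuccEquiv_rename_succ 2 _).symm

section Lines
variable {K : Type*} [Field K]

/-- The line `Z = α + βY` in the plane `X = x`, with coordinates ordered as `(Z, X, Y)`. -/
noncomputable def sliceLine (x α β : K) : Fin 3 → Polynomial K :=
  ![Polynomial.C α + Polynomial.C β * Polynomial.X, Polynomial.C x, Polynomial.X]

/-- The line `Z = γ + δX` in the plane `Y = y`, with coordinates ordered as `(Z, X, Y)`. -/
noncomputable def crossLine (y γ δ : K) : Fin 3 → Polynomial K :=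
  ![Polynomial.C γ + Polynomial.C δ * Polynomial.X, Polynomial.X, Polynomial.C y]

theorem derivative_aeval {σ : Type*} [Fintype σ] (L : σ → Polynomial K) (F : MvPolynomial σ K) :
    Polynomial.derivative (aeval L F) =
      ∑ i, aeval L (pderiv i F) * Polynomial.derivative (L i) := by
  classical
  induction F using MvPolynomial.induction_on with
  | C a => simp [Polynomial.algebraMap_eq]
  | add p q hp hq => simp [hp, hq, add_mul, Finset.sum_add_distrib]
  | mul_X p i hp =>
    simp [hp, Derivation.leibniz, pderiv_X, add_mul, Finset.sum_add_distrib, Pi.single_apply,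
      Finset.sum_mul, apply_ite (aeval L), ite_mul]
    simp only [mul_comm, add_comm, mul_assoc]

theorem derivative_aeval_sliceLine (x α β : K) (F : MvPolynomial (Fin 3) K) :
    Polynomial.derivative (aeval (sliceLine x α β) F) =
      aeval (sliceLine x α β) (pderiv 0 F) * Polynomial.C β +
        aeval (sliceLine x α β) (pderiv 2 F) := by
  rw [derivative_aeval, Fin.sum_univ_three]
  simp [sliceLine]

/-- The bordered Hessian of `F` in the variables `Z`, `Y`; it vanishes on every line
`sliceLine` contained in the surface `F = 0`. -/
noncomputable def asymptoticPoly (F : MvPolynomial (Fin 3) K) : MvPolynomial (Fin 3) K :=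
  pderiv 2 (pderiv 2 F) * pderiv 0 F ^ 2
    - (pderiv 0 (pderiv 2 F) + pderiv 2 (pderiv 0 F)) * pderiv 2 F * pderiv 0 F
    + pderiv 0 (pderiv 0 F) * pderiv 2 F ^ 2

theorem totalDegree_asymptoticPoly_le (F : MvPolynomial (Fin 3) K) :
    (asymptoticPoly F).totalDegree ≤ 3 * F.totalDegree := by
  have h1 (i) : (pderiv i F).totalDegree ≤ F.totalDegree := totalDegree_pderiv_le_s12 i F
  have h2 (i j) : (pderiv i (pderiv j F)).totalDegree ≤ F.totalDegree :=
    (totalDegree_pderiv_le_s12 i _).trans (h1 j)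
  have hs (i) : (pderiv i F ^ 2).totalDegree ≤ 2 * F.totalDegree :=
    (totalDegree_pow _ _).trans (by gcongr; exact h1 i)
  refine (totalDegree_add _ _).trans (max_le ((totalDegree_sub _ _).trans (max_le ?_ ?_)) ?_)
  · exact (totalDegree_mul _ _).trans (by linarith [h2 2 2, hs 0])
  · refine (totalDegree_mul _ _).trans ?_
    have := (totalDegree_mul (pderiv 0 (pderiv 2 F) + pderiv 2 (pderiv 0 F)) (pderiv 2 F))
    have := (totalDegree_add (pderiv 0 (pderiv 2 F)) (pderiv 2 (pderiv 0 F))).trans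
      (max_le (h2 0 2) (h2 2 0))
    linarith [h1 0, h1 2]
  · exact (totalDegree_mul _ _).trans (by linarith [h2 0 0, hs 2])

theorem aeval_asymptoticPoly (x α β : K) (F : MvPolynomial (Fin 3) K) :
    ∃ h : Polynomial K, aeval (sliceLine x α β) (asymptoticPoly F) =
      aeval (sliceLine x α β) (pderiv 0 F) ^ 2 *
          Polynomial.derivative (Polynomial.derivative (aeval (sliceLine x α β) F)) +
        Polynomial.derivative (aeval (sliceLine x α β) F) * h := by
  set L := sliceLine x α β
  set w := aeval L (pderiv 0 F)
  refine ⟨-(aeval L (pderiv 0 (pderiv 2 F) + pderiv 2 (pderiv 0 F))) * w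
    + aeval L (pderiv 0 (pderiv 0 F)) * (Polynomial.derivative (aeval L F) - 2 * Polynomial.C β * w), ?_⟩
  simp only [asymptoticPoly, derivative_aeval_sliceLine, L, map_add,
    map_sub, map_mul, map_pow, Polynomial.derivative_mul, Polynomial.derivative_C, w]
  ring

theorem aeval_asymptoticPoly_eq_zero {x α β : K} {F : MvPolynomial (Fin 3) K}
    (h : aeval (sliceLine x α β) F = 0) : aeval (sliceLine x α β) (asymptoticPoly F) = 0 := by
  obtain ⟨g, hg⟩ := aeval_asymptoticPoly x α β F
  simp [hg, h]

theorem natDegree_aeval_sliceLine_le (x α β : K) (F : MvPolynomial (Fin 3) K) :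
    (aeval (sliceLine x α β) F).natDegree ≤ F.totalDegree := by
  refine (aeval_natDegree_le F le_rfl _ (n := 1) fun i => ?_).trans (mul_one _).le
  fin_cases i
  · simpa [sliceLine, add_comm] using Polynomial.natDegree_linear_le (a := β) (b := α)
  · simp [sliceLine]
  · simp [sliceLine]

theorem natDegree_aeval_crossLine_le (y γ δ : K) (F : MvPolynomial (Fin 3) K) :
    (aeval (crossLine y γ δ) F).natDegree ≤ F.totalDegree := by
  refine (aeval_natDegree_le F le_rfl _ (n := 1) fun i => ?_).trans (mul_one _).le
  fin_cases i
  · simpa [crossLine, add_comm] using Polynomial.natDegree_linear_le (a := δ) (b := γ)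
  · simp [crossLine]
  · simp [crossLine]

theorem eval_aeval_sliceLine (x α β t : K) (F : MvPolynomial (Fin 3) K) :
    (aeval (sliceLine x α β) F).eval t = eval ![α + β * t, x, t] F := by
  rw [← Polynomial.coe_evalRingHom, ← AlgHom.coe_toRingHom, ← RingHom.comp_apply]
  congr 1
  ext i
  · simp
  · fin_cases i <;> simp [sliceLine]

theorem eval_aeval_crossLine (y γ δ t : K) (F : MvPolynomial (Fin 3) K) :
    (aeval (crossLine y γ δ) F).eval t = eval ![γ + δ * t, t, y] F := by
  rw [← Polynomial.coe_evalRingHom, ← AlgHom.coe_toRingHom, ← RingHom.comp_apply]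
  congr 1
  ext i
  · simp
  · fin_cases i <;> simp [crossLine]

end Lines

section Lines
variable {K : Type*} [Field K]

theorem exists_rename_eq_of_degreeOf_eq_zero {F : MvPolynomial (Fin 3) K} (h : F.degreeOf 0 = 0) :
    ∃ R : MvPolynomial (Fin 2) K, R.totalDegree ≤ F.totalDegree ∧ rename Fin.succ R = F := by
  refine ⟨(finSuccEquiv K 2 F).coeff 0, ?_, ?_⟩
  · by_cases h0 : (finSuccEquiv K 2 F).coeff 0 = 0
    · simp [h0]
    · exact (Nat.le_add_right _ _).trans (totalDegree_coeff_finSuccEquiv_add_le F 0 h0)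
  · apply (finSuccEquiv K 2).injective
    rw [finSuccEquiv_rename_succ]
    exact (Polynomial.eq_C_of_natDegree_eq_zero (by rw [natDegree_finSuccEquiv, h])).symm

theorem degreeOf_eq_zero_of_dvd_rename {F : MvPolynomial (Fin 3) K} {R : MvPolynomial (Fin 2) K}
    (hR : R ≠ 0) (h : F ∣ rename Fin.succ R) : F.degreeOf 0 = 0 := by
  have h1 := map_dvd (finSuccEquiv K 2) h
  rw [finSuccEquiv_rename_succ] at h1
  have h2 := Polynomial.natDegree_le_of_dvd h1 (by simpa using hR)
  rwa [natDegree_finSuccEquiv, Polynomial.natDegree_C, Nat.le_zero] at h2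

theorem eval_rename_succ (z x y : K) (R : MvPolynomial (Fin 2) K) :
    eval ![z, x, y] (rename Fin.succ R) = eval ![x, y] R := by
  rw [eval_rename]; rfl

theorem eval_eq_zero_of_sliceLine {F : MvPolynomial (Fin 3) K} {x α β : K}
    (h : aeval (sliceLine x α β) F = 0) (y : K) : eval ![α + β * y, x, y] F = 0 := by
  rw [← eval_aeval_sliceLine, h, Polynomial.eval_zero]

theorem eval_eq_zero_of_crossLine {F : MvPolynomial (Fin 3) K} {y γ δ : K}
    (h : aeval (crossLine y γ δ) F = 0) (x : K) : eval ![γ + δ * x, x, y] F = 0 := by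
  rw [← eval_aeval_crossLine, h, Polynomial.eval_zero]

/-- The triple `(x, α, β)` represents the line `Z = α + βY` in the plane `X = x`, and the triple
`(y, γ, δ)` the line `Z = γ + δX` in the plane `Y = y`. `Meets` says that these intersect. -/
def Meets (l m : K × K × K) : Prop := l.2.1 + l.2.2 * m.1 = m.2.1 + m.2.2 * l.1

instance [DecidableEq K] (l m : K × K × K) : Decidable (Meets l m) :=
  inferInstanceAs (Decidable (_ = _))

theorem Meets.symm {l m : K × K × K} (h : Meets l m) : Meets m l := Eq.symm h

/-- The polynomial `F` vanishes on the line `Z = α + βY`, `X = x`. -/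
def VanishesOnSlice (F : MvPolynomial (Fin 3) K) (l : K × K × K) : Prop :=
  aeval (sliceLine l.1 l.2.1 l.2.2) F = 0

/-- The polynomial `F` vanishes on the line `Z = γ + δX`, `Y = y`. -/
def VanishesOnCross (F : MvPolynomial (Fin 3) K) (m : K × K × K) : Prop :=
  aeval (crossLine m.1 m.2.1 m.2.2) F = 0

theorem card_le_of_injOn_roots {ι : Type*} {f : Polynomial K} (hf : f ≠ 0) (s : Finset ι) {g : ι → K}
    (hg : Set.InjOn g s) (h : ∀ i ∈ s, f.eval (g i) = 0) : #s ≤ f.natDegree := by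
  classical
  rw [← card_image_of_injOn hg]
  refine Polynomial.card_le_degree_of_subset_roots fun a ha => ?_
  obtain ⟨i, hi, rfl⟩ := Finset.mem_image.1 (by simpa using ha)
  exact (Polynomial.mem_roots hf).2 (h i hi)

theorem card_le_totalDegree_of_eval_eq_zero [Infinite K] {R : MvPolynomial (Fin 2) K} (hR : R ≠ 0)
    {I : Finset (K × K × K)} (hI : Set.InjOn Prod.fst (I : Set (K × K × K)))
    (h : ∀ l ∈ I, ∀ y, eval ![l.1, y] R = 0) : #I ≤ R.totalDegree := by
  obtain ⟨v, hv⟩ : ∃ v, eval v R ≠ 0 := by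
    by_contra! h0
    exact hR (MvPolynomial.funext fun v => by simpa using h0 v)
  set q := aeval ![Polynomial.X, Polynomial.C (v 1)] R with hq
  have he (t : K) : q.eval t = eval ![t, v 1] R := by
    rw [hq, ← Polynomial.coe_evalRingHom, ← AlgHom.coe_toRingHom, ← RingHom.comp_apply]
    congr 1
    ext i
    · simp
    · fin_cases i <;> simp
  have hq0 : q ≠ 0 := by
    intro h0
    have := he (v 0)
    rw [h0, Polynomial.eval_zero, show ![v 0, v 1] = v by ext i; fin_cases i <;> rfl] at this
    exact hv this.symm
  refine (card_le_of_injOn_roots hq0 I hI fun l hl => by rw [he, h l hl]).trans ?_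
  refine (aeval_natDegree_le R le_rfl _ (n := 1) fun i => ?_).trans (mul_one _).le
  fin_cases i <;> simp

theorem card_le_of_degreeOf_eq_zero [Infinite K] {F : MvPolynomial (Fin 3) K} (hF : F ≠ 0)
    (h : F.degreeOf 0 = 0) {I : Finset (K × K × K)}
    (hI : Set.InjOn Prod.fst (I : Set (K × K × K))) (hv : ∀ l ∈ I, VanishesOnSlice F l) :
    #I ≤ F.totalDegree := by
  obtain ⟨R, hR, rfl⟩ := exists_rename_eq_of_degreeOf_eq_zero h
  refine (card_le_totalDegree_of_eval_eq_zero (by rintro rfl; simp at hF) hI fun l hl y => ?_).trans hR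
  rw [← eval_eq_zero_of_sliceLine (hv l hl) y, eval_rename_succ]

theorem card_le_of_not_dvd [Infinite K] {F Q : MvPolynomial (Fin 3) K} (hF : Irreducible F)
    (hQ : ¬ F ∣ Q) {n : ℕ} (hn : F.totalDegree ≤ n) (hQn : Q.totalDegree ≤ 3 * n)
    {I : Finset (K × K × K)} (hI : Set.InjOn Prod.fst (I : Set (K × K × K)))
    (hvF : ∀ l ∈ I, VanishesOnSlice F l) (hvQ : ∀ l ∈ I, VanishesOnSlice Q l) :
    #I ≤ 12 * n ^ 2 := by
  rcases Nat.eq_zero_or_pos (F.degreeOf 0) with h0 | h0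
  · have := card_le_of_degreeOf_eq_zero hF.ne_zero h0 hI hvF
    nlinarith
  obtain ⟨A, B, R, hR, hRn, hAB⟩ := exists_eliminant_s12 hF h0 hQ hn hQn (by omega)
  refine (card_le_totalDegree_of_eval_eq_zero hR hI fun l hl y => ?_).trans (hRn.trans (by nlinarith))
  rw [← eval_rename_succ (l.2.1 + l.2.2 * y), ← hAB, map_add, map_mul, map_mul,
    eval_eq_zero_of_sliceLine (hvF l hl), eval_eq_zero_of_sliceLine (hvQ l hl)]
  simp

/-- If every point of the surface `F = 0` is flexional in the `X`-slices, the tangent line to a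
slice at a smooth point is contained in the surface. -/
theorem aeval_tangent_eq_zero {p : ℕ} [CharP K p] {F : MvPolynomial (Fin 3) K}
    (hF : F ∣ asymptoticPoly F) (hp : F.totalDegree < p) {x α β y : K}
    (h0 : eval ![α + β * y, x, y] F = 0)
    (h1 : eval ![α + β * y, x, y] (pderiv 0 F) ≠ 0)
    (h2 : eval ![α + β * y, x, y] (pderiv 0 F) * β + eval ![α + β * y, x, y] (pderiv 2 F) = 0) :
    aeval (sliceLine x α β) F = 0 := by
  obtain ⟨G, hG⟩ := hF
  obtain ⟨h, hh⟩ := aeval_asymptoticPoly x α β F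
  rw [hG, map_mul] at hh
  have hd := derivative_aeval_sliceLine x α β F
  have hn := natDegree_aeval_sliceLine_le x α β F
  rw [← eval_aeval_sliceLine] at h0 h1 h2
  rw [← eval_aeval_sliceLine] at h2
  set ψ := aeval (sliceLine x α β) F
  set w := aeval (sliceLine x α β) (pderiv 0 F)
  set q := aeval (sliceLine x α β) G
  by_contra hψ
  have hψ' : (Polynomial.derivative ψ).eval y = 0 := by rw [hd]; simpa using h2
  obtain ⟨ω, hω, hωy⟩ := Polynomial.exists_eq_pow_rootMultiplicity_mul_and_not_dvd ψ hψ y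
  rw [Polynomial.dvd_iff_isRoot, Polynomial.IsRoot] at hωy
  have hm : 1 < ψ.rootMultiplicity y :=
    (Polynomial.one_lt_rootMultiplicity_iff_isRoot hψ).2 ⟨h0, hψ'⟩
  have hmn : ψ.rootMultiplicity y < p := by
    have := Polynomial.natDegree_le_of_dvd (Polynomial.pow_rootMultiplicity_dvd ψ y) hψ
    rw [Polynomial.natDegree_pow, Polynomial.natDegree_X_sub_C, mul_one] at this
    omega
  obtain ⟨r, hr⟩ := Nat.exists_eq_add_of_le' hm
  rw [hr] at hω hmn
  set T : Polynomial K := Polynomial.X - Polynomial.C y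
  have hT : Polynomial.derivative T = 1 := by simp [T]
  have hTy : T.eval y = 0 := by simp [T]
  have hD1 : Polynomial.derivative ψ =
      T ^ r * (T * (((r + 2 : ℕ) : Polynomial K) * ω + T * Polynomial.derivative ω)) := by
    rw [hω, Polynomial.derivative_mul, Polynomial.derivative_pow, hT]
    simp only [Nat.succ_eq_add_one, map_natCast, mul_one]
    push_cast
    ring
  have hD2 : Polynomial.derivative (Polynomial.derivative ψ) = T ^ r *
      (((r + 2 : ℕ) : Polynomial K) * ((r + 1 : ℕ) : Polynomial K) * ω +
        T * (((2 * r + 4 : ℕ) : Polynomial K) * Polynomial.derivative ω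
        + T * Polynomial.derivative (Polynomial.derivative ω))) := by
    have hr2 : Polynomial.derivative (T ^ (r + 1)) = ((r + 1 : ℕ) : Polynomial K) * T ^ r := by
      rw [Polynomial.derivative_pow, hT]
      simp only [Nat.add_sub_cancel, map_natCast, mul_one]
    rw [hD1, ← mul_assoc, ← pow_succ, Polynomial.derivative_mul, hr2]
    simp only [Polynomial.derivative_add, Polynomial.derivative_mul, Polynomial.derivative_natCast, hT]
    push_cast
    ring
  rw [hD2, hD1, hω] at hh
  have h3 : T ^ 2 * ω * q =
      w ^ 2 * (((r + 2 : ℕ) : Polynomial K) * ((r + 1 : ℕ) : Polynomial K) * ω +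
        T * (((2 * r + 4 : ℕ) : Polynomial K) * Polynomial.derivative ω
        + T * Polynomial.derivative (Polynomial.derivative ω)))
      + T * (((r + 2 : ℕ) : Polynomial K) * ω + T * Polynomial.derivative ω) * h := by
    refine mul_left_cancel₀ (pow_ne_zero r (Polynomial.X_sub_C_ne_zero y)) ?_
    linear_combination hh
  have h4 := congr(Polynomial.eval y $h3)
  have hc (c : ℕ) (hc0 : c ≠ 0) (hcp : c < p) : (c : K) ≠ 0 := by
    rw [Ne, CharP.cast_eq_zero_iff K p]
    exact fun hd => absurd (Nat.le_of_dvd (by omega) hd) (by omega)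
  simp only [Polynomial.eval_add, Polynomial.eval_mul, Polynomial.eval_pow, hTy,
    Polynomial.eval_natCast] at h4
  have h5 := hc (r + 2) (by omega) (by omega)
  have h6 := hc (r + 1) (by omega) (by omega)
  have : Polynomial.eval y w ^ 2 * ((r + 2 : ℕ) * (r + 1 : ℕ) * Polynomial.eval y ω) = 0 := by
    linear_combination -h4
  simp_all
  
end Lines

section Lines
variable {K : Type*} [Field K]

/-- A family of lines in distinct parallel planes, at most `k` of them on each quadric
`Z = a + bX + cY + dXY`. -/
def Spread [DecidableEq K] (k : ℕ) (I : Finset (K × K × K)) : Prop :=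
  Set.InjOn Prod.fst (I : Set (K × K × K)) ∧
    ∀ a b c d, #{l ∈ I | l.2.1 = a + b * l.1 ∧ l.2.2 = c + d * l.1} ≤ k

theorem Spread.mono [DecidableEq K] {k : ℕ} {I I' : Finset (K × K × K)} (h : Spread k I)
    (hI : I' ⊆ I) : Spread k I' :=
  ⟨h.1.mono (by simpa using hI), fun a b c d =>
    (card_le_card (filter_subset_filter _ hI)).trans (h.2 a b c d)⟩

theorem eval_aeval_single {σ : Type*} (f : σ → K) (i : σ) (u : Polynomial K) :
    eval f (Polynomial.aeval (X i : MvPolynomial σ K) u) = u.eval (f i) := by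
  induction u using Polynomial.induction_on' with
  | add p q hp hq => simp [hp, hq]
  | monomial n a => simp

/-- An irreducible surface containing the tangent lines in the `X`-slices at the points of the
line `m` contains, or is, a quadric `Z = B(X, Y)`. -/
theorem dvd_tangent_poly {p : ℕ} [CharP K p] [Infinite K] {F : MvPolynomial (Fin 3) K}
    (hF : Irreducible F) (hZ : 0 < F.degreeOf 0) (hd : F ∣ asymptoticPoly F)
    (hp : F.totalDegree < p) {m : K × K × K} (hm : VanishesOnCross F m)
    {u v : Polynomial K} (hu : aeval (crossLine m.1 m.2.1 m.2.2) (pderiv 0 F) = u)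
    (hv : aeval (crossLine m.1 m.2.1 m.2.2) (pderiv 2 F) = v) (hu0 : u ≠ 0) :
    F ∣ Polynomial.aeval (X 1) u * (X 0 - (C m.2.1 + C m.2.2 * X 1)) +
      Polynomial.aeval (X 1) v * (X 2 - C m.1) := by
  by_contra hdvd
  obtain ⟨A, B, R, hR, -, hAB⟩ := exists_eliminant_s12 hF hZ hdvd le_rfl
    (le_max_right F.totalDegree _) (le_max_left _ _)
  have hz : (Polynomial.aeval (X 0 : MvPolynomial (Fin 2) K) u) * R = 0 := by
    refine MvPolynomial.funext fun f => ?_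
    rw [map_mul, eval_aeval_single, map_zero]
    by_cases h0 : u.eval (f 0) = 0
    · rw [h0, zero_mul]
    set x := f 0
    set y := f 1
    have hf : f = ![x, y] := by ext i; fin_cases i <;> rfl
    set β := -(v.eval x) / u.eval x
    set α := m.2.1 + m.2.2 * x - β * m.1
    have hpt : α + β * m.1 = m.2.1 + m.2.2 * x := by simp [α]
    have hux : eval ![m.2.1 + m.2.2 * x, x, m.1] (pderiv 0 F) = u.eval x := by
      rw [← eval_aeval_crossLine, hu]
    have hvx : eval ![m.2.1 + m.2.2 * x, x, m.1] (pderiv 2 F) = v.eval x := by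
      rw [← eval_aeval_crossLine, hv]
    have ht : aeval (sliceLine x α β) F = 0 := by
      refine aeval_tangent_eq_zero hd hp (y := m.1) ?_ ?_ ?_
      · rw [hpt]; exact eval_eq_zero_of_crossLine hm x
      · rwa [hpt, hux]
      · rw [hpt, hux, hvx]; simp only [β]; field_simp; ring
    have hF0 := eval_eq_zero_of_sliceLine ht y
    rw [hf, ← eval_rename_succ (α + β * y), ← hAB, map_add, map_mul, hF0, map_mul]
    simp only [map_add, map_mul, map_sub, eval_aeval_single, eval_X, eval_C]
    simp only [Matrix.cons_val]
    have : u.eval x * β = - v.eval x := by simp only [β]; field_simp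
    simp only [α]
    linear_combination
      (u.eval x) * eval ![m.2.1 + m.2.2 * x - β * m.1 + β * y, x, y] B * (y - m.1) * this
  refine (mul_eq_zero.1 hz).elim (fun h => hu0 ?_) hR
  refine Polynomial.funext fun t => ?_
  rw [← eval_aeval_single (fun _ : Fin 2 => t) 0 u, h]
  simp

/-- If an irreducible surface contains the tangent lines in the `X`-slices at the points of one
of its `Y`-slice lines `m`, and one such tangent line at every point meets another line `m'`,
then the surface contains, or is, a quadric `Z = B(X, Y)`. -/
theorem exists_quadric_dvd {F : MvPolynomial (Fin 3) K} [Infinite K]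
    (hF : Irreducible F) (hZ : 0 < F.degreeOf 0) {m m' : K × K × K} (hm' : VanishesOnCross F m')
    (hmm : m.1 ≠ m'.1) {u v : Polynomial K} (hu0 : u ≠ 0)
    (hd : F ∣ Polynomial.aeval (X 1) u * (X 0 - (C m.2.1 + C m.2.2 * X 1)) +
      Polynomial.aeval (X 1) v * (X 2 - C m.1)) :
    ∃ a b c d : K, F ∣ X 0 - (C a + C b * X 1 + C c * X 2 + C d * X 1 * X 2) := by
  obtain ⟨W, hW⟩ := hd
  have hsub : m'.1 - m.1 ≠ 0 := sub_ne_zero.2 hmm.symm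
  set s := (m'.1 - m.1)⁻¹
  set c := s * (m'.2.1 - m.2.1)
  set d := s * (m'.2.2 - m.2.2)
  have hv : v = - u * (Polynomial.C c + Polynomial.C d * Polynomial.X) := by
    refine Polynomial.funext fun t => ?_
    have h1 := congr(eval ![m'.2.1 + m'.2.2 * t, t, m'.1] $hW)
    rw [map_mul _ F, eval_eq_zero_of_crossLine hm'] at h1
    simp only [map_add, map_mul, map_sub, eval_aeval_single, eval_X, eval_C] at h1
    simp only [Matrix.cons_val] at h1
    simp only [Polynomial.eval_mul, Polynomial.eval_neg, Polynomial.eval_add, Polynomial.eval_C,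
      Polynomial.eval_X, c, d, s]
    field_simp
    linear_combination h1
  refine ⟨m.2.1 - c * m.1, m.2.2 - d * m.1, c, d, ?_⟩
  have hfac : F ∣ Polynomial.aeval (X 1) u * (X 0 - (C (m.2.1 - c * m.1) +
      C (m.2.2 - d * m.1) * X 1 + C c * X 2 + C d * X 1 * X 2)) := by
    refine ⟨W, ?_⟩
    rw [← hW, hv]
    simp only [map_mul, map_neg, map_add, map_sub, Polynomial.aeval_C, Polynomial.aeval_X,
      algebraMap_eq]
    ring
  refine (hF.prime.dvd_or_dvd hfac).resolve_left fun h => hZ.ne' ?_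
  have h2 : rename Fin.succ (Polynomial.aeval (X 0 : MvPolynomial (Fin 2) K) u)
      = Polynomial.aeval (X 1 : MvPolynomial (Fin 3) K) u := by
    rw [← Polynomial.aeval_algHom_apply, rename_X]
    rfl
  rw [← h2] at h
  refine degreeOf_eq_zero_of_dvd_rename (fun h0 => hu0 ?_) h
  refine Polynomial.funext fun t => ?_
  rw [← eval_aeval_single (fun _ : Fin 2 => t) 0 u, h0]
  simp

theorem card_le_of_quadric_dvd [DecidableEq K] [Infinite K] {k : ℕ} {J : Finset (K × K × K)}
    (hJ : Spread k J) {F : MvPolynomial (Fin 3) K} (hv : ∀ m ∈ J, VanishesOnCross F m)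
    {a b c d : K} (hd : F ∣ X 0 - (C a + C b * X 1 + C c * X 2 + C d * X 1 * X 2)) : #J ≤ k := by
  refine le_trans (card_le_card fun m hm => mem_filter.2 ⟨hm, ?_⟩) (hJ.2 a c b d)
  obtain ⟨W, hW⟩ := hd
  have h (t : K) : m.2.1 + m.2.2 * t = a + b * t + c * m.1 + d * t * m.1 := by
    have h1 := congr(eval ![m.2.1 + m.2.2 * t, t, m.1] $hW)
    rw [map_mul _ F, eval_eq_zero_of_crossLine (hv m hm)] at h1
    simp only [map_add, map_mul, map_sub, eval_X, eval_C] at h1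
    simp only [Matrix.cons_val] at h1
    linear_combination h1
  have h0 := h 0
  have h1 := h 1
  constructor
  · linear_combination h0
  · linear_combination h1 - h0

theorem exists_bad_of_irreducible [DecidableEq K] [Infinite K] {p : ℕ} [CharP K p] {k : ℕ}
    (hk : 1 ≤ k) {F : MvPolynomial (Fin 3) K} (hF : Irreducible F) (hp : F.totalDegree < p)
    {I J : Finset (K × K × K)} (hI : Set.InjOn Prod.fst (I : Set (K × K × K))) (hJ : Spread k J)
    (hvI : ∀ l ∈ I, VanishesOnSlice F l) (hvJ : ∀ m ∈ J, VanishesOnCross F m) :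
    ∃ S ⊆ I, #S ≤ 12 * F.totalDegree ^ 2 ∧
      ∀ l ∈ I \ S, #{m ∈ J | Meets l m} ≤ F.totalDegree + k := by
  classical
  by_cases hsmall : #I ≤ 12 * F.totalDegree ^ 2
  · exact ⟨I, Subset.rfl, hsmall, by simp⟩
  have hZ : 0 < F.degreeOf 0 := by
    refine Nat.pos_of_ne_zero fun h => hsmall ?_
    refine (card_le_of_degreeOf_eq_zero hF.ne_zero h hI hvI).trans ?_
    nlinarith
  have hFZ : pderiv 0 F ≠ 0 := pderiv_ne_zero hZ.ne' hp
  have hndvd : ¬ F ∣ pderiv 0 F := fun h => by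
    have h1 := totalDegree_le_of_dvd_of_isDomain h hFZ
    have h2 := totalDegree_pderiv_le_sub_one_s12 0 F
    have h3 := degreeOf_le_totalDegree F 0
    omega
  have hdvd : F ∣ asymptoticPoly F := by
    by_contra h
    exact hsmall (card_le_of_not_dvd hF h le_rfl (totalDegree_asymptoticPoly_le F) hI hvI
      fun l hl => aeval_asymptoticPoly_eq_zero (hvI l hl))
  refine ⟨{l ∈ I | VanishesOnSlice (pderiv 0 F) l}, filter_subset _ _, ?_, fun l hl => ?_⟩
  · refine card_le_of_not_dvd hF hndvd le_rfl ?_ (hI.mono fun l hl => (mem_filter.1 (mem_coe.1 hl)).1)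
      (fun l hl => hvI l (mem_filter.1 hl).1) fun l hl => (mem_filter.1 hl).2
    exact (totalDegree_pderiv_le_s12 0 F).trans (by omega)
  simp only [mem_sdiff, mem_filter, not_and] at hl
  have hnv := hl.2 hl.1
  rw [← card_filter_add_card_filter_not
    fun m : K × K × K => eval ![l.2.1 + l.2.2 * m.1, l.1, m.1] (pderiv 0 F) = 0]
  gcongr
  · refine (card_le_of_injOn_roots hnv _ (hJ.1.mono ?_) fun m hm => ?_).trans
      ((natDegree_aeval_sliceLine_le _ _ _ _).trans (totalDegree_pderiv_le_s12 0 F))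
    · intro m hm; simp_all
    · rw [eval_aeval_sliceLine]; simp_all
  · set M := {m ∈ {m ∈ J | Meets l m} | ¬ eval ![l.2.1 + l.2.2 * m.1, l.1, m.1] (pderiv 0 F) = 0}
    by_cases hM : #M ≤ 1
    · omega
    obtain ⟨m, hm, m', hm', hne⟩ := one_lt_card.1 (not_le.1 hM)
    simp only [M, mem_filter] at hm hm'
    have hu0 : aeval (crossLine m.1 m.2.1 m.2.2) (pderiv 0 F) ≠ 0 := fun h0 => hm.2 (by
      rw [show l.2.1 + l.2.2 * m.1 = m.2.1 + m.2.2 * l.1 from hm.1.2]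
      exact eval_eq_zero_of_crossLine h0 l.1)
    obtain ⟨a, b, c, d, h⟩ := exists_quadric_dvd hF hZ (hvJ m' hm'.1.1)
      (fun h => hne (hJ.1 hm.1.1 hm'.1.1 h)) hu0
      (dvd_tangent_poly hF hZ hdvd hp (hvJ m hm.1.1) rfl rfl hu0)
    exact (card_le_card ((filter_subset _ _).trans (filter_subset _ _))).trans
      (card_le_of_quadric_dvd hJ hvJ h)

end Lines

section Lines
variable {K : Type*} [Field K] [DecidableEq K]

/-- The number of intersecting pairs of lines. -/
def meetCount (I J : Finset (K × K × K)) : ℕ := ∑ l ∈ I, #{m ∈ J | Meets l m}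

theorem meetCount_comm (I J : Finset (K × K × K)) : meetCount I J = meetCount J I := by
  simp only [meetCount]
  refine (sum_card_bipartiteAbove_eq_sum_card_bipartiteBelow Meets).trans ?_
  refine sum_congr rfl fun m _ => congrArg card (filter_congr fun l _ => ?_)
  exact ⟨Meets.symm, Meets.symm⟩

theorem meetCount_mono_left {I I' : Finset (K × K × K)} (h : I ⊆ I') (J : Finset (K × K × K)) :
    meetCount I J ≤ meetCount I' J :=
  sum_le_sum_of_subset h

theorem meetCount_sdiff_add {I S : Finset (K × K × K)} (h : S ⊆ I) (J : Finset (K × K × K)) :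
    meetCount (I \ S) J + meetCount S J = meetCount I J :=
  sum_sdiff h

theorem meetCount_union_le (I S J : Finset (K × K × K)) :
    meetCount (I ∪ S) J ≤ meetCount I J + meetCount S J := by
  have := meetCount_sdiff_add (subset_union_right : S ⊆ I ∪ S) J
  have := meetCount_mono_left (J := J) (show (I ∪ S) \ S ⊆ I by simp [union_sdiff_right, sdiff_subset])
  omega

theorem meetCount_le_card_mul_left {I J : Finset (K × K × K)} {d : ℕ}
    (h : ∀ l ∈ I, #{m ∈ J | Meets l m} ≤ d) : meetCount I J ≤ d * #I := by
  simpa [meetCount, mul_comm] using sum_le_card_nsmul I _ d h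

theorem meetCount_le_of_cross {π : MvPolynomial (Fin 3) K} {I J : Finset (K × K × K)}
    (hI : Set.InjOn Prod.fst (I : Set (K × K × K))) (hvI : ∀ l ∈ I, VanishesOnSlice π l)
    (hJ : ∀ m ∈ J, ¬ VanishesOnCross π m) : meetCount I J ≤ π.totalDegree * #J := by
  rw [meetCount_comm]
  refine meetCount_le_card_mul_left fun m hm => ?_
  refine (card_le_of_injOn_roots (hJ m hm) _ (hI.mono ?_) fun l hl => ?_).trans
    (natDegree_aeval_crossLine_le _ _ _ _)
  · intro l hl; simp_all
  · simp only [mem_filter] at hl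
    rw [eval_aeval_crossLine, show m.2.1 + m.2.2 * l.1 = l.2.1 + l.2.2 * m.1 from hl.2]
    exact eval_eq_zero_of_sliceLine (hvI l hl.1) _

theorem exists_bad_of_vanish [Infinite K] {p : ℕ} [CharP K p] {k : ℕ} (hk : 1 ≤ k)
    {J : Finset (K × K × K)} (hJ : Spread k J) (F : MvPolynomial (Fin 3) K) :
    F ≠ 0 → F.totalDegree < p → ∀ I : Finset (K × K × K),
      Set.InjOn Prod.fst (I : Set (K × K × K)) → (∀ l ∈ I, VanishesOnSlice F l) →
      ∃ S ⊆ I, #S ≤ 12 * F.totalDegree ^ 2 ∧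
        meetCount (I \ S) J ≤ (F.totalDegree + k) * #I + F.totalDegree * #J := by
  classical
  induction F using UniqueFactorizationMonoid.induction_on_prime with
  | h₁ => simp
  | h₂ F hF =>
    intro _ _ I _ hv
    refine ⟨∅, by simp, by simp, ?_⟩
    have : I = ∅ := by
      refine eq_empty_of_forall_notMem fun l hl => ?_
      exact not_isUnit_zero (hv l hl ▸ hF.map (aeval (sliceLine l.1 l.2.1 l.2.2)))
    simp [this, meetCount]
  | h₃ G π hG hπ ih =>
    intro _ hp I hI hv
    have hdeg := totalDegree_mul_of_isDomain hπ.ne_zero hG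
    rw [hdeg] at hp
    set I₁ := {l ∈ I | VanishesOnSlice π l} with hI₁
    set J₁ := {m ∈ J | VanishesOnCross π m} with hJ₁
    have hI₁I : I₁ ⊆ I := filter_subset _ _
    have hJ₁J : J₁ ⊆ J := filter_subset _ _
    have hv₁ : ∀ l ∈ I₁, VanishesOnSlice π l := fun l hl => (mem_filter.1 hl).2
    obtain ⟨S₁, hS₁, hc₁, hd₁⟩ := exists_bad_of_irreducible hk hπ.irreducible
      (by omega : π.totalDegree < p) (hI.mono (coe_subset.2 hI₁I)) (hJ.mono hJ₁J) hv₁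
      fun m hm => (mem_filter.1 hm).2
    obtain ⟨S₂, hS₂, hc₂, hd₂⟩ := ih hG (by omega) (I \ I₁) (hI.mono (coe_subset.2 sdiff_subset))
      fun l hl => by
        simp only [hI₁, mem_sdiff, mem_filter, not_and] at hl
        have h := hv l hl.1
        simp only [VanishesOnSlice, map_mul, mul_eq_zero] at h hl
        exact h.resolve_left (hl.2 hl.1)
    refine ⟨S₁ ∪ S₂, union_subset (hS₁.trans hI₁I) (hS₂.trans sdiff_subset), ?_, ?_⟩
    · rw [hdeg]
      refine (card_union_le _ _).trans ?_
      nlinarith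
    have h1 : meetCount (I \ (S₁ ∪ S₂)) J ≤
        meetCount (I₁ \ S₁) J + meetCount ((I \ I₁) \ S₂) J := by
      refine (meetCount_mono_left (fun l hl => ?_) J).trans (meetCount_union_le _ _ J)
      simp only [mem_union, mem_sdiff] at hl ⊢
      tauto
    have h2 : meetCount (I₁ \ S₁) J ≤ (π.totalDegree + k) * #I₁ + π.totalDegree * #J := by
      rw [meetCount_comm, ← meetCount_sdiff_add hJ₁J, add_comm, meetCount_comm J₁, meetCount_comm (J \ J₁)]
      refine add_le_add ((meetCount_le_card_mul_left hd₁).trans ?_) ?_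
      · gcongr; exact sdiff_subset
      · refine (meetCount_le_of_cross (π := π) (hI.mono (coe_subset.2 (sdiff_subset.trans hI₁I)))
          (fun l hl => hv₁ l (mem_sdiff.1 hl).1) fun m hm => ?_).trans ?_
        · simp only [hJ₁, mem_sdiff, mem_filter, not_and] at hm
          exact hm.2 hm.1
        · gcongr; exact sdiff_subset
    have h3 := card_sdiff_add_card_eq_card hI₁I
    rw [hdeg]
    nlinarith

end Lines

section Greedy
variable {ι κ : Type*} [DecidableEq κ] (r : ι → κ → Prop) [∀ i j, Decidable (r i j)]

/-- Weight of a vertex with `t` chosen neighbours when more than `n` are required. -/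
noncomputable def deficit (n t : ℕ) : ℝ := if t ≤ n then (1 / 2) ^ t else 0

theorem deficit_nonneg (n t : ℕ) : 0 ≤ deficit n t := by
  unfold deficit; positivity

theorem deficit_succ_le (n t : ℕ) : deficit n (t + 1) ≤ deficit n t / 2 := by
  unfold deficit
  split_ifs with h1 h2
  · rw [pow_succ]; linarith
  · omega
  · positivity
  · simp

theorem exists_insert_deficit_le {I : Finset ι} {J J' : Finset κ} {n D N : ℕ} (hnD : n < D)
    (hN : #J ≤ N) (hdeg : ∀ i ∈ I, D ≤ #{j ∈ J | r i j}) (hJ' : J' ⊆ J) :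
    ∃ J'' ⊆ J, #J'' ≤ #J' + 1 ∧ ∑ i ∈ I, deficit n #{j ∈ J'' | r i j} ≤
      Real.exp (-(((D : ℝ) - n) / (2 * N))) * ∑ i ∈ I, deficit n #{j ∈ J' | r i j} := by
  set Φ : Finset κ → ℝ := fun T => ∑ i ∈ I, deficit n #{j ∈ T | r i j} with hΦ
  have hΦ0 (T) : 0 ≤ Φ T := sum_nonneg fun i _ => deficit_nonneg _ _
  set θ : ℝ := ((D : ℝ) - n) / (2 * N)
  have hDn : (0 : ℝ) < D - n := by rw [sub_pos]; exact_mod_cast hnD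
  change ∃ J'' ⊆ J, #J'' ≤ #J' + 1 ∧ Φ J'' ≤ Real.exp (-θ) * Φ J'
  rcases (hΦ0 J').eq_or_lt with h0 | hpos
  · exact ⟨J', hJ', by omega, by rw [← h0]; simp⟩
  have hgain : ((D : ℝ) - n) / 2 * Φ J' ≤ ∑ j ∈ J \ J', (Φ J' - Φ (insert j J')) := by
    simp only [hΦ, ← sum_sub_distrib, mul_sum]
    rw [sum_comm]
    refine sum_le_sum fun i hi => ?_
    set t := #{j ∈ J' | r i j}
    have h1 : ∀ j ∈ J \ J', (if r i j then deficit n t / 2 else 0) ≤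
        deficit n t - deficit n #{j ∈ insert j J' | r i j} := by
      intro j hj
      rw [filter_insert]
      split_ifs with h
      · rw [card_insert_of_notMem (by simp [(mem_sdiff.1 hj).2])]
        have := deficit_succ_le n t
        change _ ≤ _ - deficit n (t + 1)
        linarith
      · simp [t]
    refine le_trans ?_ (sum_le_sum h1)
    rw [← sum_filter, sum_const, nsmul_eq_mul]
    by_cases ht : t ≤ n
    · have h2 : D ≤ #{j ∈ J \ J' | r i j} + t := by
        refine (hdeg i hi).trans ?_
        rw [← card_union_of_disjoint]
        · refine card_le_card fun j hj => ?_
          simp only [mem_union, mem_filter, mem_sdiff] at hj ⊢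
          tauto
        · exact (disjoint_filter_filter (disjoint_sdiff_self_left))
      have h3 : (D : ℝ) - n ≤ #{j ∈ J \ J' | r i j} := by
        rw [sub_le_iff_le_add]; exact_mod_cast h2.trans (by omega)
      have := deficit_nonneg n t
      nlinarith
    · simp [deficit, ht]
  have hne : (J \ J').Nonempty := by
    by_contra h
    rw [not_nonempty_iff_eq_empty.1 h, sum_empty] at hgain
    have := mul_pos (half_pos hDn) hpos
    linarith
  have hNpos : (0 : ℝ) < N := by
    have := (hne.mono sdiff_subset).card_pos
    exact_mod_cast (by omega : 0 < N)
  have hθ : 0 ≤ θ := by positivity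
  obtain ⟨j, hj, hjle⟩ := exists_le_of_sum_le (f := fun _ => θ * Φ J') hne (by
    refine le_trans ?_ hgain
    rw [sum_const, nsmul_eq_mul]
    have h4 : (#(J \ J') : ℝ) ≤ N := by exact_mod_cast (card_le_card sdiff_subset).trans hN
    calc (#(J \ J') : ℝ) * (θ * Φ J') ≤ N * (θ * Φ J') := by gcongr
      _ = _ := by simp only [θ]; field_simp)
  refine ⟨insert j J', insert_subset (mem_sdiff.1 hj).1 hJ', card_insert_le _ _, ?_⟩
  have h5 : Φ (insert j J') ≤ (1 - θ) * Φ J' := by linarith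
  refine h5.trans ?_
  gcongr
  exact Real.one_sub_le_exp_neg θ

theorem exists_subset_forall_lt_card {I : Finset ι} {J : Finset κ} {n D N : ℕ} (hnD : n < D)
    (hN : #J ≤ N) (hdeg : ∀ i ∈ I, D ≤ #{j ∈ J | r i j}) (s : ℕ)
    (hs : #I * Real.exp (-(((D : ℝ) - n) / (2 * N) * s)) < (1 / 2) ^ n) :
    ∃ J' ⊆ J, #J' ≤ s ∧ ∀ i ∈ I, n < #{j ∈ J' | r i j} := by
  obtain ⟨J', hJ', hc, hΦ⟩ : ∃ J' ⊆ J, #J' ≤ s ∧ ∑ i ∈ I, deficit n #{j ∈ J' | r i j} ≤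
      #I * Real.exp (-(((D : ℝ) - n) / (2 * N) * s)) := by
    clear hs
    induction s with
    | zero => exact ⟨∅, by simp, by simp, by simp [deficit]⟩
    | succ s ih =>
      obtain ⟨J', hJ', hc, hΦ⟩ := ih
      obtain ⟨J'', hJ'', hc'', hΦ''⟩ := exists_insert_deficit_le r hnD hN hdeg hJ'
      refine ⟨J'', hJ'', by omega, hΦ''.trans ?_⟩
      calc _ ≤ Real.exp (-(((D : ℝ) - n) / (2 * N))) *
            (#I * Real.exp (-(((D : ℝ) - n) / (2 * N) * s))) := by gcongr
        _ = _ := by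
          rw [mul_left_comm, ← Real.exp_add]
          push_cast
          ring_nf
  refine ⟨J', hJ', hc, fun i hi => ?_⟩
  by_contra! h
  have h1 := single_le_sum (f := fun i => deficit n #{j ∈ J' | r i j})
    (fun i _ => deficit_nonneg _ _) hi
  have h2 : ((1 : ℝ) / 2) ^ n ≤ deficit n #{j ∈ J' | r i j} := by
    rw [deficit, if_pos h]
    exact pow_le_pow_of_le_one (by norm_num) (by norm_num) h
  linarith

end Greedy

section Lines
variable {K : Type*} [Field K]

theorem exists_vanishesOnCross (m : ℕ) {J : Finset (K × K × K)}
    (hJ : #J ≤ 3 * m ^ 2) :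
    ∃ F : MvPolynomial (Fin 3) K, F ≠ 0 ∧ F.totalDegree ≤ 9 * m ∧ ∀ l ∈ J, VanishesOnCross F l := by
  classical
  let e : (Fin 3 → Fin (3 * m + 1)) → (Fin 3 →₀ ℕ) := fun g =>
    Finsupp.equivFunOnFinite.symm fun i => (g i : ℕ)
  have he : Function.Injective e := fun g g' h => by
    ext i
    exact congr($h i)
  let Φ : ((Fin 3 → Fin (3 * m + 1)) → K) →ₗ[K] MvPolynomial (Fin 3) K :=
    ∑ g, (monomial (e g)).comp (LinearMap.proj g)
  have hΦ (c) : Φ c = ∑ g, monomial (e g) (c g) := by simp [Φ]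
  let Ψ : ((Fin 3 → Fin (3 * m + 1)) → K) →ₗ[K] (J → Fin (9 * m + 1) → K) :=
    LinearMap.pi fun l => LinearMap.pi fun i => (Polynomial.lcoeff K i).comp
      ((aeval (crossLine l.1.1 l.1.2.1 l.1.2.2)).toLinearMap.comp Φ)
  obtain ⟨c, hc, hc0⟩ := (Submodule.ne_bot_iff _).1
    (LinearMap.ker_ne_bot_of_finrank_lt (f := Ψ) (by
      simp only [Module.finrank_pi_fintype, Module.finrank_self, sum_const, card_univ,
        Fintype.card_fin, Fintype.card_coe, Fintype.card_fun, smul_eq_mul, mul_one]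
      nlinarith [Nat.mul_le_mul_right (9 * m + 1) hJ]))
  have hdeg : (Φ c).totalDegree ≤ 9 * m := by
    rw [hΦ]
    refine totalDegree_finsetSum_le fun g _ => (totalDegree_monomial_le _ _).trans ?_
    rw [Finsupp.sum_fintype _ _ (fun _ => rfl), Fin.sum_univ_three]
    simp only [e, Finsupp.equivFunOnFinite_symm_apply_apply, id_eq]
    have := (g 0).2
    have := (g 1).2
    have := (g 2).2
    omega
  refine ⟨Φ c, fun h0 => hc0 ?_, hdeg, fun l hl => ?_⟩
  · ext g
    have h1 := congr(coeff (e g) $h0)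
    rw [hΦ, coeff_sum] at h1
    simpa [coeff_monomial, he.eq_iff] using h1
  · refine Polynomial.ext fun i => ?_
    rcases lt_or_ge i (9 * m + 1) with hi | hi
    · exact congr($(LinearMap.mem_ker.1 hc) ⟨l, hl⟩ ⟨i, hi⟩)
    · exact Polynomial.coeff_eq_zero_of_natDegree_lt
        (((natDegree_aeval_crossLine_le _ _ _ _).trans hdeg).trans_lt (by omega))

end Lines

section Lines
variable {K : Type*} [Field K] [DecidableEq K] [Infinite K] {p : ℕ} [CharP K p]

theorem exp_aux {Γ m c : ℕ} (hΓ : 1 ≤ Γ) (hm : 1 ≤ m) (hc : c ≤ Γ * m ^ 2) :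
    (c : ℝ) * Real.exp (-((((9 + Γ * (11 + Γ)) * m : ℕ) - (9 * m : ℕ) : ℝ) /
      (2 * (Γ * m ^ 2 : ℕ)) * (3 * m ^ 2 : ℕ))) < (1 / 2) ^ (9 * m) := by
  have hΓ' : (0 : ℝ) < Γ := by exact_mod_cast hΓ
  have hm' : (0 : ℝ) < m := by exact_mod_cast hm
  have h1 : ((((9 + Γ * (11 + Γ)) * m : ℕ) - (9 * m : ℕ) : ℝ) /
      (2 * (Γ * m ^ 2 : ℕ)) * (3 * m ^ 2 : ℕ)) = ((11 + Γ) * m : ℕ) * (3 / 2) := by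
    push_cast
    field_simp
    ring
  have h2 : Real.exp (-(((11 + Γ) * m : ℕ) * (3 / 2))) ≤ (1 / 2) ^ ((11 + Γ) * m) := by
    rw [← mul_neg, Real.exp_nat_mul]
    gcongr
    rw [Real.exp_neg, one_div]
    gcongr
    linarith [Real.add_one_le_exp (3 / 2)]
  rw [h1]
  refine (mul_le_mul_of_nonneg_left h2 (Nat.cast_nonneg c)).trans_lt ?_
  have h3 : (11 + Γ) * m = 9 * m + (2 * m + Γ * m) := by ring
  have h4 : c < 2 ^ (2 * m + Γ * m) := by
    refine hc.trans_lt ?_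
    rw [pow_add, mul_comm, mul_comm 2 m, pow_mul]
    have h5 : m < 2 ^ m := Nat.lt_two_pow_self
    have h6 : Γ ≤ 2 ^ (Γ * m) := (Nat.le_mul_of_pos_right Γ hm).trans Nat.lt_two_pow_self.le
    have h7 : m ^ 2 < (2 ^ m) ^ 2 := Nat.pow_lt_pow_left h5 two_ne_zero
    exact Nat.mul_lt_mul_of_lt_of_le h7 h6 (by omega)
  rw [h3, pow_add, mul_left_comm]
  refine mul_lt_of_lt_one_right (by positivity) ?_
  rw [one_div, inv_pow, mul_inv_lt_iff₀ (by positivity), one_mul]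
  exact_mod_cast h4

theorem exists_bad_of_card_le {k Γ m : ℕ} (hk : 1 ≤ k) (hΓ : 1 ≤ Γ) (hm : 1 ≤ m) (hp : 9 * m < p)
    {I J : Finset (K × K × K)} (hI : Spread k I) (hJ : Spread k J)
    (hIc : #I ≤ Γ * m ^ 2) (hJc : #J ≤ Γ * m ^ 2) :
    ∃ S ⊆ I, #S ≤ 972 * m ^ 2 ∧
      meetCount (I \ S) J ≤ ((27 + Γ * (11 + Γ)) * m + k) * (Γ * m ^ 2) := by
  set D := (9 + Γ * (11 + Γ)) * m with hD
  set I' := {l ∈ I | D ≤ #{j ∈ J | Meets l j}} with hI'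
  have hI'I : I' ⊆ I := filter_subset _ _
  obtain ⟨J', hJ'J, hJ'c, hJ'⟩ := exists_subset_forall_lt_card Meets (I := I') (J := J)
    (n := 9 * m) (D := D) (N := Γ * m ^ 2) (by rw [hD]; gcongr; nlinarith) hJc
    (fun l hl => (mem_filter.1 hl).2) (3 * m ^ 2)
    (exp_aux hΓ hm ((card_le_card hI'I).trans hIc))
  obtain ⟨F, hF0, hFd, hF⟩ := exists_vanishesOnCross m hJ'c
  have hv : ∀ l ∈ I', VanishesOnSlice F l := by
    intro l hl
    by_contra h
    have h1 := card_le_of_injOn_roots h {j ∈ J' | Meets l j} (hJ.1.mono (by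
      intro j hj; exact hJ'J (mem_filter.1 (mem_coe.1 hj)).1)) fun j hj => by
        obtain ⟨hj1, hj2⟩ := mem_filter.1 hj
        rw [eval_aeval_sliceLine, show l.2.1 + l.2.2 * j.1 = j.2.1 + j.2.2 * l.1 from hj2]
        exact eval_eq_zero_of_crossLine (hF j hj1) _
    have h2 := natDegree_aeval_sliceLine_le l.1 l.2.1 l.2.2 F
    have h3 := hJ' l hl
    omega
  obtain ⟨S, hS, hSc, hSd⟩ := exists_bad_of_vanish hk hJ F hF0 (by omega : _ < p) I'
    (hI.1.mono (coe_subset.2 hI'I)) hv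
  refine ⟨S, hS.trans hI'I, hSc.trans ?_, ?_⟩
  · nlinarith
  have h1 : meetCount (I \ S) J ≤ meetCount (I \ I') J + meetCount (I' \ S) J := by
    refine (meetCount_mono_left (fun l hl => ?_) J).trans (meetCount_union_le _ _ J)
    simp only [mem_union, mem_sdiff] at hl ⊢
    tauto
  have h2 : meetCount (I \ I') J ≤ D * (Γ * m ^ 2) := by
    refine (meetCount_le_card_mul_left (d := D) fun l hl => ?_).trans ?_
    · simp only [hI', mem_sdiff, mem_filter, not_and, not_le] at hl
      exact (hl.2 hl.1).le
    · gcongr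
      exact (card_le_card sdiff_subset).trans hIc
  have h3 : (F.totalDegree + k) * #I' + F.totalDegree * #J ≤
      (9 * m + k) * (Γ * m ^ 2) + 9 * m * (Γ * m ^ 2) := by
    gcongr
    exact (card_le_card hI'I).trans hIc
  calc _ ≤ _ := h1.trans (add_le_add h2 (hSd.trans h3))
    _ = _ := by rw [hD]; ring

theorem meetCount_le_pow {k t : ℕ} (hk : 1 ≤ k) (hp : 9 * 2 ^ t < p)
    {I J : Finset (K × K × K)} (hI : Spread k I) (hJ : Spread k J)
    (hIc : #I ≤ 3888 * 4 ^ t) (hJc : #J ≤ 3888 * 4 ^ t) :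
    meetCount I J ≤ 16 * (27 + 3888 * (11 + 3888)) * 3888 * (8 ^ t + k * 4 ^ t) := by
  induction t generalizing I J with
  | zero =>
    have h1 : meetCount I J ≤ #J * #I := meetCount_le_card_mul_left fun l _ =>
      card_le_card (filter_subset _ _)
    nlinarith
  | succ t ih =>
    have h4 : (2 ^ (t + 1)) ^ 2 = 4 * 4 ^ t := by
      rw [← pow_mul, mul_comm (t + 1), pow_mul, pow_succ]; ring
    have hm : 1 ≤ 2 ^ (t + 1) := Nat.one_le_two_pow
    have hbound : 3888 * 4 ^ (t + 1) = 3888 * (2 ^ (t + 1)) ^ 2 := by rw [h4]; ring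
    rw [hbound] at hIc hJc
    obtain ⟨S, hS, hSc, hSm⟩ := exists_bad_of_card_le hk (by norm_num) hm hp hI hJ hIc hJc
    obtain ⟨S', hS', hSc', hSm'⟩ := exists_bad_of_card_le hk (by norm_num) hm hp hJ (hI.mono hS) hJc
      ((card_le_card hS).trans hIc)
    rw [h4] at hSc hSc'
    have h1 := ih (lt_of_le_of_lt (by gcongr <;> omega) hp) (hI.mono hS) (hJ.mono hS')
      (by omega) (by omega)
    have h2 := meetCount_sdiff_add hS J
    have h3 := meetCount_sdiff_add hS' S
    rw [meetCount_comm J S, meetCount_comm S' S] at h3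
    have h8 : 2 ^ (t + 1) * (2 ^ (t + 1)) ^ 2 = 8 * 8 ^ t := by
      rw [← pow_succ', ← pow_mul, mul_comm (t + 1), pow_mul, pow_succ]; ring
    have h5 : ((27 + 3888 * (11 + 3888)) * 2 ^ (t + 1) + k) * (3888 * (2 ^ (t + 1)) ^ 2) =
        (27 + 3888 * (11 + 3888)) * 3888 * (8 * 8 ^ t) + 3888 * k * (4 * 4 ^ t) := by
      rw [← h8, ← h4]; ring
    rw [h5] at hSm hSm'
    rw [pow_succ, pow_succ]
    have : 0 ≤ k * 4 ^ t := Nat.zero_le _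
    nlinarith

/-- The constant in `meetCount_le`. -/
def meetConst : ℕ := 128 * (27 + 3888 * (11 + 3888)) * 3888

theorem meetCount_le {k N : ℕ} (hk : 1 ≤ k) (hN : 1 ≤ N) (hp : 324 * N < p ^ 2)
    {I J : Finset (K × K × K)} (hI : Spread k I) (hJ : Spread k J) (hIc : #I ≤ N) (hJc : #J ≤ N) :
    (meetCount I J : ℝ) ≤ meetConst * (N * √N + k * N) := by
  have hex : ∃ t, N ≤ 3888 * 4 ^ t :=
    ⟨N, (Nat.lt_pow_self (by norm_num : 1 < 4)).le.trans (Nat.le_mul_of_pos_left _ (by norm_num))⟩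
  obtain ⟨t, ht, hmin⟩ : ∃ t, N ≤ 3888 * 4 ^ t ∧ ∀ s < t, ¬ N ≤ 3888 * 4 ^ s :=
    ⟨Nat.find hex, Nat.find_spec hex, fun s => Nat.find_min hex⟩
  have ht4 : 4 ^ t ≤ 4 * N := by
    rcases Nat.eq_zero_or_pos t with h0 | h0
    · rw [h0]; omega
    · have h1 := hmin _ (Nat.sub_one_lt h0.ne')
      have h2 : 4 ^ t = 4 * 4 ^ (t - 1) := by rw [← pow_succ', Nat.sub_add_cancel h0]
      omega
  have h22 : (2 ^ t) ^ 2 = 4 ^ t := by rw [← pow_mul, mul_comm, pow_mul]; norm_num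
  have ht9 : 9 * 2 ^ t < p := lt_of_pow_lt_pow_left₀ 2 (Nat.zero_le _) (by nlinarith)
  have h := meetCount_le_pow hk ht9 hI hJ (hIc.trans ht) (hJc.trans ht)
  have hs : (2 : ℝ) ^ t ≤ 2 * √N := by
    refine le_of_sq_le_sq ?_ (by positivity)
    rw [mul_pow, Real.sq_sqrt (Nat.cast_nonneg N)]
    exact_mod_cast (by omega : (2 ^ t) ^ 2 ≤ 2 ^ 2 * N)
  have h8 : (8 : ℝ) ^ t = 2 ^ t * 4 ^ t := by rw [← mul_pow]; norm_num
  have h4 : (4 : ℝ) ^ t ≤ 4 * N := by exact_mod_cast ht4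
  have h' : (meetCount I J : ℝ) ≤
      16 * (27 + 3888 * (11 + 3888)) * 3888 * (8 ^ t + k * 4 ^ t) := by exact_mod_cast h
  refine h'.trans ?_
  rw [h8]
  calc _ ≤ (16 * (27 + 3888 * (11 + 3888)) * 3888 : ℝ) * (2 * √N * (4 * N) + k * (4 * N)) := by
        gcongr
    _ ≤ _ := by
      rw [meetConst]
      push_cast
      have : (0 : ℝ) ≤ k * N := by positivity
      nlinarith

end Lines

end Incidence

section Families
variable {F K : Type*} [Field F] [Field K] [Algebra F K]

/-- The line attached to `(d, f, h)`, after a generic change of coordinates. -/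
noncomputable def genericLine (a b c : K) (s : F × F × F) : K × K × K :=
  let w := 1 + c * algebraMap F K s.2.1
  ((algebraMap F K s.1 + a * algebraMap F K s.2.1 + b * algebraMap F K s.2.2) / w,
    algebraMap F K s.2.2 / w, algebraMap F K s.2.1 / w)

/-- The coefficients `a, b, c` are generic over the field `F`. -/
structure Generic (F : Type*) {K : Type*} [Field F] [Field K] [Algebra F K] (a b c : K) : Prop where
  ne_zero (f : F) : 1 + c * algebraMap F K f ≠ 0
  inj (s s' : F × F × F) : (algebraMap F K s.1 + a * algebraMap F K s.2.1 + b * algebraMap F K s.2.2)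
      * (1 + c * algebraMap F K s'.2.1) =
    (algebraMap F K s'.1 + a * algebraMap F K s'.2.1 + b * algebraMap F K s'.2.2)
      * (1 + c * algebraMap F K s.2.1) → s = s'

theorem Generic.fst_injective {a b c : K} (h : Generic F a b c) :
    Function.Injective fun s : F × F × F => (genericLine a b c s).1 := fun s s' hs => by
  refine h.inj s s' ?_
  simp only [genericLine] at hs
  rwa [div_eq_div_iff (h.ne_zero _) (h.ne_zero _)] at hs

theorem Generic.meets {a b c : K} (h : Generic F a b c) (h' : Generic F a c b) {s t : F × F × F}
    (hst : s.2.2 + s.2.1 * t.1 = t.2.2 + t.2.1 * s.1) :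
    Meets (genericLine a b c s) (genericLine a c b t) := by
  have h1 := h.ne_zero s.2.1
  have h2 := h'.ne_zero t.2.1
  have h3 := congr(algebraMap F K $hst)
  simp only [map_add, map_mul] at h3
  simp only [Meets, genericLine]
  rw [div_mul_div_comm, div_mul_div_comm, div_add_div _ _ h1 (mul_ne_zero h1 h2),
    div_add_div _ _ h2 (mul_ne_zero h2 h1), div_eq_div_iff (by simp [h1, h2]) (by simp [h1, h2])]
  linear_combination (1 + c * algebraMap F K s.2.1) ^ 2 * (1 + b * algebraMap F K t.2.1) ^ 2 * h3

/-- Solutions of a system defining a line on a quadric are collinear. -/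
theorem Generic.collinear {a b c : K} (h : Generic F a b c) {q₁ q₂ q₃ q₄ : K}
    {T : Set (F × F × F)} (hT : ∀ s ∈ T, (genericLine a b c s).2.1 = q₁ + q₂ * (genericLine a b c s).1 ∧
      (genericLine a b c s).2.2 = q₃ + q₄ * (genericLine a b c s).1)
    {s₀ s₁ s₂ s₃ : F × F × F} (h₀ : s₀ ∈ T) (h₁ : s₁ ∈ T) (h₂ : s₂ ∈ T) (h₃ : s₃ ∈ T) :
    (s₁.1 - s₀.1) * (s₃.2.1 - s₂.2.1) = (s₁.2.1 - s₀.2.1) * (s₃.1 - s₂.1) ∧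
    (s₁.1 - s₀.1) * (s₃.2.2 - s₂.2.2) = (s₁.2.2 - s₀.2.2) * (s₃.1 - s₂.1) ∧
    (s₁.2.1 - s₀.2.1) * (s₃.2.2 - s₂.2.2) = (s₁.2.2 - s₀.2.2) * (s₃.2.1 - s₂.2.1) := by
  let P (s : F × F × F) : K := 1 + c * algebraMap F K s.2.1
  let Q (s : F × F × F) : K :=
    algebraMap F K s.1 + a * algebraMap F K s.2.1 + b * algebraMap F K s.2.2
  have hh (s) (hs : s ∈ T) : algebraMap F K s.2.2 = q₁ * P s + q₂ * Q s := by
    have := (hT s hs).1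
    have h0 := h.ne_zero s.2.1
    simp only [genericLine] at this
    rwa [div_eq_iff h0, add_mul, mul_assoc, div_mul_cancel₀ _ h0] at this
  have hf (s) (hs : s ∈ T) : algebraMap F K s.2.1 = q₃ * P s + q₄ * Q s := by
    have := (hT s hs).2
    have h0 := h.ne_zero s.2.1
    simp only [genericLine] at this
    rwa [div_eq_iff h0, add_mul, mul_assoc, div_mul_cancel₀ _ h0] at this
  have hd (s) (hs : s ∈ T) : algebraMap F K s.1 = Q s - a * (q₃ * P s + q₄ * Q s)
      - b * (q₁ * P s + q₂ * Q s) := by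
    rw [← hh s hs, ← hf s hs]; simp only [Q]; ring
  have h1 (s) (hs : s ∈ T) : (1 - c * q₃) * P s - c * q₄ * Q s = 1 := by
    have := hf s hs
    simp only [P] at this ⊢
    linear_combination c * this
  have hPQ : (P s₁ - P s₀) * (Q s₃ - Q s₂) = (Q s₁ - Q s₀) * (P s₃ - P s₂) := by
    have e1 : (1 - c * q₃) * (P s₁ - P s₀) = c * q₄ * (Q s₁ - Q s₀) := by
      linear_combination h1 s₁ h₁ - h1 s₀ h₀
    have e2 : (1 - c * q₃) * (P s₃ - P s₂) = c * q₄ * (Q s₃ - Q s₂) := by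
      linear_combination h1 s₃ h₃ - h1 s₂ h₂
    by_cases hz : 1 - c * q₃ = 0
    · have hz' : c * q₄ ≠ 0 := fun h0 => by have := h1 s₀ h₀; simp [hz, h0] at this
      refine mul_left_cancel₀ hz' ?_
      linear_combination (P s₃ - P s₂) * e1 - (P s₁ - P s₀) * e2
    · refine mul_left_cancel₀ hz ?_
      linear_combination (Q s₃ - Q s₂) * e1 - (Q s₁ - Q s₀) * e2
  refine ⟨(algebraMap F K).injective ?_, (algebraMap F K).injective ?_,
    (algebraMap F K).injective ?_⟩ <;>
  simp only [map_mul, map_sub, hh _ h₀, hh _ h₁, hh _ h₂, hh _ h₃, hf _ h₀, hf _ h₁, hf _ h₂,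
    hf _ h₃, hd _ h₀, hd _ h₁, hd _ h₂, hd _ h₃]
  · linear_combination -(q₃ + b * q₁ * q₄ - b * q₂ * q₃) * hPQ
  · linear_combination -(q₁ + a * q₃ * q₂ - a * q₄ * q₁) * hPQ
  · linear_combination (q₃ * q₂ - q₄ * q₁) * hPQ

variable [DecidableEq K]

/-- The lines attached to the triples `(d, f, g d f + v)`. -/
noncomputable def lineFamily (a b c : K) (g : F → F → F) (D A U : Finset F) : Finset (K × K × K) :=
  (D ×ˢ A ×ˢ U).image fun s => genericLine a b c (s.1, s.2.1, g s.1 s.2.1 + s.2.2)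

theorem card_lineFamily_le (a b c : K) (g : F → F → F) (D A U : Finset F) :
    #(lineFamily a b c g D A U) ≤ #D * #A * #U := by
  refine card_image_le.trans ?_
  simp [mul_assoc]

theorem Generic.spread_lineFamily {a b c : K} (h : Generic F a b c) (g : F → F → F)
    (D A U : Finset F) (hD : D.Nonempty) : Spread (#D + #A + #U) (lineFamily a b c g D A U) := by
  refine ⟨?_, fun q₁ q₂ q₃ q₄ => ?_⟩
  · intro l hl l' hl' hll
    simp only [lineFamily, coe_image, Set.mem_image] at hl hl'
    obtain ⟨s, -, rfl⟩ := hl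
    obtain ⟨s', -, rfl⟩ := hl'
    exact congrArg _ (h.fst_injective hll)
  let e (s : F × F × F) : F × F × F := (s.1, s.2.1, g s.1 s.2.1 + s.2.2)
  have he : Function.Injective e := by
    rintro ⟨d, f, v⟩ ⟨d', f', v'⟩ hs
    simp only [e, Prod.mk.injEq] at hs
    obtain ⟨rfl, rfl, hs⟩ := hs
    simpa using hs
  rw [lineFamily, filter_image]
  refine card_image_le.trans ?_
  set T := {s ∈ D ×ˢ A ×ˢ U | (genericLine a b c (e s)).2.1 = q₁ + q₂ * (genericLine a b c (e s)).1 ∧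
      (genericLine a b c (e s)).2.2 = q₃ + q₄ * (genericLine a b c (e s)).1} with hT
  change #T ≤ _
  have hTD : ∀ s ∈ T, s.1 ∈ D ∧ s.2.1 ∈ A ∧ s.2.2 ∈ U := fun s hs => by
    simpa using (mem_filter.1 hs).1
  have hcol := fun s₀ s₁ s₂ s₃ (h₀ : s₀ ∈ T) (h₁ : s₁ ∈ T) (h₂ : s₂ ∈ T) (h₃ : s₃ ∈ T) =>
    h.collinear (q₁ := q₁) (q₂ := q₂) (q₃ := q₃) (q₄ := q₄) (T := e '' T) (by
      rintro _ ⟨s, hs, rfl⟩; exact (mem_filter.1 hs).2)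
      (Set.mem_image_of_mem e h₀) (Set.mem_image_of_mem e h₁) (Set.mem_image_of_mem e h₂)
      (Set.mem_image_of_mem e h₃)
  have hDpos := hD.card_pos
  by_cases hsmall : #T ≤ 1
  · omega
  obtain ⟨s₀, h₀, s₁, h₁, hne⟩ := one_lt_card.1 (not_le.1 hsmall)
  have hne' := he.ne hne
  by_cases hd : (e s₁).1 - (e s₀).1 = 0
  · by_cases hf : (e s₁).2.1 - (e s₀).2.1 = 0
    · have hh : (e s₁).2.2 - (e s₀).2.2 ≠ 0 := fun hh => hne' (by
        ext <;> [exact (sub_eq_zero.1 hd).symm; exact (sub_eq_zero.1 hf).symm;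
          exact (sub_eq_zero.1 hh).symm])
      refine (card_le_card_of_injOn (fun s => s.2.2) (t := U) (fun s hs => (hTD s hs).2.2) ?_).trans
        (by omega)
      intro s hs s' hs' hss
      obtain ⟨-, c2, c3⟩ := hcol s₀ s₁ s s' h₀ h₁ hs hs'
      rw [hd, zero_mul, eq_comm, mul_eq_zero] at c2
      rw [hf, zero_mul, eq_comm, mul_eq_zero] at c3
      have e1 := sub_eq_zero.1 (c2.resolve_left hh)
      have e2 := sub_eq_zero.1 (c3.resolve_left hh)
      exact Prod.ext e1.symm (Prod.ext e2.symm hss)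
    · refine (card_le_card_of_injOn (fun s => s.2.1) (t := A) (fun s hs => (hTD s hs).2.1) ?_).trans
        (by omega)
      intro s hs s' hs' hss
      obtain ⟨c1, -, c3⟩ := hcol s₀ s₁ s s' h₀ h₁ hs hs'
      have h0 : (e s').2.1 - (e s).2.1 = 0 := sub_eq_zero.2 hss.symm
      rw [h0, mul_zero, eq_comm, mul_eq_zero] at c1
      rw [h0, mul_zero, mul_eq_zero] at c3
      exact (he (Prod.ext (sub_eq_zero.1 (c1.resolve_left hf)) (Prod.ext hss.symm
        (sub_eq_zero.1 (c3.resolve_left hf))))).symm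
  · refine (card_le_card_of_injOn (fun s => s.1) (t := D) (fun s hs => (hTD s hs).1) ?_).trans
      (by omega)
    intro s hs s' hs' hss
    obtain ⟨c1, c2, -⟩ := hcol s₀ s₁ s s' h₀ h₁ hs hs'
    have h0 : (e s').1 - (e s).1 = 0 := sub_eq_zero.2 hss.symm
    rw [h0, mul_zero, mul_eq_zero] at c1 c2
    exact (he (Prod.ext hss.symm (Prod.ext (sub_eq_zero.1 (c1.resolve_left hd))
      (sub_eq_zero.1 (c2.resolve_left hd))))).symm

end Families

section Transcendental
open Polynomial
variable (F : Type*) [Field F]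

theorem generic_of_polynomial {a b c : F[X]} (hc : c.coeff 0 = 0)
    (hinj : ∀ s s' : F × F × F, (C s.1 + a * C s.2.1 + b * C s.2.2) * (1 + c * C s'.2.1) =
      (C s'.1 + a * C s'.2.1 + b * C s'.2.2) * (1 + c * C s.2.1) → s = s') :
    Generic F (algebraMap F[X] (FractionRing F[X]) a) (algebraMap F[X] (FractionRing F[X]) b)
      (algebraMap F[X] (FractionRing F[X]) c) := by
  have h := IsFractionRing.injective F[X] (FractionRing F[X])
  have hC (f : F) : algebraMap F (FractionRing F[X]) f = algebraMap F[X] (FractionRing F[X]) (C f) :=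
    IsScalarTower.algebraMap_apply F F[X] _ f
  constructor
  · intro f h0
    rw [hC, ← map_mul, ← map_one (algebraMap F[X] (FractionRing F[X])), ← map_add,
      map_eq_zero_iff _ h] at h0
    have := congr(coeff $h0 0)
    simp [hc] at this
  · intro s s' hs
    simp only [hC] at hs
    rw [← map_one (algebraMap F[X] (FractionRing F[X]))] at hs
    simp only [← map_mul, ← map_add] at hs
    exact hinj s s' (h hs)

theorem generic_X : Generic F (algebraMap F[X] (FractionRing F[X]) X)
    (algebraMap F[X] (FractionRing F[X]) (X ^ 2)) (algebraMap F[X] (FractionRing F[X]) (X ^ 3)) := by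
  refine generic_of_polynomial F (by simp) ?_
  rintro ⟨d, f, h⟩ ⟨d', f', h'⟩ hs
  have e (d f h f' : F) : (C d + X * C f + X ^ 2 * C h) * (1 + X ^ 3 * C f') =
    C d + C f * X + C h * X ^ 2 + C (d * f') * X ^ 3 + C (f * f') * X ^ 4 + C (h * f') * X ^ 5 := by
    simp only [map_mul]; ring
  simp only [e] at hs
  have h0 := congr(coeff $hs 0)
  have h1 := congr(coeff $hs 1)
  have h2 := congr(coeff $hs 2)
  simp only [coeff_add, coeff_C_mul, coeff_X_pow, coeff_X, coeff_C] at h0 h1 h2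
  norm_num at h0 h1 h2
  simp [h0, h1, h2]

theorem generic_X_swap : Generic F (algebraMap F[X] (FractionRing F[X]) X)
    (algebraMap F[X] (FractionRing F[X]) (X ^ 3)) (algebraMap F[X] (FractionRing F[X]) (X ^ 2)) := by
  refine generic_of_polynomial F (by simp) ?_
  rintro ⟨d, f, h⟩ ⟨d', f', h'⟩ hs
  have e (d f h f' : F) : (C d + X * C f + X ^ 3 * C h) * (1 + X ^ 2 * C f') =
    C d + C f * X + C (d * f') * X ^ 2 + C (h + f * f') * X ^ 3 + C (h * f') * X ^ 5 := by
    simp only [map_mul, map_add]; ring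
  simp only [e] at hs
  have h0 := congr(coeff $hs 0)
  have h1 := congr(coeff $hs 1)
  have h3 := congr(coeff $hs 3)
  simp only [coeff_add, coeff_C_mul, coeff_X_pow, coeff_X, coeff_C] at h0 h1 h3
  norm_num at h0 h1 h3
  subst h0 h1
  rw [mul_comm f] at h3
  simpa using h3

end Transcendental

theorem meetCount_eq_card {K : Type*} [Field K] [DecidableEq K] (I J : Finset (K × K × K)) :
    meetCount I J = #{q ∈ I ×ˢ J | Meets q.1 q.2} := by
  simp only [meetCount, card_filter, sum_product]

section SquareEnergy
variable {F K : Type*} [Field F] [DecidableEq F] [Field K] [DecidableEq K] [Algebra F K]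

theorem Generic.sq_energy_le_meetCount {a b c : K} (h : Generic F a b c) (h' : Generic F a c b)
    (h2 : (2 : F) ≠ 0) (A U : Finset F) :
    #A ^ 2 * #{q ∈ (A ×ˢ A) ×ˢ U ×ˢ U | q.2.1 - q.2.2 = q.1.1 ^ 2 - q.1.2 ^ 2} ≤
      meetCount (lineFamily a b c (fun d f => d ^ 2 - f ^ 2) (A - A) A U)
        (lineFamily a c b (fun e f => (e ^ 2 - f ^ 2) / 4) ((A - A).image (-2 * ·))
          (A.image (-2 * ·)) U) := by
  have h4 : (4 : F) ≠ 0 := by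
    rw [show (4 : F) = 2 * 2 by norm_num]; exact mul_ne_zero h2 h2
  rw [meetCount_eq_card, sq, ← card_product, ← card_product]
  let φ (r : (F × F) × (F × F) × F × F) : (F × F × F) × F × F × F :=
    ((r.2.1.1 - r.1.1, r.1.2, (r.2.1.1 - r.1.1) ^ 2 - r.1.2 ^ 2 + r.2.2.2),
      (-2 * (r.2.1.2 - r.1.2), -2 * r.1.1,
        ((-2 * (r.2.1.2 - r.1.2)) ^ 2 - (-2 * r.1.1) ^ 2) / 4 + r.2.2.1))
  refine card_le_card_of_injOn (fun r => (genericLine a b c (φ r).1, genericLine a c b (φ r).2))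
    ?_ ?_
  · rintro ⟨⟨x, y⟩, ⟨s, t⟩, u, v⟩ hr
    simp only [coe_product, coe_filter, Set.mem_prod, mem_coe, Set.mem_ofPred_eq, mem_product] at hr
    obtain ⟨⟨hx, hy⟩, ⟨⟨hs, ht⟩, hu, hv⟩, heq⟩ := hr
    refine mem_coe.2 (mem_filter.2 ⟨mem_product.2 ⟨mem_image.2 ⟨(s - x, y, v), ?_, rfl⟩,
      mem_image.2 ⟨(-2 * (t - y), -2 * x, u), ?_, rfl⟩⟩, h.meets h' ?_⟩)
    · simp [hy, hv, sub_mem_sub hs hx]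
    · simp only [mem_product]
      exact ⟨mem_image_of_mem _ (sub_mem_sub ht hy), mem_image_of_mem _ hx, hu⟩
    · simp only [φ]
      field_simp
      linear_combination (-4 : F) * heq
  · rintro ⟨⟨x, y⟩, ⟨s, t⟩, u, v⟩ - ⟨⟨x', y'⟩, ⟨s', t'⟩, u', v'⟩ - hr
    obtain ⟨e1, e2⟩ := Prod.ext_iff.1 hr
    have e1 := h.fst_injective congr(Prod.fst $e1)
    have e2 := h'.fst_injective congr(Prod.fst $e2)
    simp only [φ, Prod.mk.injEq, mul_right_inj' (neg_ne_zero.2 h2)] at e1 e2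
    obtain ⟨f1, rfl, f2⟩ := e1
    obtain ⟨g1, rfl, g2⟩ := e2
    simp_all

theorem sq_energy_le {p : ℕ} [CharP K p] [Infinite K] {a b c : K} (h : Generic F a b c)
    (h' : Generic F a c b) (h2 : (2 : F) ≠ 0) {A U : Finset F} (hA : A.Nonempty)
    (hU : U.Nonempty) (hp : 324 * (#(A - A) * #A * #U) < p ^ 2) :
    (#A : ℝ) ^ 2 * #{q ∈ (A ×ˢ A) ×ˢ U ×ˢ U | q.2.1 - q.2.2 = q.1.1 ^ 2 - q.1.2 ^ 2} ≤
      meetConst * ((#(A - A) * #A * #U) * √(#(A - A) * #A * #U) +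
        (#(A - A) + #A + #U) * (#(A - A) * #A * #U)) := by
  have hD : (A - A).Nonempty := hA.sub hA
  have hcard (B : Finset F) : #(B.image (-2 * ·)) = #B :=
    card_image_of_injective _ (mul_right_injective₀ (neg_ne_zero.2 h2))
  have hN : 1 ≤ #(A - A) * #A * #U := Nat.mul_pos (Nat.mul_pos hD.card_pos hA.card_pos) hU.card_pos
  have hJ := h'.spread_lineFamily (fun e f => (e ^ 2 - f ^ 2) / 4) ((A - A).image (-2 * ·))
    (A.image (-2 * ·)) U (hD.image _)
  have hJc := card_lineFamily_le a c b (fun e f => (e ^ 2 - f ^ 2) / 4) ((A - A).image (-2 * ·))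
    (A.image (-2 * ·)) U
  rw [hcard, hcard] at hJ hJc
  have := meetCount_le (p := p) (by have := hA.card_pos; omega) hN hp
    (h.spread_lineFamily (fun d f => d ^ 2 - f ^ 2) (A - A) A U hD) hJ
    (card_lineFamily_le a b c _ _ _ _) hJc
  push_cast at this
  refine le_trans ?_ this
  exact_mod_cast h.sq_energy_le_meetCount h' h2 A U

end SquareEnergy

theorem rep_le {p : ℕ} (A : Finset (ZMod p)) (x : ZMod p) :
    rep A x ≤ #{q ∈ A ×ˢ A | x = q.1 ^ 2 - q.2 ^ 2} := by
  refine (card_le_card ?_).trans (card_image_le (f := fun q : ZMod p × ZMod p => (q.1 ^ 2, q.2 ^ 2)))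
  rintro ⟨y, z⟩ hq
  simp only [sqSet, mem_filter, mem_product, mem_image] at hq ⊢
  obtain ⟨⟨⟨y, hy, rfl⟩, z, hz, rfl⟩, hx⟩ := hq
  exact ⟨(y, z), ⟨⟨hy, hz⟩, hx.symm⟩, rfl⟩

theorem Tw_mul_le {p : ℕ} (A : Finset (ZMod p)) (w : ZMod p) :
    (Tw A w : ℝ) * ((#A : ℝ) ^ 2 / (2 * #(sqDiff A))) ≤
      #{q ∈ (A ×ˢ A) ×ˢ Pw A w ×ˢ Pw A w | q.2.1 - q.2.2 = q.1.1 ^ 2 - q.1.2 ^ 2} := by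
  have hE : #{q ∈ (A ×ˢ A) ×ˢ Pw A w ×ˢ Pw A w | q.2.1 - q.2.2 = q.1.1 ^ 2 - q.1.2 ^ 2} =
      ∑ r ∈ Pw A w ×ˢ Pw A w, #{q ∈ A ×ˢ A | r.1 - r.2 = q.1 ^ 2 - q.2 ^ 2} := by
    simp only [card_filter, sum_product_right]
  rw [hE, Nat.cast_sum, Tw, ← nsmul_eq_mul, ← sum_const]
  refine (sum_le_sum fun r hr => ?_).trans
    (sum_le_sum_of_subset_of_nonneg (filter_subset _ _) fun _ _ _ => Nat.cast_nonneg _)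
  refine ((mem_filter.1 (mem_filter.1 hr).2).2).trans ?_
  exact_mod_cast rep_le A _

theorem card_sqDiff_le {p : ℕ} (A : Finset (ZMod p)) : #(sqDiff A) ≤ #A ^ 2 := by
  rw [sq]
  exact card_sub_le.trans (Nat.mul_le_mul card_image_le card_image_le)

/-- Rearranging the incidence bound into the normalised form. -/
theorem normalise_bound {n D S U T B : ℝ} (hn : 0 < n) (hS : 0 < S) (hU : 0 ≤ U) (hB : 0 ≤ B)
    (hnD : n ≤ D) (hUn : U ≤ n ^ 2)
    (h : n ^ 2 * (T * (n ^ 2 / (2 * S))) ≤ B * ((D * n * U) * √(D * n * U) +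
      (D + n + U) * (D * n * U))) :
    T ≤ 4 * B * ((D / n) ^ ((3 : ℝ) / 2) * (S / n) * U ^ ((3 : ℝ) / 2) +
      (D / n) ^ 2 * (S / n) * U) := by
  have hrpow (x : ℝ) (hx : 0 ≤ x) : x ^ ((3 : ℝ) / 2) = x * √x := by
    rw [show (3 : ℝ) / 2 = 1 + 1 / 2 by norm_num, Real.rpow_add' hx (by norm_num), Real.rpow_one,
      Real.sqrt_eq_rpow]
  have hD : 0 < D := hn.trans_le hnD
  obtain ⟨M, rfl⟩ : ∃ M, D = M * n := ⟨D / n, by field_simp⟩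
  have hM : 1 ≤ M := by nlinarith
  have hM0 : 0 ≤ M := zero_le_one.trans hM
  rw [mul_div_cancel_right₀ _ hn.ne', hrpow M hM0, hrpow U hU]
  have hs : √(M * n * n * U) = √M * √U * n := by
    rw [show M * n * n * U = M * U * n ^ 2 by ring, Real.sqrt_mul (by positivity),
      Real.sqrt_mul hM0, Real.sqrt_sq hn.le]
  rw [hs] at h
  have hsU : √U ≤ n := Real.sqrt_le_iff.2 ⟨hn.le, hUn⟩
  have hsM : 1 ≤ √M := Real.one_le_sqrt.2 hM
  have hUU : U * n ≤ √M * √U * n ^ 2 := by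
    calc U * n = √U * √U * n := by rw [Real.mul_self_sqrt hU]
      _ ≤ √U * n * n := by gcongr
      _ = 1 * √U * n ^ 2 := by ring
      _ ≤ √M * √U * n ^ 2 := by gcongr
  have hmain : (M * n * n * U) * (√M * √U * n) + (M * n + n + U) * (M * n * n * U) ≤
      2 * n ^ 3 * (M * √M * (U * √U) + M ^ 2 * U) := by
    have e1 : n * (M * n * n * U) ≤ M * n * (M * n * n * U) := by gcongr
    have e2 : U * (M * n * n * U) ≤ M * n * U * (√M * √U * n ^ 2) := by
      calc U * (M * n * n * U) = M * n * U * (U * n) := by ring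
        _ ≤ _ := by gcongr
    linarith
  have hfin : n ^ 4 * T ≤ 4 * B * S * n ^ 3 * (M * √M * (U * √U) + M ^ 2 * U) := by
    have h1 := h.trans (mul_le_mul_of_nonneg_left hmain hB)
    have h2 := mul_le_mul_of_nonneg_left h1 (by positivity : 0 ≤ 2 * S)
    calc n ^ 4 * T = 2 * S * (n ^ 2 * (T * (n ^ 2 / (2 * S)))) := by field_simp
      _ ≤ _ := h2
      _ = _ := by ring
  refine le_of_mul_le_mul_left (hfin.trans_eq ?_) (by positivity : 0 < n ^ 4)
  field_simp

/-- There exist absolute constants `C, c > 0` such that for every prime `p` and every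
nonempty `A ⊆ 𝔽_p` with `|A-A|·|A|·|A²-A²| ≤ c·p²`, for every `w ∈ A²-A²`,
`T_w ≤ C·(M^{3/2}·K·|P_w|^{3/2} + M²·K·|P_w|)` with `M = |A-A|/|A|`, `K = |A²-A²|/|A|`. -/
theorem Tw_upper :
    ∃ C c : ℝ, 0 < C ∧ 0 < c ∧
      ∀ (p : ℕ), p.Prime →
        ∀ A : Finset (ZMod p), A.Nonempty →
          (((A - A).card : ℝ) * (A.card : ℝ) * ((sqDiff A).card : ℝ) ≤ c * (p : ℝ) ^ 2) →
          ∀ w ∈ sqDiff A,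
            (Tw A w : ℝ) ≤
              C * ((((A - A).card : ℝ) / (A.card : ℝ)) ^ ((3 : ℝ) / 2)
                    * (((sqDiff A).card : ℝ) / (A.card : ℝ))
                    * ((Pw A w).card : ℝ) ^ ((3 : ℝ) / 2)
                  + (((A - A).card : ℝ) / (A.card : ℝ)) ^ 2
                    * (((sqDiff A).card : ℝ) / (A.card : ℝ))
                    * ((Pw A w).card : ℝ)) := by
  classical
  refine ⟨4 * (meetConst + 1), 1 / 648, by positivity, by norm_num, ?_⟩
  intro p hp A hA hsize w hw
  have : Fact p.Prime := ⟨hp⟩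
  have hS : 0 < #(sqDiff A) := card_pos.2 ⟨w, hw⟩
  have hUS : #(Pw A w) ≤ #(sqDiff A) := card_le_card inter_subset_left
  obtain hU | hU := (Pw A w).eq_empty_or_nonempty
  · rw [Tw, hU]
    simp only [product_empty, filter_empty, card_empty, Nat.cast_zero]
    positivity
  have hD : 0 < #(A - A) := (hA.sub hA).card_pos
  have hsize' : 648 * (#(A - A) * #A * #(sqDiff A)) ≤ p ^ 2 := by
    have : (648 : ℝ) * (#(A - A) * #A * #(sqDiff A)) ≤ p ^ 2 := by linarith
    exact_mod_cast this
  have hpos : 0 < #(A - A) * #A * #(sqDiff A) := Nat.mul_pos (Nat.mul_pos hD hA.card_pos) hS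
  have h2 : (2 : ZMod p) ≠ 0 := by
    intro h
    have : p ≤ 2 := Nat.le_of_dvd (by norm_num)
      ((ZMod.natCast_eq_zero_iff 2 p).1 (by exact_mod_cast h))
    nlinarith
  have hlt : 324 * (#(A - A) * #A * #(Pw A w)) < p ^ 2 := by
    have := Nat.mul_le_mul_left (#(A - A) * #A) hUS
    omega
  have : CharP (FractionRing (Polynomial (ZMod p))) p :=
    charP_of_injective_algebraMap (algebraMap (ZMod p) _).injective p
  have : Infinite (FractionRing (Polynomial (ZMod p))) :=
    Infinite.of_injective _ (IsFractionRing.injective (Polynomial (ZMod p)) _)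
  have key := sq_energy_le (p := p) (generic_X (ZMod p)) (generic_X_swap (ZMod p)) h2 hA hU hlt
  refine normalise_bound (by exact_mod_cast hA.card_pos) (by exact_mod_cast hS) (by positivity)
    (by positivity) (by exact_mod_cast card_le_card_sub_self)
    (by exact_mod_cast hUS.trans (card_sqDiff_le A)) ?_
  refine (mul_le_mul_of_nonneg_left (Tw_mul_le A w) (by positivity)).trans (key.trans ?_)
  gcongr
  linarith

end FpSumProd
end
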